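/- For 0 ≤ λ ≤ 1 there exist constants C > 0 and δ > 0, independent of K, ε and t, such that: if ψ is a solution as in the context satisfying the bootstrap bound E_N(ψ)(t) ≤ K²ε² for all t ≥ 0 and Kε ≤ δ, then for every 0 ≤ l ≤ N−1 and every t ≥ 0, Σ_{|b|≤l} ‖⟨r−t⟩ ∇∂Γ^b ψ(t,·)‖ ≤ C Σ_{|c|≤l+1} ‖∂Γ^c ψ(t,·)‖ + C(1+t)^{1−λ} Σ_{|c|≤l} ‖∇Γ^c ψ(t,·)‖ + C(1+t)^{−1} Σ_{|c|≤l} ‖Γ^c ψ(t,·)‖. -/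

import Mathlib

noncomputable section
open MeasureTheory Real Set

/-- Euclidean space ℝ³. -/
abbrev E3 : Type := EuclideanSpace ℝ (Fin 3)
/-- A space-time point (t, x) ∈ ℝ × ℝ³. -/
abbrev Pt : Type := ℝ × E3

/-- Time derivative ∂ₜ. -/
def dt (f : Pt → ℝ) (p : Pt) : ℝ := fderiv ℝ f p (1, 0)
/-- Spatial derivative ∂ᵢ. -/
def dxi (i : Fin 3) (f : Pt → ℝ) (p : Pt) : ℝ := fderiv ℝ f p (0, EuclideanSpace.single i 1)

/-- The vector fields Γ = (∂ₜ, ∂₁, ∂₂, ∂₃, Ω₁, Ω₂, Ω₃, S), where Ω = x ∧ ∇ are the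
rotations and S = t∂ₜ + Σ xₖ∂ₖ is the scaling field. -/
def Gam : Fin 8 → (Pt → ℝ) → Pt → ℝ :=
  ![dt, dxi 0, dxi 1, dxi 2,
    fun f p => p.2 1 * dxi 2 f p - p.2 2 * dxi 1 f p,
    fun f p => p.2 2 * dxi 0 f p - p.2 0 * dxi 2 f p,
    fun f p => p.2 0 * dxi 1 f p - p.2 1 * dxi 0 f p,
    fun f p => p.1 * dt f p + ∑ k, p.2 k * dxi k f p]

/-- The composition Γ^a corresponding to a word `a` in the eight fields. -/
def GamWord : List (Fin 8) → (Pt → ℝ) → Pt → ℝ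
  | [], f => f
  | k :: l, f => Gam k (GamWord l f)

/-- The first-order derivatives ∂ = (∂ₜ, ∂₁, ∂₂, ∂₃). -/
def Dop : Fin 4 → (Pt → ℝ) → Pt → ℝ := ![dt, dxi 0, dxi 1, dxi 2]

/-- The composition ∂^a corresponding to a word `a` in the four derivatives. -/
def DWord : List (Fin 4) → (Pt → ℝ) → Pt → ℝ
  | [], f => f
  | k :: l, f => Dop k (DWord l f)

/-- L² norm in the space variable. -/
def L2norm (f : E3 → ℝ) : ℝ := Real.sqrt (∫ x : E3, (f x) ^ 2)

/-- The d'Alembertian □ = ∂ₜ² - Δ. -/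
def box (f : Pt → ℝ) (p : Pt) : ℝ :=
  dt (fun q => dt f q) p - ∑ i, dxi i (fun q => dxi i f q) p

/-- The square of the sound speed, expressed through ψ:
`c²(ρ) = 1 - (γ-1)[(1+t)^λ ∂ₜψ + λ(1+t)^{λ-1}ψ + μψ + (1+t)^{2λ}|∇ψ|²/2]`. -/
def csq (μ lam γ : ℝ) (ψ : Pt → ℝ) (p : Pt) : ℝ :=
  1 - (γ - 1) * ((1 + p.1) ^ lam * dt ψ p + lam * (1 + p.1) ^ (lam - 1) * ψ p
    + μ * ψ p + (1 + p.1) ^ (2 * lam) * (∑ i, (dxi i ψ p) ^ 2) / 2)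

/-- The quadratic error term `Q(ψ) = (c²(ρ)-1)Δψ - 2(1+t)^λ ∂ₜ∇ψ·∇ψ
- 2λ(1+t)^{λ-1}|∇ψ|² - μ|∇ψ|² - (1+t)^{2λ} Σ (∂ᵢψ)(∂ⱼψ)∂ᵢⱼψ`. -/
def Qpsi (μ lam γ : ℝ) (ψ : Pt → ℝ) (p : Pt) : ℝ :=
  (csq μ lam γ ψ p - 1) * (∑ i, dxi i (fun q => dxi i ψ q) p)
    - 2 * (1 + p.1) ^ lam * ∑ i, dxi i (fun q => dt ψ q) p * dxi i ψ p
    - 2 * lam * (1 + p.1) ^ (lam - 1) * ∑ i, (dxi i ψ p) ^ 2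
    - μ * ∑ i, (dxi i ψ p) ^ 2
    - (1 + p.1) ^ (2 * lam) *
        ∑ i, ∑ j, dxi i ψ p * dxi j ψ p * dxi i (fun q => dxi j ψ q) p

/-- ψ solves `□ψ + (μ/(1+t)^λ)∂ₜψ + (2λ/(1+t))∂ₜψ - (λ(1-λ)/(1+t)²)ψ = Q(ψ)` for `t ≥ 0`. -/
def psiEq (μ lam γ : ℝ) (ψ : Pt → ℝ) : Prop :=
  ∀ p : Pt, 0 ≤ p.1 →
    box ψ p + μ / (1 + p.1) ^ lam * dt ψ p + 2 * lam / (1 + p.1) * dt ψ p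
      - lam * (1 - lam) / (1 + p.1) ^ 2 * ψ p = Qpsi μ lam γ ψ p

/-- The time-weighted energy
`E_N(ψ)(t) = Σ_{|a|≤N} ∫ ((1+t)^{2λ}|∂Γ^aψ|² + |Γ^aψ|²) dx`. -/
def energy (lam : ℝ) (N : ℕ) (ψ : Pt → ℝ) (t : ℝ) : ℝ :=
  ∑ n ∈ Finset.range (N + 1), ∑ a : Fin n → Fin 8,
    ∫ x : E3, ((1 + t) ^ (2 * lam) *
        ∑ α : Fin 4, (Dop α (GamWord (List.ofFn a) ψ) (t, x)) ^ 2
      + (GamWord (List.ofFn a) ψ (t, x)) ^ 2)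


/-- smoothness -/
abbrev Sm (f : Pt → ℝ) : Prop := ContDiff ℝ (⊤ : ℕ∞) f

/-- spatial basis vectors -/
abbrev ev (i : Fin 3) : E3 := EuclideanSpace.single i 1

/-- rotation generator -/
def rotL (i j : Fin 3) : Pt →L[ℝ] Pt :=
  (ContinuousLinearMap.inr ℝ ℝ E3).comp
    (((EuclideanSpace.proj i : E3 →L[ℝ] ℝ).smulRight (ev j)
      - (EuclideanSpace.proj j : E3 →L[ℝ] ℝ).smulRight (ev i)).comp
      (ContinuousLinearMap.snd ℝ ℝ E3))

/-- linear part of the fields -/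
def Lk : Fin 8 → Pt →L[ℝ] Pt :=
  ![0, 0, 0, 0, rotL 1 2, rotL 2 0, rotL 0 1, ContinuousLinearMap.id ℝ Pt]

/-- constant part of the fields -/
def vk : Fin 8 → Pt :=
  ![(1, 0), (0, ev 0), (0, ev 1), (0, ev 2), 0, 0, 0, 0]

lemma e3_decomp (y : E3) : y = ∑ k, y k • ev k := by
  ext j
  fin_cases j <;> simp [Fin.sum_univ_three]

lemma fd_pair (A : Pt →L[ℝ] ℝ) (s : ℝ) (y : E3) :
    A (s, y) = s * A (1, 0) + ∑ k, y k * A (0, ev k) := by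
  have h : ((s, y) : Pt) = s • ((1, 0) : Pt) + ∑ k, y k • ((0, ev k) : Pt) := by
    apply Prod.ext
    · simp [Prod.fst_sum]
    · simp only [Prod.snd_add, Prod.snd_sum, Prod.smul_snd, smul_zero, zero_add]
      exact e3_decomp y
  rw [h, map_add, map_smul, map_sum]; simp only [map_smul, smul_eq_mul]

lemma Gam_eq (k : Fin 8) (f : Pt → ℝ) (p : Pt) :
    Gam k f p = fderiv ℝ f p (vk k + Lk k p) := by
  obtain ⟨s, y⟩ := p
  rw [← Prod.mk.eta (p := vk k + Lk k (s, y)), fd_pair]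
  fin_cases k <;> simp [Gam, vk, Lk, dt, dxi, rotL, Fin.sum_univ_three] <;> ring

lemma Dop_zero (f : Pt → ℝ) : Dop 0 f = dt f := rfl
lemma Dop_succ (i : Fin 3) (f : Pt → ℝ) : Dop i.succ f = dxi i f := by
  fin_cases i <;> rfl
lemma Dop_eq_Gam (α : Fin 4) (f : Pt → ℝ) : Dop α f = Gam (Fin.castLE (by norm_num) α) f := by
  fin_cases α <;> rfl
lemma dt_eq_Gam (f : Pt → ℝ) : dt f = Gam 0 f := rfl
lemma dxi_eq_Gam (i : Fin 3) (f : Pt → ℝ) : dxi i f = Gam (Fin.castLE (by norm_num) i.succ) f := by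
  fin_cases i <;> rfl

lemma Sm_dir {f : Pt → ℝ} (hf : Sm f) (v : Pt) : Sm (fun p => fderiv ℝ f p v) :=
  (hf.fderiv_right (m := (⊤ : ℕ∞)) (by simp)).clm_apply contDiff_const

lemma Sm_Gam {f : Pt → ℝ} (hf : Sm f) (k : Fin 8) : Sm (Gam k f) := by
  have : Gam k f = fun p => fderiv ℝ f p (vk k + Lk k p) := funext (Gam_eq k f)
  rw [this]
  exact (hf.fderiv_right (m := (⊤ : ℕ∞)) (by simp)).clm_apply
    (contDiff_const.add (Lk k).contDiff)

lemma Sm_GamWord {f : Pt → ℝ} (hf : Sm f) (a : List (Fin 8)) : Sm (GamWord a f) := by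
  induction a with
  | nil => exact hf
  | cons k l ih => exact Sm_Gam ih k

lemma Sm_dt {f : Pt → ℝ} (hf : Sm f) : Sm (dt f) := Sm_Gam hf 0
lemma Sm_dxi {f : Pt → ℝ} (hf : Sm f) (i : Fin 3) : Sm (dxi i f) := by
  rw [dxi_eq_Gam]; exact Sm_Gam hf _
lemma Sm_Dop {f : Pt → ℝ} (hf : Sm f) (i : Fin 4) : Sm (Dop i f) := by
  rw [Dop_eq_Gam]; exact Sm_Gam hf _

lemma Sm.da {f : Pt → ℝ} (hf : Sm f) (p : Pt) : DifferentiableAt ℝ f p :=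
  (hf.differentiable (by simp)) p

lemma GamWord_append (a b : List (Fin 8)) (f : Pt → ℝ) :
    GamWord (a ++ b) f = GamWord a (GamWord b f) := by
  induction a with
  | nil => rfl
  | cons k l ih => simp [GamWord, ih]

lemma Gam_mul {f g : Pt → ℝ} (hf : Sm f) (hg : Sm g) (k : Fin 8) :
    Gam k (fun p => f p * g p) = fun p => Gam k f p * g p + f p * Gam k g p := by
  funext p
  rw [Gam_eq, Gam_eq, Gam_eq, fderiv_fun_mul (hf.da p) (hg.da p)]
  simp; ring

lemma Gam_add {f g : Pt → ℝ} (hf : Sm f) (hg : Sm g) (k : Fin 8) :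
    Gam k (fun p => f p + g p) = fun p => Gam k f p + Gam k g p := by
  funext p
  rw [Gam_eq, Gam_eq, Gam_eq, fderiv_fun_add (hf.da p) (hg.da p)]
  simp

lemma Gam_smul {f : Pt → ℝ} (hf : Sm f) (c : ℝ) (k : Fin 8) :
    Gam k (fun p => c * f p) = fun p => c * Gam k f p := by
  funext p
  rw [Gam_eq, Gam_eq, fderiv_const_mul (hf.da p)]
  simp

lemma Sm_add {f g : Pt → ℝ} (hf : Sm f) (hg : Sm g) : Sm (fun p => f p + g p) := hf.add hg
lemma Sm_mul {f g : Pt → ℝ} (hf : Sm f) (hg : Sm g) : Sm (fun p => f p * g p) := hf.mul hg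
lemma Sm_smul {f : Pt → ℝ} (hf : Sm f) (c : ℝ) : Sm (fun p => c * f p) := contDiff_const.mul hf
lemma Sm_const (c : ℝ) : Sm (fun _ => c) := contDiff_const
lemma Sm_sum {ι : Type*} (s : Finset ι) {f : ι → Pt → ℝ} (hf : ∀ i, Sm (f i)) :
    Sm (fun p => ∑ i ∈ s, f i p) := ContDiff.sum (fun i _ => hf i)

lemma GW_add {f g : Pt → ℝ} (hf : Sm f) (hg : Sm g) (a : List (Fin 8)) :
    GamWord a (fun p => f p + g p) = fun p => GamWord a f p + GamWord a g p := by
  induction a with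
  | nil => rfl
  | cons k l ih => simp only [GamWord, ih]; exact Gam_add (Sm_GamWord hf l) (Sm_GamWord hg l) k

lemma GW_smul {f : Pt → ℝ} (hf : Sm f) (c : ℝ) (a : List (Fin 8)) :
    GamWord a (fun p => c * f p) = fun p => c * GamWord a f p := by
  induction a with
  | nil => rfl
  | cons k l ih => simp only [GamWord, ih]; exact Gam_smul (Sm_GamWord hf l) c k

lemma GW_zero (a : List (Fin 8)) : GamWord a (fun _ => (0:ℝ)) = fun _ => 0 := by
  have := GW_smul (Sm_const 0) 0 a
  simpa using this

lemma GW_sum {ι : Type*} (s : Finset ι) {f : ι → Pt → ℝ} (hf : ∀ i, Sm (f i)) (a : List (Fin 8)) :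
    GamWord a (fun p => ∑ i ∈ s, f i p) = fun p => ∑ i ∈ s, GamWord a (f i) p := by
  classical
  induction s using Finset.induction_on with
  | empty => simpa using GW_zero a
  | insert i s hi ih =>
    simp only [Finset.sum_insert hi]
    rw [GW_add (hf i) (Sm_sum s hf), ih]

/-- locality -/
lemma Gam_congr {U : Set Pt} (hU : IsOpen U) {f g : Pt → ℝ} (h : ∀ p ∈ U, f p = g p) (k : Fin 8) :
    ∀ p ∈ U, Gam k f p = Gam k g p := by
  intro p hp
  rw [Gam_eq, Gam_eq]
  have : f =ᶠ[nhds p] g := Filter.eventually_of_mem (hU.mem_nhds hp) h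
  rw [this.fderiv_eq]

lemma GW_congr {U : Set Pt} (hU : IsOpen U) {f g : Pt → ℝ} (h : ∀ p ∈ U, f p = g p)
    (a : List (Fin 8)) : ∀ p ∈ U, GamWord a f p = GamWord a g p := by
  induction a with
  | nil => exact h
  | cons k l ih => exact Gam_congr hU ih k

/-- commutator of a constant-direction derivative with `Gam k` -/
lemma dir_Gam {f : Pt → ℝ} (hf : Sm f) (k : Fin 8) (v : Pt) (p : Pt) :
    fderiv ℝ (Gam k f) p v
      = Gam k (fun q => fderiv ℝ f q v) p + fderiv ℝ f p (Lk k v) := by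
  have h1 : Gam k f = fun p => fderiv ℝ f p (vk k + Lk k p) := funext (Gam_eq k f)
  have hd : DifferentiableAt ℝ (fderiv ℝ f) p :=
    ((hf.fderiv_right (m := (⊤ : ℕ∞)) (by simp)).differentiable (by simp)) p
  have hV : HasFDerivAt (fun q => vk k + Lk k q) (Lk k) p :=
    ((Lk k).hasFDerivAt).const_add _
  have h2 := (hd.hasFDerivAt.clm_apply hV).fderiv
  have h3 := (hd.hasFDerivAt.clm_apply (hasFDerivAt_const v p)).fderiv
  have hs : IsSymmSndFDerivAt ℝ f p :=
    (hf.contDiffAt).isSymmSndFDerivAt (by rw [minSmoothness_of_isRCLikeNormedField]; exact WithTop.coe_le_coe.2 (le_top : (2:ℕ∞) ≤ ⊤))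
  rw [h1, h2, Gam_eq, h3]
  simp
  have := hs v (vk k + Lk k p)
  simp at this
  linarith

/-- commutator coefficients -/
def ck (k : Fin 8) (i j : Fin 3) : ℝ := (Lk k (0, ev i)).2 j
def dk (k : Fin 8) : ℝ := if k = 7 then 1 else 0

lemma dxi_Gam {f : Pt → ℝ} (hf : Sm f) (k : Fin 8) (i : Fin 3) :
    dxi i (Gam k f) = fun p => Gam k (dxi i f) p + ∑ j, ck k i j * dxi j f p := by
  funext p
  unfold dxi
  rw [dir_Gam hf]
  congr 1
  have : Lk k (0, ev i) = (0, (Lk k (0, ev i)).2) := by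
    apply Prod.ext
    · fin_cases k <;> simp [Lk, rotL]
    · rfl
  rw [this, fd_pair]; simp [ck]

lemma dt_Gam {f : Pt → ℝ} (hf : Sm f) (k : Fin 8) :
    dt (Gam k f) = fun p => Gam k (dt f) p + dk k * dt f p := by
  funext p
  unfold dt
  rw [dir_Gam hf]
  congr 1
  fin_cases k <;> simp [Lk, rotL, dk]

lemma ck_symm (k : Fin 8) (i j : Fin 3) : ck k i j + ck k j i = if i = j then 2 * dk k else 0 := by
  fin_cases k <;> fin_cases i <;> fin_cases j <;> simp [ck, Lk, rotL, dk] <;> norm_num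

lemma ck_abs (k : Fin 8) (i j : Fin 3) : |ck k i j| ≤ 1 := by
  fin_cases k <;> fin_cases i <;> fin_cases j <;> simp [ck, Lk, rotL]
lemma dk_abs (k : Fin 8) : |dk k| ≤ 1 := by unfold dk; split_ifs <;> simp


lemma snoc_cases {n : ℕ} {a : List (Fin 8)} (h : a.length ≤ n + 1) :
    a = [] ∨ ∃ a' k, a = a' ++ [k] ∧ a'.length ≤ n := by
  rcases List.eq_nil_or_concat a with h0 | ⟨a', k, rfl⟩
  · exact Or.inl h0
  · right; exact ⟨a', k, by simp, by simpa using h⟩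

lemma GW_snoc (a : List (Fin 8)) (k : Fin 8) (f : Pt → ℝ) :
    GamWord (a ++ [k]) f = GamWord a (Gam k f) := by
  rw [GamWord_append]; rfl

/-- the commutation property -/
def CommP {ι : Type*} (D : ι → (Pt → ℝ) → Pt → ℝ) : Prop :=
  ∀ n : ℕ, ∃ C : ℝ, 0 ≤ C ∧ ∀ a : List (Fin 8), a.length ≤ n → ∀ f, Sm f → ∀ (p : Pt) (B : ℝ),
      (∀ (c : List (Fin 8)) j, c.length ≤ n → |D j (GamWord c f) p| ≤ B) →
      ∀ i, |GamWord a (D i f) p| ≤ C * B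

/-- abstract commutation lemma -/
lemma comm_abs {ι : Type*} [Fintype ι] (D : ι → (Pt → ℝ) → Pt → ℝ)
    (hD : ∀ i f, Sm f → Sm (D i f)) (e : Fin 8 → ι → ι → ℝ)
    (hc : ∀ f, Sm f → ∀ k i,
      Gam k (D i f) = fun p => D i (Gam k f) p + ∑ j, e k i j * D j f p) :
    CommP D := by
  intro n
  induction n with
  | zero =>
    refine ⟨1, by norm_num, ?_⟩
    intro a ha f hf p B hB i
    have : a = [] := List.length_eq_zero_iff.1 (Nat.le_zero.1 ha)
    subst this
    simpa [GamWord] using hB [] i (by simp)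
  | succ n ih =>
    obtain ⟨C, hC, ih⟩ := ih
    refine ⟨1 + C * (1 + ∑ k, ∑ i, ∑ j, |e k i j|), by positivity, ?_⟩
    intro a ha f hf p B hB i
    have hB0 : 0 ≤ B := (abs_nonneg _).trans (hB [] i (by simp))
    rcases snoc_cases ha with rfl | ⟨a', k, rfl, ha'⟩
    · refine (hB [] i (by simp)).trans ?_
      have : 0 ≤ C * (1 + ∑ k, ∑ i, ∑ j, |e k i j|) := by positivity
      nlinarith
    · rw [GW_snoc, hc f hf, GW_add (hD _ _ (Sm_Gam hf k))
        (Sm_sum _ fun j => Sm_smul (hD _ _ hf) _),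
        GW_sum _ (fun j => Sm_smul (hD _ _ hf) _)]
      have h1 : |GamWord a' (D i (Gam k f)) p| ≤ C * B := by
        refine ih a' ha' _ (Sm_Gam hf k) p B ?_ i
        intro c j hc
        have := hB (c ++ [k]) j (by simpa using hc)
        rwa [GW_snoc] at this
      have h2 : ∀ j, |GamWord a' (D j f) p| ≤ C * B := fun j =>
        ih a' ha' _ hf p B (fun c j hc => hB c j (by omega)) j
      have h3 : |∑ j, GamWord a' (fun p => e k i j * D j f p) p| ≤ ∑ j, |e k i j| * (C * B) := by
        refine (Finset.abs_sum_le_sum_abs _ _).trans (Finset.sum_le_sum fun j _ => ?_)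
        rw [GW_smul (hD _ _ hf), abs_mul]
        exact mul_le_mul_of_nonneg_left (h2 j) (abs_nonneg _)
      have h4 : ∑ j, |e k i j| ≤ ∑ k, ∑ i, ∑ j, |e k i j| :=
        (Finset.single_le_sum (f := fun i => ∑ j, |e k i j|)
          (fun i _ => Finset.sum_nonneg fun j _ => abs_nonneg _) (Finset.mem_univ i)).trans
        (Finset.single_le_sum (f := fun k => ∑ i, ∑ j, |e k i j|)
          (fun i _ => Finset.sum_nonneg fun j _ => Finset.sum_nonneg fun _ _ => abs_nonneg _)
          (Finset.mem_univ k))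
      rw [← Finset.sum_mul] at h3
      have hCB : 0 ≤ C * B := by positivity
      have h5 := mul_le_mul_of_nonneg_right h4 hCB
      refine (abs_add_le _ _).trans ?_
      nlinarith

/-- coefficients for `Dop` -/
def e4 (k : Fin 8) (α β : Fin 4) : ℝ :=
  - (Fin.cases (motive := fun _ => ℝ) (Fin.cases (motive := fun _ => ℝ) (dk k) (fun _ => 0) β)
    (fun i => Fin.cases (motive := fun _ => ℝ) 0 (fun j => ck k i j) β) α)

lemma Gam_dxi {f : Pt → ℝ} (hf : Sm f) (k : Fin 8) (i : Fin 3) :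
    Gam k (dxi i f) = fun p => dxi i (Gam k f) p + ∑ j, (- ck k i j) * dxi j f p := by
  funext p; rw [dxi_Gam hf]; simp
lemma Gam_dt {f : Pt → ℝ} (hf : Sm f) (k : Fin 8) :
    Gam k (dt f) = fun p => dt (Gam k f) p + (- dk k) * dt f p := by
  funext p; rw [dt_Gam hf]; simp

lemma Gam_Dop {f : Pt → ℝ} (hf : Sm f) (k : Fin 8) (α : Fin 4) :
    Gam k (Dop α f) = fun p => Dop α (Gam k f) p + ∑ β, e4 k α β * Dop β f p := by
  funext p
  refine Fin.cases ?_ (fun i => ?_) α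
  · rw [Fin.sum_univ_succ]
    simp [Dop_zero, Dop_succ, e4, Gam_dt hf]
  · rw [Fin.sum_univ_succ]
    simp [Dop_zero, Dop_succ, e4, Gam_dxi hf]

lemma dxi_add {f g : Pt → ℝ} (hf : Sm f) (hg : Sm g) (i : Fin 3) :
    dxi i (fun p => f p + g p) = fun p => dxi i f p + dxi i g p := by
  simp only [dxi_eq_Gam]; exact Gam_add hf hg _
lemma dxi_smul {f : Pt → ℝ} (hf : Sm f) (c : ℝ) (i : Fin 3) :
    dxi i (fun p => c * f p) = fun p => c * dxi i f p := by
  simp only [dxi_eq_Gam]; exact Gam_smul hf c _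
lemma dxi_mul {f g : Pt → ℝ} (hf : Sm f) (hg : Sm g) (i : Fin 3) :
    dxi i (fun p => f p * g p) = fun p => dxi i f p * g p + f p * dxi i g p := by
  simp only [dxi_eq_Gam]; exact Gam_mul hf hg _
lemma dxi_sum {ι : Type*} (s : Finset ι) {f : ι → Pt → ℝ} (hf : ∀ i, Sm (f i)) (i : Fin 3) :
    dxi i (fun p => ∑ j ∈ s, f j p) = fun p => ∑ j ∈ s, dxi i (f j) p := by
  simp only [dxi_eq_Gam]; exact GW_sum s hf [_]

/-- second derivatives, at least one being spatial -/
def D2 (q : Fin 3 × Fin 4) (f : Pt → ℝ) : Pt → ℝ := dxi q.1 (Dop q.2 f)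
lemma Sm_D2 (q : Fin 3 × Fin 4) (f : Pt → ℝ) (hf : Sm f) : Sm (D2 q f) := Sm_dxi (Sm_Dop hf _) _

def e12 (k : Fin 8) (q s : Fin 3 × Fin 4) : ℝ :=
  (if q.1 = s.1 then e4 k q.2 s.2 else 0) - (if q.2 = s.2 then ck k q.1 s.1 else 0)

lemma Gam_D2 (f : Pt → ℝ) (hf : Sm f) (k : Fin 8) (q : Fin 3 × Fin 4) :
    Gam k (D2 q f) = fun p => D2 q (Gam k f) p + ∑ s, e12 k q s * D2 s f p := by
  obtain ⟨i, α⟩ := q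
  funext p
  unfold D2
  rw [Gam_dxi (Sm_Dop hf α), Gam_Dop hf, dxi_add (Sm_Dop (Sm_Gam hf k) α)
    (Sm_sum _ fun j => Sm_smul (Sm_Dop hf _) _), dxi_sum _ (fun j => Sm_smul (Sm_Dop hf _) _)]
  simp only [dxi_smul (Sm_Dop hf _)]
  rw [Fintype.sum_prod_type]
  simp only [e12, sub_mul, ite_mul, zero_mul, Finset.sum_sub_distrib]
  rw [Finset.sum_comm (f := fun x y => if i = x then _ else _)]
  simp
  ring

lemma comm_dxi : CommP (fun i : Fin 3 => dxi i) := comm_abs (fun i => dxi i) (fun i _ hf => Sm_dxi hf i) (fun k i j => - ck k i j)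
  (fun _ hf k i => Gam_dxi hf k i)
lemma comm_Dop : CommP (fun i : Fin 4 => Dop i) := comm_abs (fun i => Dop i) (fun i _ hf => Sm_Dop hf i) e4
  (fun _ hf k i => Gam_Dop hf k i)
lemma comm_D2 : CommP D2 := comm_abs D2 Sm_D2 e12 Gam_D2
lemma comm_dt' : CommP (fun _ : Unit => dt) := comm_abs (fun _ : Unit => dt) (fun _ _ hf => Sm_dt hf) (fun k _ _ => - dk k)
  (fun f hf k i => by simpa using Gam_dt hf k)

/-- Leibniz -/
lemma leib (a : List (Fin 8)) : ∀ f g, Sm f → Sm g → ∀ (p : Pt) (B : ℝ),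
    (∀ a1 a2 : List (Fin 8), a1.length + a2.length ≤ a.length → a1 ⊆ a → a2 ⊆ a →
      |GamWord a1 f p * GamWord a2 g p| ≤ B) →
    |GamWord a (fun q => f q * g q) p| ≤ 2 ^ a.length * B := by
  induction a using List.reverseRecOn with
  | nil =>
    intro f g hf hg p B h
    simpa [GamWord] using h [] [] (by simp) (by simp) (by simp)
  | append_singleton a k ih =>
    intro f g hf hg p B h
    rw [GW_snoc, Gam_mul hf hg, GW_add (Sm_mul (Sm_Gam hf k) hg) (Sm_mul hf (Sm_Gam hg k))]
    have h1 := ih _ _ (Sm_Gam hf k) hg p B (by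
      intro a1 a2 hl h1 h2
      have := h (a1 ++ [k]) a2 (by simp; omega)
        (by simp; exact fun x hx => List.mem_append_left _ (h1 hx))
        (fun x hx => List.mem_append_left _ (h2 hx))
      rwa [GW_snoc] at this)
    have h2 := ih _ _ hf (Sm_Gam hg k) p B (by
      intro a1 a2 hl h1 h2
      have := h a1 (a2 ++ [k]) (by simp; omega)
        (fun x hx => List.mem_append_left _ (h1 hx))
        (by simp; exact fun x hx => List.mem_append_left _ (h2 hx))
      rwa [GW_snoc] at this)
    refine (abs_add_le _ _).trans ?_
    simp only [List.length_append, List.length_singleton, pow_succ]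
    linarith

/-- box commutator -/
lemma box_Gam {f : Pt → ℝ} (hf : Sm f) (k : Fin 8) :
    box (Gam k f) = fun p => Gam k (box f) p + 2 * dk k * box f p := by
  have hb : box f = fun p => dt (dt f) p + (-1) * ∑ i, dxi i (dxi i f) p := by
    funext p; simp [box]; ring
  have hL : Sm (fun p => ∑ i, dxi i (dxi i f) p) :=
    Sm_sum _ fun i => Sm_dxi (Sm_dxi hf i) i
  have hG : Gam k (box f) = fun p => Gam k (dt (dt f)) p + (-1) * ∑ i, Gam k (dxi i (dxi i f)) p := by
    rw [hb, Gam_add (Sm_dt (Sm_dt hf)) (Sm_smul hL _), Gam_smul hL]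
    have := GW_sum Finset.univ (fun i => Sm_dxi (Sm_dxi hf i) i) [k]
    simp only [GamWord] at this
    rw [this]
  have h1 : ∀ p, dt (dt (Gam k f)) p = Gam k (dt (dt f)) p + 2 * dk k * dt (dt f) p := by
    intro p
    rw [dt_Gam hf]
    have : dt (fun p => Gam k (dt f) p + dk k * dt f p)
        = fun p => dt (Gam k (dt f)) p + dk k * dt (dt f) p := by
      have h1 := Gam_add (Sm_Gam (Sm_dt hf) k) (Sm_smul (Sm_dt hf) (dk k)) 0
      have h2 := Gam_smul (Sm_dt hf) (dk k) 0
      simp only [← dt_eq_Gam] at h1 h2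
      rw [h1, h2]
    rw [this, dt_Gam (Sm_dt hf)]
    ring
  have h2 : ∀ i p, dxi i (dxi i (Gam k f)) p = Gam k (dxi i (dxi i f)) p
      + ∑ j, ck k i j * dxi j (dxi i f) p + ∑ j, ck k i j * dxi i (dxi j f) p := by
    intro i p
    rw [dxi_Gam hf, dxi_add (Sm_Gam (Sm_dxi hf i) k) (Sm_sum _ fun j => Sm_smul (Sm_dxi hf j) _),
      dxi_sum _ (fun j => Sm_smul (Sm_dxi hf j) _), dxi_Gam (Sm_dxi hf i)]
    simp only [dxi_smul (Sm_dxi hf _)]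
  have h3 : ∀ p, ∑ i, (∑ j, ck k i j * dxi j (dxi i f) p + ∑ j, ck k i j * dxi i (dxi j f) p)
      = 2 * dk k * ∑ i, dxi i (dxi i f) p := by
    intro p
    rw [Finset.sum_add_distrib, Finset.sum_comm, ← Finset.sum_add_distrib, Finset.mul_sum]
    refine Finset.sum_congr rfl fun i _ => ?_
    rw [← Finset.sum_add_distrib]
    simp only [← add_mul, ck_symm]
    simp
  funext p
  rw [hG]
  simp only [box]
  have e1 := h1 p
  have e2 : ∑ i, dxi i (dxi i (Gam k f)) p = ∑ i, Gam k (dxi i (dxi i f)) p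
      + 2 * dk k * ∑ i, dxi i (dxi i f) p := by
    rw [← h3 p, ← Finset.sum_add_distrib]
    exact Finset.sum_congr rfl fun i _ => by rw [h2]; ring
  rw [e1, e2]; ring


/-- smooth positive extension of `1+t` -/
def th (t : ℝ) : ℝ := 1 + t * Real.smoothTransition (t + 1)

lemma th_eq {t : ℝ} (ht : 0 ≤ t) : th t = 1 + t := by
  unfold th; rw [Real.smoothTransition.one_of_one_le (by linarith)]; ring

lemma th_pos (t : ℝ) : 0 < th t := by
  unfold th
  rcases le_or_gt (t + 1) 0 with h | h
  · rw [Real.smoothTransition.zero_of_nonpos h]; simp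
  · rcases le_or_gt 0 t with h' | h'
    · have := Real.smoothTransition.nonneg (t + 1); nlinarith [mul_nonneg h' this]
    · have := Real.smoothTransition.le_one (t + 1); nlinarith

lemma th_smooth : ContDiff ℝ (⊤ : ℕ∞) th := by
  unfold th
  exact contDiff_const.add (contDiff_id.mul
    (Real.smoothTransition.contDiff.comp (contDiff_id.add contDiff_const)))

/-- time weights -/
def tw (s : ℝ) (p : Pt) : ℝ := th p.1 ^ s

lemma Sm_tw (s : ℝ) : Sm (tw s) :=
  (th_smooth.comp contDiff_fst).rpow_const_of_ne (fun p => (th_pos p.1).ne')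

lemma tw_eq (s : ℝ) {p : Pt} (hp : 0 ≤ p.1) : tw s p = (1 + p.1) ^ s := by
  unfold tw; rw [th_eq hp]

/-- upper half space -/
def Up : Set Pt := {p | 0 < p.1}
lemma Up_open : IsOpen Up := isOpen_lt continuous_const continuous_fst

lemma fderiv_tw (s : ℝ) {p : Pt} (hp : 0 < p.1) (v : Pt) :
    fderiv ℝ (tw s) p v = s * (1 + p.1) ^ (s - 1) * v.1 := by
  have h1 : tw s =ᶠ[nhds p] fun q => (1 + q.1) ^ s :=
    Filter.eventually_of_mem (Up_open.mem_nhds hp) fun q hq => tw_eq s (le_of_lt hq)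
  rw [h1.fderiv_eq]
  have h2 : HasDerivAt (fun x : ℝ => (1 + x) ^ s) (s * (1 + p.1) ^ (s - 1)) p.1 := by
    have := ((hasDerivAt_id p.1).const_add 1).rpow_const (p := s) (Or.inl (by simp; linarith))
    simpa using this
  have h3 := (h2.comp_hasFDerivAt p (hasFDerivAt_fst (𝕜 := ℝ) (p := p))).fderiv
  have h4 : (fun x : ℝ => (1 + x) ^ s) ∘ Prod.fst = fun q : Pt => (1 + q.1) ^ s := rfl
  rw [h4] at h3
  rw [h3]; simp

lemma Gam_tw (s : ℝ) (k : Fin 8) : ∃ α β : ℝ, |α| ≤ |s| ∧ |β| ≤ |s| ∧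
    ∀ p ∈ Up, Gam k (tw s) p = α * tw s p + β * tw (s - 1) p := by
  have key : ∀ p ∈ Up, Gam k (tw s) p = s * tw (s - 1) p * (vk k + Lk k p).1 := by
    intro p hp
    rw [Gam_eq, fderiv_tw s hp, tw_eq _ (le_of_lt hp)]
  have hz : ∀ p ∈ Up, p.1 * tw (s - 1) p = tw s p - tw (s - 1) p := by
    intro p hp
    have hp' : (0:ℝ) < p.1 := hp
    rw [tw_eq _ hp'.le, tw_eq _ hp'.le]
    have : (1 + p.1) ^ s = (1 + p.1) ^ (s - 1) * (1 + p.1) := by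
      rw [← Real.rpow_add_one (by linarith)]; simp
    rw [this]; ring
  by_cases h0 : k = 0
  · refine ⟨0, s, by simp, le_rfl, fun p hp => ?_⟩
    subst h0; rw [key p hp]; simp [vk, Lk]
  by_cases h7 : k = 7
  · refine ⟨s, -s, le_rfl, by simp, fun p hp => ?_⟩
    subst h7; rw [key p hp]; simp [vk, Lk]
    have := hz p hp
    linear_combination s * this
  · refine ⟨0, 0, by simp, by simp, fun p hp => ?_⟩
    rw [key p hp]
    fin_cases k <;> simp_all [vk, Lk, rotL]

lemma tw_le {s r : ℝ} (h : s ≤ r) {p : Pt} (hp : 0 < p.1) : tw s p ≤ tw r p := by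
  rw [tw_eq _ hp.le, tw_eq _ hp.le]
  exact Real.rpow_le_rpow_of_exponent_le (by linarith) h

lemma tw_pos (s : ℝ) (p : Pt) : 0 < tw s p := Real.rpow_pos_of_pos (th_pos _) _

lemma tw_mul (s r : ℝ) (p : Pt) : tw s p * tw r p = tw (s + r) p :=
  (Real.rpow_add (th_pos _) s r).symm

lemma tw_bound : ∀ (n : ℕ) (s : ℝ), ∃ C : ℝ, 0 ≤ C ∧ ∀ a : List (Fin 8), a.length ≤ n →
    ∀ p, 0 < p.1 → |GamWord a (tw s) p| ≤ C * tw s p := by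
  intro n
  induction n with
  | zero =>
    intro s
    refine ⟨1, by norm_num, fun a ha p hp => ?_⟩
    have : a = [] := List.length_eq_zero_iff.1 (Nat.le_zero.1 ha)
    subst this
    simp [GamWord, abs_of_pos (tw_pos s p)]
  | succ n ih =>
    intro s
    obtain ⟨C1, hC1, h1⟩ := ih s
    obtain ⟨C2, hC2, h2⟩ := ih (s - 1)
    refine ⟨1 + |s| * C1 + |s| * C2, by positivity, fun a ha p hp => ?_⟩
    have hpos := tw_pos s p
    rcases snoc_cases ha with rfl | ⟨a', k, rfl, ha'⟩
    · simp only [GamWord, abs_of_pos hpos]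
      have : 0 ≤ |s| * C1 + |s| * C2 := by positivity
      nlinarith
    · obtain ⟨α, β, hα, hβ, he⟩ := Gam_tw s k
      rw [GW_snoc, GW_congr Up_open he a' p hp,
        GW_add (Sm_smul (Sm_tw s) α) (Sm_smul (Sm_tw _) β), GW_smul (Sm_tw s), GW_smul (Sm_tw _)]
      refine (abs_add_le _ _).trans ?_
      rw [abs_mul, abs_mul]
      have e1 : |α| * |GamWord a' (tw s) p| ≤ |s| * (C1 * tw s p) :=
        mul_le_mul hα (h1 a' ha' p hp) (abs_nonneg _) (abs_nonneg _)
      have e2 : |β| * |GamWord a' (tw (s - 1)) p| ≤ |s| * (C2 * tw s p) := by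
        refine mul_le_mul hβ ((h2 a' ha' p hp).trans ?_) (abs_nonneg _) (abs_nonneg _)
        exact mul_le_mul_of_nonneg_left (tw_le (by linarith) hp) hC2
      nlinarith

/-- damped box -/
def Gop (μ lam : ℝ) (f : Pt → ℝ) (p : Pt) : ℝ := box f p + (μ * tw (-lam) p) * dt f p

lemma Sm_box {f : Pt → ℝ} (hf : Sm f) : Sm (box f) :=
  (Sm_dt (Sm_dt hf)).sub (Sm_sum _ fun i => Sm_dxi (Sm_dxi hf i) i)
lemma Sm_Gop (μ lam : ℝ) {f : Pt → ℝ} (hf : Sm f) : Sm (Gop μ lam f) :=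
  Sm_add (Sm_box hf) (Sm_mul (Sm_smul (Sm_tw _) μ) (Sm_dt hf))

lemma Gop_Gam (μ lam : ℝ) {f : Pt → ℝ} (hf : Sm f) (k : Fin 8) :
    Gop μ lam (Gam k f) = fun p => (Gam k (Gop μ lam f) p + 2 * dk k * Gop μ lam f p)
      + (-μ) * ((dk k * tw (-lam) p + Gam k (tw (-lam)) p) * dt f p) := by
  have h1 : Gam k (Gop μ lam f) = fun p => Gam k (box f) p +
      ((μ * Gam k (tw (-lam)) p) * dt f p + (μ * tw (-lam) p) * Gam k (dt f) p) := by
    unfold Gop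
    rw [Gam_add (Sm_box hf) (Sm_mul (Sm_smul (Sm_tw _) μ) (Sm_dt hf)),
      Gam_mul (Sm_smul (Sm_tw _) μ) (Sm_dt hf), Gam_smul (Sm_tw _)]
  funext p
  rw [h1]
  simp only [Gop, box_Gam hf, dt_Gam hf]
  ring

lemma Gb_bound (μ lam : ℝ) : ∀ n : ℕ, ∃ C : ℝ, 0 ≤ C ∧ ∀ b : List (Fin 8), b.length ≤ n →
    ∀ f, Sm f → ∀ (p : Pt), 0 < p.1 → ∀ B : ℝ,
    (∀ c : List (Fin 8), c.length ≤ n → |GamWord c (Gop μ lam f) p| ≤ B) →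
    (∀ d : List (Fin 8), d.length < n → tw (-lam) p * |dt (GamWord d f) p| ≤ B) →
    |Gop μ lam (GamWord b f) p| ≤ C * B := by
  intro n
  induction n with
  | zero =>
    refine ⟨1, by norm_num, fun b hb f hf p hp B h1 h2 => ?_⟩
    have : b = [] := List.length_eq_zero_iff.1 (Nat.le_zero.1 hb)
    subst this
    simpa [GamWord] using h1 [] (by simp)
  | succ n ih =>
    obtain ⟨C, hC, ih⟩ := ih
    obtain ⟨Ct, hCt, ht⟩ := tw_bound (n + 1) (-lam)
    obtain ⟨Cd, hCd, hd⟩ := comm_dt' n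
    set K : ℝ := 3 + |μ| * (2 ^ n * ((2 * Ct) * Cd)) with hK
    have hKnn : 0 ≤ K := by positivity
    have hK1 : 1 ≤ K := by
      have : 0 ≤ |μ| * (2 ^ n * ((2 * Ct) * Cd)) := by positivity
      linarith
    refine ⟨1 + C * K, by positivity, fun b hb f hf p hp B h1 h2 => ?_⟩
    have hB0 : 0 ≤ B := (abs_nonneg _).trans (h1 [] (by simp))
    rcases snoc_cases hb with rfl | ⟨b', k, rfl, hb'⟩
    · have := h1 [] (by simp)
      simp only [GamWord] at this ⊢
      have : 0 ≤ C * K * B := by positivity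
      nlinarith
    · rw [GW_snoc]
      have main : |Gop μ lam (GamWord b' (Gam k f)) p| ≤ C * (K * B) := by
        refine ih b' hb' _ (Sm_Gam hf k) p hp (K * B) ?_ ?_
        · intro c hc
          have hS1 := Sm_Gop μ lam hf
          have hS2 : Sm (fun p => dk k * tw (-lam) p + Gam k (tw (-lam)) p) :=
            Sm_add (Sm_smul (Sm_tw _) _) (Sm_Gam (Sm_tw _) k)
          have hS3 := Sm_mul hS2 (Sm_dt hf)
          rw [Gop_Gam μ lam hf, GW_add (Sm_add (Sm_Gam hS1 k) (Sm_smul hS1 _)) (Sm_smul hS3 _),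
            GW_add (Sm_Gam hS1 k) (Sm_smul hS1 _), GW_smul hS1, GW_smul hS3]
          have q1 : |GamWord c (Gam k (Gop μ lam f)) p| ≤ B := by
            have := h1 (c ++ [k]) (by simpa using hc)
            rwa [GW_snoc] at this
          have q2 : |2 * dk k * GamWord c (Gop μ lam f) p| ≤ 2 * B := by
            rw [abs_mul, abs_mul]
            have := h1 c (by omega)
            have h3 := dk_abs k
            have : |dk k| * |GamWord c (Gop μ lam f) p| ≤ 1 * B :=
              mul_le_mul h3 this (abs_nonneg _) (by norm_num)
            simp only [abs_two]; linarith
          have q3 : |GamWord c (fun p => (dk k * tw (-lam) p + Gam k (tw (-lam)) p) * dt f p) p|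
              ≤ 2 ^ n * ((2 * Ct) * Cd * B) := by
            have hbnn : 0 ≤ (2 * Ct) * Cd * B := by positivity
            refine (leib c _ _ hS2 (Sm_dt hf) p ((2 * Ct) * Cd * B) ?_).trans
              (mul_le_mul_of_nonneg_right (pow_le_pow_right₀ (by norm_num) hc) hbnn)
            intro a1 a2 hl _ _
            have ha1 : a1.length ≤ n := by omega
            have ha2 : a2.length ≤ n := by omega
            rw [GW_add (Sm_smul (Sm_tw _) _) (Sm_Gam (Sm_tw _) k), GW_smul (Sm_tw _), abs_mul]
            have r1 : |dk k * GamWord a1 (tw (-lam)) p + GamWord a1 (Gam k (tw (-lam))) p|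
                ≤ 2 * Ct * tw (-lam) p := by
              refine (abs_add_le _ _).trans ?_
              rw [abs_mul]
              have s1 := ht a1 (by omega) p hp
              have s2 := ht (a1 ++ [k]) (by simpa using ha1) p hp
              rw [GW_snoc] at s2
              have : |dk k| * |GamWord a1 (tw (-lam)) p| ≤ 1 * (Ct * tw (-lam) p) :=
                mul_le_mul (dk_abs k) s1 (abs_nonneg _) (by norm_num)
              linarith
            have hT := tw_pos (-lam) p
            have r2 : |GamWord a2 (dt f) p| ≤ Cd * (B / tw (-lam) p) := by
              refine hd a2 ha2 f hf p _ (fun c _ hc => ?_) ()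
              rw [le_div_iff₀ hT, mul_comm]
              exact h2 c (by omega)
            calc _ ≤ (2 * Ct * tw (-lam) p) * (Cd * (B / tw (-lam) p)) :=
                  mul_le_mul r1 r2 (abs_nonneg _) (by positivity)
              _ = _ := by field_simp
          have q4 : |(-μ) * GamWord c (fun p => (dk k * tw (-lam) p + Gam k (tw (-lam)) p) * dt f p) p|
              ≤ |μ| * (2 ^ n * ((2 * Ct) * Cd * B)) := by
            rw [abs_mul, abs_neg]
            exact mul_le_mul_of_nonneg_left q3 (abs_nonneg _)
          refine (abs_add_le _ _).trans ?_
          have := abs_add_le (GamWord c (Gam k (Gop μ lam f)) p) (2 * dk k * GamWord c (Gop μ lam f) p)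
          rw [hK]
          nlinarith
        · intro d hdl
          have := h2 (d ++ [k]) (by simpa using hdl)
          rw [GW_snoc] at this
          nlinarith
      nlinarith

/-- pointwise Klainerman–Sideris bounds -/
lemma KS (M : ℝ) (hM : 0 < M) : ∃ C : ℝ, 0 ≤ C ∧ ∀ φ, Sm φ → ∀ (p : Pt), 1 ≤ p.1 → ‖p.2‖ ≤ p.1 + M →
    ∀ Z : ℝ, (∀ (c : List (Fin 8)) α, c.length ≤ 1 → |Dop α (GamWord c φ) p| ≤ Z) →
    |(p.1 ^ 2 - ‖p.2‖ ^ 2) / (1 + p.1) * ∑ i, dxi i (dxi i φ) p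
        + p.1 ^ 2 / (1 + p.1) * box φ p| ≤ C * Z ∧
    ∀ i, |(p.1 ^ 2 - ‖p.2‖ ^ 2) / (1 + p.1) * dxi i (dt φ) p
        - p.1 * p.2 i / (1 + p.1) * box φ p| ≤ C * Z := by
  obtain ⟨C, hC, hcomm⟩ := comm_Dop 1
  refine ⟨10 * C * (1 + M), by positivity, fun φ hφ p hp hr Z hZ => ?_⟩
  have hZ0 : 0 ≤ Z := (abs_nonneg _).trans (hZ [] 0 (by simp))
  have hG : ∀ k α, |Gam k (Dop α φ) p| ≤ C * Z := fun k α =>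
    hcomm [k] (by simp) φ hφ p Z (fun c j hc => hZ c j hc) α
  have sym : ∀ v w : Pt, fderiv ℝ (fun q => fderiv ℝ φ q v) p w
      = fderiv ℝ (fun q => fderiv ℝ φ q w) p v := by
    intro v w
    have hd : DifferentiableAt ℝ (fderiv ℝ φ) p :=
      ((hφ.fderiv_right (m := (⊤ : ℕ∞)) (by simp)).differentiable (by simp)) p
    have h3 := fun v => (hd.hasFDerivAt.clm_apply (hasFDerivAt_const v p)).fderiv
    have hs : IsSymmSndFDerivAt ℝ φ p :=
      (hφ.contDiffAt).isSymmSndFDerivAt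
        (by rw [minSmoothness_of_isRCLikeNormedField]; exact WithTop.coe_le_coe.2 (le_top : (2:ℕ∞) ≤ ⊤))
    rw [h3, h3]
    have := hs v w
    simpa using this.symm
  have s0 : ∀ i, dt (dxi i φ) p = dxi i (dt φ) p := fun i => sym _ _
  have s1 : ∀ i j, dxi j (dxi i φ) p = dxi i (dxi j φ) p := fun i j => sym _ _
  have hn : ‖p.2‖ ^ 2 = p.2 0 ^ 2 + p.2 1 ^ 2 + p.2 2 ^ 2 := by
    rw [EuclideanSpace.norm_sq_eq]; simp [Fin.sum_univ_three]
  have hx : ∀ i, |p.2 i| ≤ p.1 + M := fun i => by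
    have := PiLp.norm_apply_le p.2 i
    rw [Real.norm_eq_abs] at this
    linarith
  obtain ⟨t, x⟩ := p
  simp only at *
  have hbd : ∀ y g : ℝ, |y| ≤ t + M → |g| ≤ C * Z → |y * g| ≤ (1 + t) * ((1 + M) * (C * Z)) := by
    intro y g h1 h2
    rw [abs_mul]
    have h3 : (0:ℝ) ≤ C * Z := by positivity
    calc |y| * |g| ≤ (t + M) * (C * Z) := mul_le_mul h1 h2 (abs_nonneg _) (by linarith)
      _ ≤ ((1 + t) * (1 + M)) * (C * Z) := by
          apply mul_le_mul_of_nonneg_right _ h3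
          nlinarith
      _ = _ := by ring
  have ht' : |t| ≤ t + M := by rw [abs_of_nonneg (by linarith)]; linarith
  set H : ℝ := (1 + t) * ((1 + M) * (C * Z)) with hH
  have g7 := fun α => hG 7 α
  have g4 := fun α => hG 4 α
  have g5 := fun α => hG 5 α
  have g6 := fun α => hG 6 α
  have hfin : ∀ E : ℝ, |E| ≤ 10 * H → |E / (1 + t)| ≤ 10 * C * (1 + M) * Z := by
    intro E hE
    rw [abs_div, abs_of_pos (by linarith : 0 < 1 + t), div_le_iff₀ (by linarith)]
    refine hE.trans (le_of_eq ?_)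
    rw [hH]; ring
  have d0 : ∀ α, |Gam 7 (Dop α φ) (t, x)| ≤ C * Z := g7
  have E7 : ∀ f, Gam 7 f (t, x) = t * dt f (t, x) + (x 0 * dxi 0 f (t, x) + x 1 * dxi 1 f (t, x) + x 2 * dxi 2 f (t, x)) := by
    intro f; simp [Gam, Fin.sum_univ_three]
  have E4 : ∀ f, Gam 4 f (t, x) = x 1 * dxi 2 f (t, x) - x 2 * dxi 1 f (t, x) := fun f => rfl
  have E5 : ∀ f, Gam 5 f (t, x) = x 2 * dxi 0 f (t, x) - x 0 * dxi 2 f (t, x) := fun f => rfl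
  have E6 : ∀ f, Gam 6 f (t, x) = x 0 * dxi 1 f (t, x) - x 1 * dxi 0 f (t, x) := fun f => rfl
  have D0 : Dop 0 φ = dt φ := rfl
  have D1 : Dop 1 φ = dxi 0 φ := rfl
  have D2' : Dop 2 φ = dxi 1 φ := rfl
  have D3 : Dop 3 φ = dxi 2 φ := rfl
  have bx : box φ (t, x) = dt (dt φ) (t, x) - (dxi 0 (dxi 0 φ) (t, x) + dxi 1 (dxi 1 φ) (t, x) + dxi 2 (dxi 2 φ) (t, x)) := by
    simp [box, Fin.sum_univ_three]
  constructor
  · have hh : (t ^ 2 - ‖x‖ ^ 2) / (1 + t) * ∑ i, dxi i (dxi i φ) (t, x) + t ^ 2 / (1 + t) * box φ (t, x)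
      = (t * Gam 7 (Dop 0 φ) (t, x) - x 0 * Gam 7 (Dop 1 φ) (t, x) - x 1 * Gam 7 (Dop 2 φ) (t, x)
        - x 2 * Gam 7 (Dop 3 φ) (t, x)
        - x 0 * Gam 6 (Dop 2 φ) (t, x) + x 1 * Gam 6 (Dop 1 φ) (t, x)
        + x 0 * Gam 5 (Dop 3 φ) (t, x) - x 2 * Gam 5 (Dop 1 φ) (t, x)
        - x 1 * Gam 4 (Dop 3 φ) (t, x) + x 2 * Gam 4 (Dop 2 φ) (t, x)) / (1 + t) := by
      rw [bx, hn, D0, D1, D2', D3]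
      simp only [E7, E6, E5, E4, s0, Fin.sum_univ_three, s1 0 1, s1 0 2, s1 1 2]
      ring
    rw [hh]
    apply hfin
    have b1 := abs_le.1 (hbd t _ ht' (g7 0))
    have b2 := abs_le.1 (hbd _ _ (hx 0) (g7 1))
    have b3 := abs_le.1 (hbd _ _ (hx 1) (g7 2))
    have b4 := abs_le.1 (hbd _ _ (hx 2) (g7 3))
    have b5 := abs_le.1 (hbd _ _ (hx 0) (g6 2))
    have b6 := abs_le.1 (hbd _ _ (hx 1) (g6 1))
    have b7 := abs_le.1 (hbd _ _ (hx 0) (g5 3))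
    have b8 := abs_le.1 (hbd _ _ (hx 2) (g5 1))
    have b9 := abs_le.1 (hbd _ _ (hx 1) (g4 3))
    have b10 := abs_le.1 (hbd _ _ (hx 2) (g4 2))
    rw [abs_le]; constructor <;> linarith
  · intro i
    fin_cases i
    · have hh : (t ^ 2 - ‖x‖ ^ 2) / (1 + t) * dxi 0 (dt φ) (t, x) - t * x 0 / (1 + t) * box φ (t, x)
        = (t * Gam 7 (Dop 1 φ) (t, x) - x 0 * Gam 7 (Dop 0 φ) (t, x)
          + t * Gam 6 (Dop 2 φ) (t, x) - t * Gam 5 (Dop 3 φ) (t, x)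
          + x 1 * Gam 6 (Dop 0 φ) (t, x) - x 2 * Gam 5 (Dop 0 φ) (t, x)) / (1 + t) := by
        rw [bx, hn, D0, D1, D2', D3]
        simp only [E7, E6, E5, E4, s0, Fin.sum_univ_three, s1 0 1, s1 0 2, s1 1 2]
        ring
      simp only [Fin.zero_eta]
      rw [hh]
      apply hfin
      have b1 := abs_le.1 (hbd t _ ht' (g7 1))
      have b2 := abs_le.1 (hbd _ _ (hx 0) (g7 0))
      have b3 := abs_le.1 (hbd t _ ht' (g6 2))
      have b4 := abs_le.1 (hbd t _ ht' (g5 3))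
      have b5 := abs_le.1 (hbd _ _ (hx 1) (g6 0))
      have b6 := abs_le.1 (hbd _ _ (hx 2) (g5 0))
      rw [abs_le]; constructor <;> linarith
    · have hh : (t ^ 2 - ‖x‖ ^ 2) / (1 + t) * dxi 1 (dt φ) (t, x) - t * x 1 / (1 + t) * box φ (t, x)
        = (t * Gam 7 (Dop 2 φ) (t, x) - x 1 * Gam 7 (Dop 0 φ) (t, x)
          - t * Gam 6 (Dop 1 φ) (t, x) + t * Gam 4 (Dop 3 φ) (t, x)
          - x 0 * Gam 6 (Dop 0 φ) (t, x) + x 2 * Gam 4 (Dop 0 φ) (t, x)) / (1 + t) := by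
        rw [bx, hn, D0, D1, D2', D3]
        simp only [E7, E6, E5, E4, s0, Fin.sum_univ_three, s1 0 1, s1 0 2, s1 1 2]
        ring
      simp only [Fin.mk_one]
      rw [hh]
      apply hfin
      have b1 := abs_le.1 (hbd t _ ht' (g7 2))
      have b2 := abs_le.1 (hbd _ _ (hx 1) (g7 0))
      have b3 := abs_le.1 (hbd t _ ht' (g6 1))
      have b4 := abs_le.1 (hbd t _ ht' (g4 3))
      have b5 := abs_le.1 (hbd _ _ (hx 0) (g6 0))
      have b6 := abs_le.1 (hbd _ _ (hx 2) (g4 0))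
      rw [abs_le]; constructor <;> linarith
    · have hh : (t ^ 2 - ‖x‖ ^ 2) / (1 + t) * dxi 2 (dt φ) (t, x) - t * x 2 / (1 + t) * box φ (t, x)
        = (t * Gam 7 (Dop 3 φ) (t, x) - x 2 * Gam 7 (Dop 0 φ) (t, x)
          + t * Gam 5 (Dop 1 φ) (t, x) - t * Gam 4 (Dop 2 φ) (t, x)
          + x 0 * Gam 5 (Dop 0 φ) (t, x) - x 1 * Gam 4 (Dop 0 φ) (t, x)) / (1 + t) := by
        rw [bx, hn, D0, D1, D2', D3]
        simp only [E7, E6, E5, E4, s0, Fin.sum_univ_three, s1 0 1, s1 0 2, s1 1 2]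
        ring
      simp only [Fin.reduceFinMk]
      rw [hh]
      apply hfin
      have b1 := abs_le.1 (hbd t _ ht' (g7 3))
      have b2 := abs_le.1 (hbd _ _ (hx 2) (g7 0))
      have b3 := abs_le.1 (hbd t _ ht' (g5 1))
      have b4 := abs_le.1 (hbd t _ ht' (g4 2))
      have b5 := abs_le.1 (hbd _ _ (hx 0) (g5 0))
      have b6 := abs_le.1 (hbd _ _ (hx 1) (g4 0))
      rw [abs_le]; constructor <;> linarith


/-- continuous with compact support -/
def CC (g : E3 → ℝ) : Prop := Continuous g ∧ HasCompactSupport g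

lemma CC.int {g : E3 → ℝ} (h : CC g) : Integrable g := h.1.integrable_of_hasCompactSupport h.2
lemma CC.mul {g f : E3 → ℝ} (h : CC g) (hf : Continuous f) : CC (fun x => f x * g x) :=
  ⟨hf.mul h.1, h.2.mul_left⟩
lemma CC.mulr {g f : E3 → ℝ} (h : CC g) (hf : Continuous f) : CC (fun x => g x * f x) :=
  ⟨h.1.mul hf, h.2.mul_right⟩
lemma CC.sq {g : E3 → ℝ} (h : CC g) : CC (fun x => g x ^ 2) := by
  have := h.mul h.1
  simpa [pow_two] using this
lemma CC.sqint {g : E3 → ℝ} (h : CC g) : Integrable (fun x => g x ^ 2) := h.sq.int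
lemma CC.add {g f : E3 → ℝ} (h : CC g) (hf : CC f) : CC (fun x => g x + f x) :=
  ⟨h.1.add hf.1, h.2.add hf.2⟩

lemma L2_nonneg (f : E3 → ℝ) : 0 ≤ L2norm f := Real.sqrt_nonneg _
lemma L2_sq (f : E3 → ℝ) : L2norm f ^ 2 = ∫ x, f x ^ 2 :=
  Real.sq_sqrt (integral_nonneg fun _ => sq_nonneg _)

lemma L2_le_of_int {f : E3 → ℝ} {B : ℝ} (hB : 0 ≤ B) (h : ∫ x, f x ^ 2 ≤ B ^ 2) : L2norm f ≤ B :=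
  Real.sqrt_le_iff.2 ⟨hB, h⟩

lemma L2_transfer {ι : Type*} (s : Finset ι) (g : ι → E3 → ℝ) (hg : ∀ i ∈ s, CC (g i)) (f : E3 → ℝ)
    (C : ℝ) (hC : 0 ≤ C) (h : ∀ x B, (∀ i ∈ s, |g i x| ≤ B) → |f x| ≤ C * B)
    (B' : ℝ) (hB' : 0 ≤ B') (hB : ∀ i ∈ s, L2norm (g i) ≤ B') : L2norm f ≤ C * s.card * B' := by
  apply L2_le_of_int (by positivity)
  have h1 : ∀ x, f x ^ 2 ≤ C ^ 2 * ∑ i ∈ s, g i x ^ 2 := by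
    intro x
    have hS : 0 ≤ ∑ i ∈ s, g i x ^ 2 := Finset.sum_nonneg fun _ _ => sq_nonneg _
    have := h x (Real.sqrt (∑ i ∈ s, g i x ^ 2)) (by
      intro i hi
      apply Real.abs_le_sqrt
      exact Finset.single_le_sum (f := fun i => g i x ^ 2) (fun _ _ => sq_nonneg _) hi)
    calc f x ^ 2 = |f x| ^ 2 := (sq_abs _).symm
      _ ≤ (C * Real.sqrt (∑ i ∈ s, g i x ^ 2)) ^ 2 := by gcongr
      _ = _ := by rw [mul_pow, Real.sq_sqrt hS]
  have h2 : Integrable (fun x => C ^ 2 * ∑ i ∈ s, g i x ^ 2) :=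
    (integrable_finsetSum s fun i hi => (hg i hi).sqint).const_mul _
  calc ∫ x, f x ^ 2 ≤ ∫ x, C ^ 2 * ∑ i ∈ s, g i x ^ 2 :=
        integral_mono_of_nonneg (Filter.Eventually.of_forall fun _ => sq_nonneg _) h2
          (Filter.Eventually.of_forall h1)
    _ = C ^ 2 * ∑ i ∈ s, L2norm (g i) ^ 2 := by
        rw [integral_const_mul, integral_finsetSum s fun i hi => (hg i hi).sqint]
        simp only [L2_sq]
    _ ≤ C ^ 2 * ∑ i ∈ s, B' ^ 2 := by
        gcongr with i hi
        · exact L2_nonneg _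
        · exact hB i hi
    _ = C ^ 2 * (s.card : ℝ) * B' ^ 2 := by rw [Finset.sum_const, nsmul_eq_mul]; ring
    _ ≤ C ^ 2 * (s.card : ℝ) ^ 2 * B' ^ 2 := by
        gcongr
        have : s.card ≤ s.card ^ 2 := Nat.le_self_pow (by norm_num) _
        exact_mod_cast this
    _ = _ := by ring

/-- domination by one function -/
lemma L2_mono {f g : E3 → ℝ} (hg : CC g) {C : ℝ} (hC : 0 ≤ C) (h : ∀ x, |f x| ≤ C * |g x|) :
    L2norm f ≤ C * L2norm g := by
  have := L2_transfer ({()} : Finset Unit) (fun _ => g) (fun _ _ => hg) f C hC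
    (fun x B hB => (h x).trans (by gcongr; exact hB () (by simp))) (L2norm g) (L2_nonneg _)
    (fun _ _ => le_rfl)
  simpa using this

/-- two-function triangle-type inequality -/
lemma L2_add {f g h : E3 → ℝ} (hg : CC g) (hh : CC h) {C : ℝ} (hC : 0 ≤ C)
    (H : ∀ x, |f x| ≤ C * (|g x| + |h x|)) {B : ℝ} (hB : 0 ≤ B) (h1 : L2norm g ≤ B) (h2 : L2norm h ≤ B) :
    L2norm f ≤ 4 * C * B := by
  have := L2_transfer (Finset.univ : Finset Bool) (fun b => if b then g else h)
    (by intro i _; cases i <;> simpa) f (2 * C) (by positivity)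
    (fun x B hB => (H x).trans (by
      have a := hB true (by simp)
      have b := hB false (by simp)
      simp at a b
      nlinarith)) B hB (by intro i _; cases i <;> simpa)
  refine this.trans (le_of_eq ?_)
  rw [Finset.card_univ, Fintype.card_bool]; push_cast; ring

lemma L2_cs {f g : E3 → ℝ} (hf : CC f) (hg : CC g) : |∫ x, f x * g x| ≤ L2norm f * L2norm g := by
  set a := ∫ x, f x * g x
  have key : ∀ s : ℝ, 0 ≤ L2norm g ^ 2 * (s * s) + (2 * a) * s + L2norm f ^ 2 := by
    intro s
    have h0 : 0 ≤ ∫ x, (f x + s * g x) ^ 2 := integral_nonneg fun _ => sq_nonneg _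
    have h1 : ∫ x, (f x + s * g x) ^ 2 = (∫ x, f x ^ 2) + (2 * s) * a + (s ^ 2) * ∫ x, g x ^ 2 := by
      rw [← integral_const_mul, ← integral_const_mul, ← integral_add, ← integral_add]
      · congr 1; ext x; ring
      · exact (hf.sqint.add ((hg.mul hf.1).int.const_mul _))
      · exact hg.sqint.const_mul _
      · exact hf.sqint
      · exact (hg.mul hf.1).int.const_mul _
    rw [h1, ← L2_sq, ← L2_sq] at h0
    nlinarith
  have hd := discrim_le_zero key
  unfold discrim at hd
  apply abs_le_of_sq_le_sq _ (mul_nonneg (L2_nonneg _) (L2_nonneg _))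
  nlinarith

/-- words of length at most m -/
def WD (m : ℕ) : Finset (List (Fin 8)) :=
  (Finset.range (m + 1)).biUnion (fun n => Finset.univ.image (fun b : Fin n → Fin 8 => List.ofFn b))
lemma mem_WD {m : ℕ} {c : List (Fin 8)} : c ∈ WD m ↔ c.length ≤ m := by
  simp only [WD, Finset.mem_biUnion, Finset.mem_range, Finset.mem_image, Finset.mem_univ, true_and]
  constructor
  · rintro ⟨n, hn, b, rfl⟩; simp; omega
  · intro h; exact ⟨c.length, by omega, c.get, by simp⟩

lemma le_wsum {m : ℕ} (F : List (Fin 8) → ℝ) (hF : ∀ c, 0 ≤ F c) {c : List (Fin 8)} (hc : c.length ≤ m) :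
    F c ≤ ∑ n ∈ Finset.range (m + 1), ∑ b : Fin n → Fin 8, F (List.ofFn b) := by
  have h1 : F c ≤ ∑ b : Fin c.length → Fin 8, F (List.ofFn b) := by
    have := Finset.single_le_sum (f := fun b : Fin c.length → Fin 8 => F (List.ofFn b))
      (fun _ _ => hF _) (Finset.mem_univ c.get)
    simpa using this
  exact h1.trans (Finset.single_le_sum (f := fun n => ∑ b : Fin n → Fin 8, F (List.ofFn b))
    (fun _ _ => Finset.sum_nonneg fun _ _ => hF _) (Finset.mem_range.2 (by omega)))

lemma wsum_le (m : ℕ) : ∃ K : ℝ, 0 ≤ K ∧ ∀ (F : List (Fin 8) → ℝ) (B : ℝ),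
    (∀ c, c.length ≤ m → F c ≤ B) →
    ∑ n ∈ Finset.range (m + 1), ∑ b : Fin n → Fin 8, F (List.ofFn b) ≤ K * B := by
  refine ⟨∑ n ∈ Finset.range (m + 1), ∑ b : Fin n → Fin 8, 1, Finset.sum_nonneg fun _ _ => Finset.sum_nonneg fun _ _ => zero_le_one, fun F B h => ?_⟩
  rw [Finset.sum_mul]
  refine Finset.sum_le_sum fun n hn => ?_
  rw [Finset.sum_mul]
  refine Finset.sum_le_sum fun b _ => ?_
  rw [one_mul]
  apply h
  simp at hn ⊢; omega

/-- smooth, supported in the light cone -/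
def Good (M : ℝ) (f : Pt → ℝ) : Prop := Sm f ∧ ∀ p : Pt, 0 < p.1 → p.1 + M < ‖p.2‖ → f p = 0

lemma Good.gam {M : ℝ} {f : Pt → ℝ} (h : Good M f) (k : Fin 8) : Good M (Gam k f) := by
  refine ⟨Sm_Gam h.1 k, fun p h1 h2 => ?_⟩
  have hU : IsOpen {p : Pt | 0 < p.1 ∧ p.1 + M < ‖p.2‖} :=
    (isOpen_lt continuous_const continuous_fst).inter
      (isOpen_lt (continuous_fst.add continuous_const) continuous_snd.norm)
  have := Gam_congr hU (f := f) (g := fun _ => 0) (fun q hq => h.2 q hq.1 hq.2) k p ⟨h1, h2⟩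
  rw [this, show Gam k (fun _ => (0:ℝ)) = GamWord [k] (fun _ => (0:ℝ)) from rfl, GW_zero]

lemma Good.gw {M : ℝ} {f : Pt → ℝ} (h : Good M f) (a : List (Fin 8)) : Good M (GamWord a f) := by
  induction a with
  | nil => exact h
  | cons k l ih => exact ih.gam k
lemma Good.dop {M : ℝ} {f : Pt → ℝ} (h : Good M f) (i : Fin 4) : Good M (Dop i f) := by
  rw [Dop_eq_Gam]; exact h.gam _
lemma Good.dxi {M : ℝ} {f : Pt → ℝ} (h : Good M f) (i : Fin 3) : Good M (dxi i f) := by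
  rw [dxi_eq_Gam]; exact h.gam _
lemma Good.dt {M : ℝ} {f : Pt → ℝ} (h : Good M f) : Good M (dt f) := h.gam 0
lemma Good.D2 {M : ℝ} {f : Pt → ℝ} (h : Good M f) (q : Fin 3 × Fin 4) : Good M (D2 q f) :=
  (h.dop _).dxi _
lemma Good.mul {M : ℝ} {f g : Pt → ℝ} (h : Good M f) (hg : Sm g) : Good M (fun p => g p * f p) :=
  ⟨Sm_mul hg h.1, fun p h1 h2 => by simp [h.2 p h1 h2]⟩
lemma Good.mulr {M : ℝ} {f g : Pt → ℝ} (h : Good M f) (hg : Sm g) : Good M (fun p => f p * g p) :=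
  ⟨Sm_mul h.1 hg, fun p h1 h2 => by simp [h.2 p h1 h2]⟩
lemma Good.smul {M : ℝ} {f : Pt → ℝ} (h : Good M f) (c : ℝ) : Good M (fun p => c * f p) :=
  h.mul (Sm_const c)
lemma Good.add {M : ℝ} {f g : Pt → ℝ} (h : Good M f) (hg : Good M g) : Good M (fun p => f p + g p) :=
  ⟨Sm_add h.1 hg.1, fun p h1 h2 => by simp [h.2 p h1 h2, hg.2 p h1 h2]⟩
lemma Good.sum {M : ℝ} {ι : Type*} (s : Finset ι) {f : ι → Pt → ℝ} (h : ∀ i, Good M (f i)) :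
    Good M (fun p => ∑ i ∈ s, f i p) :=
  ⟨Sm_sum s fun i => (h i).1, fun p h1 h2 => Finset.sum_eq_zero fun i _ => (h i).2 p h1 h2⟩

lemma Sm.slice {f : Pt → ℝ} (h : Sm f) (t : ℝ) : Continuous (fun x : E3 => f (t, x)) :=
  h.continuous.comp (by fun_prop)

lemma Good.cc {M : ℝ} {f : Pt → ℝ} (h : Good M f) {t : ℝ} (ht : 0 < t) :
    CC (fun x : E3 => f (t, x)) := by
  refine ⟨h.1.slice t, ?_⟩
  apply HasCompactSupport.of_support_subset_isCompact (isCompact_closedBall (0 : E3) (t + M))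
  intro x hx
  simp only [mem_closedBall_zero_iff]
  by_contra hc
  push Not at hc
  exact hx (h.2 (t, x) ht hc)

lemma slice_hasFDerivAt {f : Pt → ℝ} (h : Sm f) (t : ℝ) (x : E3) :
    HasFDerivAt (fun x : E3 => f (t, x)) ((fderiv ℝ f (t, x)).comp (ContinuousLinearMap.inr ℝ ℝ E3)) x := by
  have h1 : HasFDerivAt f (fderiv ℝ f (t, x)) (t, x) := (h.da _).hasFDerivAt
  exact h1.comp x (hasFDerivAt_prodMk_right t x)

lemma slice_fderiv {f : Pt → ℝ} (h : Sm f) (t : ℝ) (x : E3) (i : Fin 3) :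
    fderiv ℝ (fun x : E3 => f (t, x)) x (ev i) = dxi i f (t, x) := by
  rw [(slice_hasFDerivAt h t x).fderiv]; rfl

lemma ibp {M : ℝ} {f g : Pt → ℝ} (hf : Good M f) (hg : Sm g) {t : ℝ} (ht : 0 < t) (i : Fin 3) :
    ∫ x : E3, g (t, x) * dxi i f (t, x) = - ∫ x : E3, dxi i g (t, x) * f (t, x) := by
  have := integral_mul_fderiv_eq_neg_fderiv_mul_of_integrable (μ := (volume : Measure E3))
    (f := fun x : E3 => g (t, x)) (g := fun x : E3 => f (t, x)) (v := ev i) ?_ ?_ ?_ ?_ ?_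
  · simpa only [slice_fderiv hf.1, slice_fderiv hg] using this
  · simp only [slice_fderiv hg]
    exact ((hf.cc ht).mul ((Sm_dxi hg i).slice t)).int
  · simp only [slice_fderiv hf.1]
    exact (((hf.dxi i).cc ht).mul (hg.slice t)).int
  · exact ((hf.cc ht).mul (hg.slice t)).int
  · exact fun x _ => (slice_hasFDerivAt hg t x).differentiableAt
  · exact fun x _ => (slice_hasFDerivAt hf.1 t x).differentiableAt

section
open scoped ENNReal


/-- rotation chart derivative -/
def rotD (h : ℝ) (z : ℝ × ℝ) : ℝ × ℝ →L[ℝ] ℝ × ℝ :=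
  LinearMap.toContinuousLinearMap (Matrix.toLin (Module.Basis.finTwoProd ℝ) (Module.Basis.finTwoProd ℝ)
    !![cos z.2, -sin z.2 * z.1 - cos z.2 * h; sin z.2, cos z.2 * z.1 - sin z.2 * h])

lemma rotD_has (h : ℝ) (z : ℝ × ℝ) : HasFDerivAt
    (fun z : ℝ × ℝ => (cos z.2 * z.1 - sin z.2 * h, sin z.2 * z.1 + cos z.2 * h)) (rotD h z) z := by
  unfold rotD
  rw [Matrix.toLin_finTwoProd_toContinuousLinearMap]
  have hc : HasFDerivAt (fun z : ℝ × ℝ => cos z.2) (-sin z.2 • ContinuousLinearMap.snd ℝ ℝ ℝ) z :=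
    HasFDerivAt.cos hasFDerivAt_snd
  have hs : HasFDerivAt (fun z : ℝ × ℝ => sin z.2) (cos z.2 • ContinuousLinearMap.snd ℝ ℝ ℝ) z :=
    HasFDerivAt.sin hasFDerivAt_snd
  have hf : HasFDerivAt (fun z : ℝ × ℝ => z.1) (ContinuousLinearMap.fst ℝ ℝ ℝ) z := hasFDerivAt_fst
  refine HasFDerivAt.prodMk ?_ ?_
  · convert! (hc.mul hf).sub (hs.mul_const h) using 1
    ext <;> simp <;> ring
  · convert! (hs.mul hf).add (hc.mul_const h) using 1
    ext <;> simp <;> ring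

lemma rotD_det (h : ℝ) (z : ℝ × ℝ) : (rotD h z).det = z.1 := by
  have : (rotD h z).det = LinearMap.det (Matrix.toLin (Module.Basis.finTwoProd ℝ) (Module.Basis.finTwoProd ℝ)
    !![cos z.2, -sin z.2 * z.1 - cos z.2 * h; sin z.2, cos z.2 * z.1 - sin z.2 * h]) := rfl
  rw [this, LinearMap.det_toLin, Matrix.det_fin_two_of]
  linear_combination z.1 * (sin_sq_add_cos_sq z.2)

lemma rot_aux (h : ℝ) (S : Set ℝ) (hS : MeasurableSet S) (hinj : ∀ a ∈ S, ∀ b ∈ S, a ^ 2 = b ^ 2 → a = b)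
    (h0 : (0:ℝ) ∉ S) (f : ℝ × ℝ → ℝ≥0∞) (hf : Measurable f) :
    ∫⁻ y in S, ENNReal.ofReal |y| * ∫⁻ α in Ioo (0:ℝ) 1,
      f (cos α * y - sin α * h, sin α * y + cos α * h) ≤ ∫⁻ z, f z := by
  have hm : MeasurableSet (S ×ˢ Ioo (0:ℝ) 1) := hS.prod measurableSet_Ioo
  have key := lintegral_image_eq_lintegral_abs_det_fderiv_mul (volume : Measure (ℝ × ℝ)) hm
    (fun z _ => (rotD_has h z).hasFDerivWithinAt) (by
      rintro ⟨a, α⟩ ⟨ha, hα⟩ ⟨b, β⟩ ⟨hb, hβ⟩ hab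
      simp only [Prod.mk.injEq] at hab ha hb hα hβ ⊢
      obtain ⟨e1, e2⟩ := hab
      have sa := sin_sq_add_cos_sq α
      have sb := sin_sq_add_cos_sq β
      have hsq : a ^ 2 = b ^ 2 := by
        have : (cos α * a - sin α * h)^2 + (sin α * a + cos α * h)^2
            = (cos β * b - sin β * h)^2 + (sin β * b + cos β * h)^2 := by rw [e1, e2]
        linear_combination this - (a^2+h^2) * sa + (b^2+h^2)*sb
      have hab := hinj a ha b hb hsq
      subst hab
      refine ⟨rfl, ?_⟩
      have ha0 : a ≠ 0 := fun h => h0 (h ▸ ha)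
      have hp : 0 < a ^ 2 + h ^ 2 := by positivity
      have : (a ^ 2 + h ^ 2) * cos α = (a ^ 2 + h ^ 2) * cos β := by
        linear_combination a * e1 + h * e2
      have hc := mul_left_cancel₀ hp.ne' this
      have hpi := pi_gt_three
      exact injOn_cos ⟨hα.1.le, by linarith [hα.2]⟩ ⟨hβ.1.le, by linarith [hβ.2]⟩ hc) f
  have hmeas : Measurable (fun z : ℝ × ℝ => f (cos z.2 * z.1 - sin z.2 * h, sin z.2 * z.1 + cos z.2 * h)) :=
    hf.comp (by fun_prop)
  calc _ = ∫⁻ y in S, ∫⁻ α in Ioo (0:ℝ) 1, ENNReal.ofReal |y| *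
      f (cos α * y - sin α * h, sin α * y + cos α * h) := by
        congr 1; ext y; rw [lintegral_const_mul]
        exact hf.comp (Measurable.prodMk (by fun_prop) (by fun_prop))
    _ = ∫⁻ z in S ×ˢ Ioo (0:ℝ) 1, ENNReal.ofReal |z.1| *
      f (cos z.2 * z.1 - sin z.2 * h, sin z.2 * z.1 + cos z.2 * h) := by
        rw [Measure.volume_eq_prod, ← Measure.prod_restrict, lintegral_prod]
        exact (Measurable.mul (by fun_prop) hmeas).aemeasurable
    _ = _ := by rw [key]; simp only [rotD_det]
    _ ≤ _ := setLIntegral_le_lintegral _ _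

lemma rot_plane (h : ℝ) (g f : ℝ × ℝ → ℝ≥0∞) (hf : Measurable f)
    (H : ∀ y, g (y, h) ≤ ∫⁻ α in Ioo (0:ℝ) 1, f (cos α * y - sin α * h, sin α * y + cos α * h)) :
    ∫⁻ y, ENNReal.ofReal |y| * g (y, h) ≤ 2 * ∫⁻ z, f z := by
  have h1 := rot_aux h (Ioi 0) measurableSet_Ioi (fun a ha b hb hab => by
    simp at ha hb; nlinarith) (by simp) f hf
  have h2 := rot_aux h (Iio 0) measurableSet_Iio (fun a ha b hb hab => by
    simp at ha hb; nlinarith) (by simp) f hf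
  have h3 : ∫⁻ y, ENNReal.ofReal |y| * g (y, h) ≤ ∫⁻ y, ENNReal.ofReal |y| * ∫⁻ α in Ioo (0:ℝ) 1,
        f (cos α * y - sin α * h, sin α * y + cos α * h) := by
        gcongr with y; exact H y
  refine h3.trans ?_
  rw [← lintegral_add_compl _ (measurableSet_Iio (a := (0:ℝ))), compl_Iio, two_mul,
    ← setLIntegral_congr (Ioi_ae_eq_Ici (a := (0:ℝ)))]
  exact add_le_add h2 h1

lemma circ {u u' : ℝ → ℝ} (hu : ∀ s, HasDerivAt u (u' s) s) (hc : Continuous u') :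
    ‖u 0‖ₑ ≤ ∫⁻ α in Ioo (0:ℝ) 1, (‖u α‖ₑ + ‖u' α‖ₑ) := by
  have hcu : Continuous u := continuous_iff_continuousAt.2 fun s => (hu s).continuousAt
  have h1 : ∀ α ∈ Ioo (0:ℝ) 1, ‖u 0‖ₑ ≤ ‖u α‖ₑ + ∫⁻ s in Ioo (0:ℝ) 1, ‖u' s‖ₑ := by
    intro α hα
    have e : u α - u 0 = ∫ s in (0:ℝ)..α, u' s :=
      (intervalIntegral.integral_eq_sub_of_hasDerivAt (fun s _ => hu s) (hc.intervalIntegrable _ _)).symm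
    have e2 : u 0 = u α - ∫ s in (0:ℝ)..α, u' s := by rw [← e]; ring
    rw [e2]
    refine (enorm_sub_le).trans ?_
    gcongr
    rw [intervalIntegral.integral_of_le hα.1.le]
    refine (enorm_integral_le_lintegral_enorm _).trans ?_
    apply lintegral_mono_set
    exact fun x hx => ⟨hx.1, lt_of_le_of_lt hx.2 hα.2⟩
  have hv : volume (Ioo (0:ℝ) 1) = 1 := by simp
  calc ‖u 0‖ₑ = ∫⁻ _ in Ioo (0:ℝ) 1, ‖u 0‖ₑ := by rw [setLIntegral_const, hv, mul_one]
    _ ≤ ∫⁻ α in Ioo (0:ℝ) 1, (‖u α‖ₑ + ∫⁻ s in Ioo (0:ℝ) 1, ‖u' s‖ₑ) :=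
        setLIntegral_mono' measurableSet_Ioo h1
    _ = _ := by
        rw [lintegral_add_left hcu.enorm.measurable, lintegral_add_left hcu.enorm.measurable,
          setLIntegral_const, hv, mul_one]

/-- coordinates -/
def pt (i j k : Fin 3) (a b c : ℝ) : E3 := a • ev i + b • ev j + c • ev k

lemma pt_swap (i j k : Fin 3) (a b c : ℝ) : pt i j k a b c = pt i k j a c b := by unfold pt; abel
lemma pt_rot (i j k : Fin 3) (a b c : ℝ) : pt i j k a b c = pt j i k b a c := by unfold pt; abel

lemma perm_ex (i j k : Fin 3) (h1 : i ≠ j) (h2 : j ≠ k) (h3 : i ≠ k) :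
    ∃ σ : Equiv.Perm (Fin 3), σ 0 = i ∧ σ 1 = j ∧ σ 2 = k := by
  revert i j k; decide

lemma pt_cont (i j k : Fin 3) : Continuous (fun z : ℝ × ℝ × ℝ => pt i j k z.1 z.2.1 z.2.2) := by
  unfold pt; fun_prop

lemma pt_lint (i j k : Fin 3) (h1 : i ≠ j) (h2 : j ≠ k) (h3 : i ≠ k) (f : E3 → ℝ≥0∞) (hf : Measurable f) :
    ∫⁻ c, ∫⁻ z : ℝ × ℝ, f (pt i j k z.1 z.2 c) = ∫⁻ x, f x := by
  obtain ⟨σ, rfl, rfl, rfl⟩ := perm_ex i j k h1 h2 h3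
  have m1 := (LinearIsometryEquiv.piLpCongrLeft 2 ℝ ℝ σ).measurePreserving
  have m2 := PiLp.volume_preserving_toLp (Fin 3)
  have m3 := (volume_preserving_piFinSuccAbove (fun _ : Fin 3 => ℝ) 2).symm
  have m4 := (volume_preserving_finTwoArrow ℝ).symm
  have m5 := (MeasurePreserving.id (volume : Measure ℝ)).prod m4
  have m6 := m1.comp (m2.comp (m3.comp m5))
  rw [← m6.lintegral_comp hf]
  rw [lintegral_prod]
  · congr 1; ext c; congr 1; ext z; congr 1
    apply (LinearIsometryEquiv.piLpCongrLeft 2 ℝ ℝ σ).symm.injective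
    simp only [Function.comp, LinearIsometryEquiv.symm_apply_apply]
    ext m
    fin_cases m <;> simp [pt, MeasurableEquiv.piFinSuccAbove,
      MeasurableEquiv.finTwoArrow] <;> rfl
  · exact (hf.comp m6.measurable).aemeasurable


/-- index of the rotation in the (i,j) plane -/
def ol (i j : Fin 3) : Fin 8 :=
  if (i, j) = (0, 1) ∨ (i, j) = (1, 0) then 6 else if (i, j) = (1, 2) ∨ (i, j) = (2, 1) then 4 else 5

lemma ol_spec (i j : Fin 3) (hij : i ≠ j) (f : Pt → ℝ) (p : Pt) :
    ‖p.2 i * dxi j f p - p.2 j * dxi i f p‖ₑ = ‖Gam (ol i j) f p‖ₑ := by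
  fin_cases i <;> fin_cases j <;> first | exact absurd rfl hij | skip
  all_goals simp [ol, Gam]
  all_goals rw [← enorm_neg]; congr 1; ring

lemma ol_sp (i j : Fin 3) : ol i j ∈ [1, 2, 3, 4, 5, (6 : Fin 8)] := by
  revert i j; decide

/-- index of dxi -/
def xl (i : Fin 3) : Fin 8 := Fin.castLE (by norm_num) i.succ
lemma xl_sp (i : Fin 3) : xl i ∈ [1, 2, 3, 4, 5, (6 : Fin 8)] := by
  revert i; decide

lemma pt_apply (i j k : Fin 3) (h1 : i ≠ j) (h2 : j ≠ k) (h3 : i ≠ k) (a b c : ℝ) :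
    (pt i j k a b c) i = a ∧ (pt i j k a b c) j = b := by
  constructor
  · simp [pt, h1, h3]
  · simp [pt, h1.symm, h2]

lemma pt_meas (i j k : Fin 3) {F : Pt → ℝ} (hF : Sm F) (t c : ℝ) :
    Measurable (fun z : ℝ × ℝ => ‖F (t, pt i j k z.1 z.2 c)‖ₑ) :=
  (hF.continuous.comp (by unfold pt; fun_prop)).enorm.measurable

lemma w1_meas : Measurable (fun z : ℝ × ℝ => ENNReal.ofReal |z.1|) := by fun_prop
lemma w2_meas : Measurable (fun z : ℝ × ℝ => ENNReal.ofReal (Real.sqrt (z.1 ^ 2 + z.2 ^ 2))) := by fun_prop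

lemma rot_slice (i j k : Fin 3) (h1 : i ≠ j) (h2 : j ≠ k) (h3 : i ≠ k) {F : Pt → ℝ} (hF : Sm F) (t c : ℝ)
    (w : ℝ × ℝ → ℝ≥0∞) (hw : Measurable w)
    (hwr : ∀ α y h, w (cos α * y - sin α * h, sin α * y + cos α * h) = w (y, h)) (h : ℝ) :
    ∫⁻ y, ENNReal.ofReal |y| * (w (y, h) * ‖F (t, pt i j k y h c)‖ₑ) ≤
      2 * ∫⁻ z : ℝ × ℝ, w z * (‖F (t, pt i j k z.1 z.2 c)‖ₑ + ‖Gam (ol i j) F (t, pt i j k z.1 z.2 c)‖ₑ) := by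
  have hcont : Continuous (fun z : ℝ × ℝ => ((t, pt i j k z.1 z.2 c) : Pt)) := by unfold pt; fun_prop
  refine rot_plane h (fun z => w z * ‖F (t, pt i j k z.1 z.2 c)‖ₑ)
    (fun z => w z * (‖F (t, pt i j k z.1 z.2 c)‖ₑ + ‖Gam (ol i j) F (t, pt i j k z.1 z.2 c)‖ₑ)) ?_ ?_
  · exact hw.mul (((hF.continuous.comp hcont).enorm.measurable).add
      ((Sm_Gam hF _).continuous.comp hcont).enorm.measurable)
  · intro y
    simp only [hwr]
    have hcu : Continuous (fun α : ℝ => pt i j k (cos α * y - sin α * h) (sin α * y + cos α * h) c) := by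
      unfold pt; fun_prop
    have hme : Measurable (fun α : ℝ => ‖F (t, pt i j k (cos α * y - sin α * h) (sin α * y + cos α * h) c)‖ₑ
        + ‖Gam (ol i j) F (t, pt i j k (cos α * y - sin α * h) (sin α * y + cos α * h) c)‖ₑ) := by
      have m1 : Measurable (fun α : ℝ => ‖F (t, pt i j k (cos α * y - sin α * h) (sin α * y + cos α * h) c)‖ₑ) :=
        (hF.continuous.comp (by fun_prop)).enorm.measurable
      have m2 : Measurable (fun α : ℝ => ‖Gam (ol i j) F (t, pt i j k (cos α * y - sin α * h) (sin α * y + cos α * h) c)‖ₑ) :=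
        ((Sm_Gam hF _).continuous.comp (by fun_prop)).enorm.measurable
      exact m1.add m2
    rw [lintegral_const_mul _ hme]
    gcongr
    have := circ (u := fun α => F (t, pt i j k (cos α * y - sin α * h) (sin α * y + cos α * h) c))
      (u' := fun α => (cos α * y - sin α * h) * dxi j F (t, pt i j k (cos α * y - sin α * h) (sin α * y + cos α * h) c)
        - (sin α * y + cos α * h) * dxi i F (t, pt i j k (cos α * y - sin α * h) (sin α * y + cos α * h) c)) ?_ ?_
    · simp only [cos_zero, sin_zero, one_mul, zero_mul, sub_zero, zero_add] at this
      refine this.trans (le_of_eq ?_)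
      congr 1; ext α; congr 1
      have hp := pt_apply i j k h1 h2 h3 (cos α * y - sin α * h) (sin α * y + cos α * h) c
      rw [← ol_spec i j h1]
      simp only [hp.1, hp.2]
    · intro α
      have e1 : HasDerivAt (fun α => cos α * y - sin α * h) (-(sin α * y + cos α * h)) α := by
        convert! ((hasDerivAt_cos α).mul_const y).sub ((hasDerivAt_sin α).mul_const h) using 1; ring
      have e2 : HasDerivAt (fun α => sin α * y + cos α * h) (cos α * y - sin α * h) α := by
        convert! ((hasDerivAt_sin α).mul_const y).add ((hasDerivAt_cos α).mul_const h) using 1; ring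
      have e3 : HasDerivAt (fun α : ℝ => pt i j k (cos α * y - sin α * h) (sin α * y + cos α * h) c)
          ((-(sin α * y + cos α * h)) • ev i + (cos α * y - sin α * h) • ev j) α := by
        unfold pt
        convert! ((e1.smul_const (ev i)).add (e2.smul_const (ev j))).add_const (c • ev k) using 1
      have e4 := (slice_hasFDerivAt hF t (pt i j k (cos α * y - sin α * h) (sin α * y + cos α * h) c)).comp_hasDerivAt α e3
      convert! e4 using 1
      rw [map_add, map_smul, map_smul]
      simp only [smul_eq_mul, ContinuousLinearMap.comp_apply, ContinuousLinearMap.inr_apply, dxi]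
      ring
    · refine Continuous.sub (Continuous.mul (by fun_prop) ?_) (Continuous.mul (by fun_prop) ?_)
      · exact (Sm_dxi hF j).continuous.comp (by fun_prop)
      · exact (Sm_dxi hF i).continuous.comp (by fun_prop)

lemma abs_le_norm (x : E3) (i : Fin 3) : |x i| ≤ ‖x‖ := PiLp.norm_apply_le x i

lemma line_aux {M : ℝ} (i j k : Fin 3) (h1 : i ≠ j) (h2 : j ≠ k) (h3 : i ≠ k) {F : Pt → ℝ} (hF : Good M F) {t : ℝ}
    (ht : 0 < t) (e a b c : ℝ) (he : e ≠ 0) :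
    ‖F (t, pt i j k (e * a) b c)‖ₑ ≤ ∫⁻ s in Iic a, ‖e * dxi i F (t, pt i j k (e * s) b c)‖ₑ := by
  have hd : ∀ s, HasDerivAt (fun s : ℝ => F (t, pt i j k (e * s) b c)) (e * dxi i F (t, pt i j k (e * s) b c)) s := by
    intro s
    have e1 : HasDerivAt (fun s : ℝ => pt i j k (e * s) b c) (e • ev i) s := by
      unfold pt
      have := (((hasDerivAt_id s).const_mul e).smul_const (ev i)).add_const (b • ev j)
      convert! this.add_const (c • ev k) using 1
      simp
    have e4 := (slice_hasFDerivAt hF.1 t (pt i j k (e * s) b c)).comp_hasDerivAt s e1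
    convert! e4 using 1
    rw [map_smul]; rfl
  have hcd : ContDiff ℝ 1 (fun s : ℝ => F (t, pt i j k (e * s) b c)) := by
    have : ContDiff ℝ 1 F := hF.1.of_le (by exact_mod_cast le_top)
    refine this.comp ?_
    unfold pt; fun_prop
  have hcs : HasCompactSupport (fun s : ℝ => F (t, pt i j k (e * s) b c)) := by
    apply HasCompactSupport.of_support_subset_isCompact (isCompact_closedBall (0 : ℝ) ((t + M) / |e|))
    intro s hs
    simp only [mem_closedBall_zero_iff, Real.norm_eq_abs]
    by_contra hc
    push Not at hc
    rw [div_lt_iff₀ (abs_pos.2 he), ← abs_mul] at hc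
    refine hs (hF.2 _ ht (hc.trans_le ?_))
    have := abs_le_norm (pt i j k (e * s) b c) i
    rw [(pt_apply i j k h1 h2 h3 _ _ _).1] at this
    rwa [mul_comm s e]
  have := hcs.enorm_le_lintegral_Ici_deriv hcd a
  simpa only [(hd _).deriv] using this

lemma line1 {M : ℝ} (i j k : Fin 3) (h1 : i ≠ j) (h2 : j ≠ k) (h3 : i ≠ k) {F : Pt → ℝ} (hF : Good M F) {t : ℝ}
    (ht : 0 < t) (a b c : ℝ) :
    ‖F (t, pt i j k a b c)‖ₑ ≤ ∫⁻ s, ‖Gam (xl i) F (t, pt i j k s b c)‖ₑ := by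
  have := line_aux i j k h1 h2 h3 hF ht 1 a b c one_ne_zero
  simp only [one_mul, dxi_eq_Gam] at this
  exact this.trans (setLIntegral_le_lintegral _ _)

lemma line2 {M : ℝ} (i j k : Fin 3) (h1 : i ≠ j) (h2 : j ≠ k) (h3 : i ≠ k) {F : Pt → ℝ} (hF : Good M F) {t : ℝ}
    (ht : 0 < t) (a b c : ℝ) :
    ENNReal.ofReal (a ^ 2) * ‖F (t, pt i j k a b c)‖ₑ ≤
      ∫⁻ s, ENNReal.ofReal (s ^ 2) * ‖Gam (xl i) F (t, pt i j k s b c)‖ₑ := by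
  have hm : Measurable (fun s : ℝ => ‖Gam (xl i) F (t, pt i j k s b c)‖ₑ) :=
    ((Sm_Gam hF.1 _).continuous.comp (by unfold pt; fun_prop)).enorm.measurable
  rcases le_total a 0 with h | h
  · have := line_aux i j k h1 h2 h3 hF ht 1 a b c one_ne_zero
    simp only [one_mul, dxi_eq_Gam] at this
    calc _ ≤ ENNReal.ofReal (a ^ 2) * ∫⁻ s in Iic a, ‖Gam (xl i) F (t, pt i j k s b c)‖ₑ := by gcongr; exact this
      _ = ∫⁻ s in Iic a, ENNReal.ofReal (a ^ 2) * ‖Gam (xl i) F (t, pt i j k s b c)‖ₑ := by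
        rw [lintegral_const_mul _ hm]
      _ ≤ ∫⁻ s in Iic a, ENNReal.ofReal (s ^ 2) * ‖Gam (xl i) F (t, pt i j k s b c)‖ₑ := by
        apply setLIntegral_mono' measurableSet_Iic
        intro s hs
        simp only [mem_Iic] at hs
        gcongr ?_ * _
        apply ENNReal.ofReal_le_ofReal
        nlinarith
      _ ≤ _ := setLIntegral_le_lintegral _ _
  · have := line_aux i j k h1 h2 h3 hF ht (-1) (-a) b c (by norm_num)
    simp only [neg_mul, one_mul, neg_neg, enorm_neg, dxi_eq_Gam] at this
    calc _ ≤ ENNReal.ofReal (a ^ 2) * ∫⁻ s in Iic (-a), ‖Gam (xl i) F (t, pt i j k (-s) b c)‖ₑ := by gcongr; exact this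
      _ = ∫⁻ s in Iic (-a), ENNReal.ofReal (a ^ 2) * ‖Gam (xl i) F (t, pt i j k (-s) b c)‖ₑ := by
        have hm2 : Measurable (fun s : ℝ => ‖Gam (xl i) F (t, pt i j k (-s) b c)‖ₑ) := hm.comp measurable_neg
        rw [lintegral_const_mul _ hm2]
      _ ≤ ∫⁻ s in Iic (-a), ENNReal.ofReal ((-s) ^ 2) * ‖Gam (xl i) F (t, pt i j k (-s) b c)‖ₑ := by
        apply setLIntegral_mono' measurableSet_Iic
        intro s hs
        simp only [mem_Iic] at hs
        gcongr ?_ * _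
        apply ENNReal.ofReal_le_ofReal
        nlinarith
      _ ≤ ∫⁻ s, ENNReal.ofReal ((-s) ^ 2) * ‖Gam (xl i) F (t, pt i j k (-s) b c)‖ₑ := setLIntegral_le_lintegral _ _
      _ = _ := lintegral_neg_eq_self (fun s => ENNReal.ofReal (s ^ 2) * ‖Gam (xl i) F (t, pt i j k s b c)‖ₑ)

lemma space_gain (i j k : Fin 3) (h1 : i ≠ j) (h2 : j ≠ k) (h3 : i ≠ k) {g : Pt → ℝ} (hg : Sm g) (t c : ℝ) (B : ℝ≥0∞)
    (b1 : ∫⁻ x : E3, ‖g (t, x)‖ₑ ≤ B) (b2 : ∫⁻ x : E3, ‖Gam (ol i k) g (t, x)‖ₑ ≤ B) :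
    ∫⁻ z : ℝ × ℝ, ENNReal.ofReal |z.1| * ‖g (t, pt i j k z.1 z.2 c)‖ₑ ≤ 4 * B := by
  have hm : Measurable (fun z : ℝ × ℝ => ENNReal.ofReal |z.1| * ‖g (t, pt i j k z.1 z.2 c)‖ₑ) := by
    exact w1_meas.mul (pt_meas i j k hg t c)
  rw [Measure.volume_eq_prod, lintegral_prod_symm _ hm.aemeasurable]
  have hA : ∀ s : ℝ, ∫⁻ y, ENNReal.ofReal |y| * ‖g (t, pt i j k y s c)‖ₑ ≤
      2 * ∫⁻ z : ℝ × ℝ, (‖g (t, pt i k j z.1 z.2 s)‖ₑ + ‖Gam (ol i k) g (t, pt i k j z.1 z.2 s)‖ₑ) := by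
    intro s
    have := rot_slice i k j h3 h2.symm h1 hg t s (fun _ => 1) measurable_const (fun _ _ _ => rfl) c
    simp only [one_mul] at this
    simpa only [pt_swap i j k] using this
  refine (lintegral_mono hA).trans ?_
  rw [lintegral_const_mul' _ _ (by simp)]
  have hm1 : Measurable (fun x : E3 => ‖g (t, x)‖ₑ) := (hg.slice t).enorm.measurable
  have hm2 : Measurable (fun x : E3 => ‖Gam (ol i k) g (t, x)‖ₑ) := ((Sm_Gam hg _).slice t).enorm.measurable
  rw [pt_lint i k j h3 h2.symm h1 (fun x => ‖g (t, x)‖ₑ + ‖Gam (ol i k) g (t, x)‖ₑ) (hm1.add hm2),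
    lintegral_add_left hm1]
  calc _ ≤ 2 * (B + B) := by gcongr
    _ = 4 * B := by rw [← two_mul, ← mul_assoc]; norm_num

/-- spatial letters -/
def spl : List (Fin 8) := [1, 2, 3, 4, 5, 6]

lemma sob_w {M : ℝ} (i j k : Fin 3) (h1 : i ≠ j) (h2 : j ≠ k) (h3 : i ≠ k) {G : Pt → ℝ} (hG : Good M G) {t : ℝ}
    (ht : 0 < t) (a b c : ℝ) (B : ℝ≥0∞)
    (hB : ∀ w : List (Fin 8), w.length ≤ 3 → w ⊆ spl → ∫⁻ x : E3, ‖GamWord w G (t, x)‖ₑ ≤ B) :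
    ENNReal.ofReal (a ^ 2) * ‖G (t, pt i j k a b c)‖ₑ ≤ 32 * B := by
  have s1 : xl i ∈ spl := xl_sp i
  have s2 : ∀ i j, ol i j ∈ spl := ol_sp
  refine (line2 i j k h1 h2 h3 hG ht a b c).trans ?_
  set g := Gam (xl i) G with hgdef
  have hg : Sm g := Sm_Gam hG.1 _
  have hρ : Continuous (fun z : ℝ × ℝ => Real.sqrt (z.1 ^ 2 + z.2 ^ 2)) := by fun_prop
  have r1 := rot_slice i j k h1 h2 h3 hg t c (fun z => ENNReal.ofReal (Real.sqrt (z.1 ^ 2 + z.2 ^ 2)))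
    (by fun_prop) (by
      intro α y h
      congr 2
      linear_combination (y ^ 2 + h ^ 2) * sin_sq_add_cos_sq α) b
  have r0 : ∫⁻ s, ENNReal.ofReal (s ^ 2) * ‖g (t, pt i j k s b c)‖ₑ ≤
      ∫⁻ y, ENNReal.ofReal |y| * (ENNReal.ofReal (Real.sqrt (y ^ 2 + b ^ 2)) * ‖g (t, pt i j k y b c)‖ₑ) := by
    refine lintegral_mono fun s => ?_
    rw [← mul_assoc, ← ENNReal.ofReal_mul (abs_nonneg _)]
    gcongr
    rw [← sq_abs, pow_two]
    gcongr
    apply Real.abs_le_sqrt; nlinarith [sq_abs s, sq_nonneg b]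
  have r2 : ∀ g : Pt → ℝ, Sm g → (∀ w : List (Fin 8), w.length ≤ 1 → w ⊆ spl → ∫⁻ x : E3, ‖GamWord w g (t, x)‖ₑ ≤ B) →
      ∫⁻ z : ℝ × ℝ, ENNReal.ofReal (Real.sqrt (z.1 ^ 2 + z.2 ^ 2)) * ‖g (t, pt i j k z.1 z.2 c)‖ₑ ≤ 8 * B := by
    intro g hg hb
    have q1 := space_gain i j k h1 h2 h3 hg t c B (hb [] (by simp) (by simp)) (hb [_] (by simp) (by simp [s2]))
    have q2 := space_gain j i k h1.symm h3 h2 hg t c B (hb [] (by simp) (by simp)) (hb [_] (by simp) (by simp [s2]))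
    have q3 : ∫⁻ z : ℝ × ℝ, ENNReal.ofReal |z.2| * ‖g (t, pt i j k z.1 z.2 c)‖ₑ ≤ 4 * B := by
      rw [Measure.volume_eq_prod, ← (MeasureTheory.Measure.measurePreserving_swap (μ := (volume : Measure ℝ)) (ν := (volume : Measure ℝ))).lintegral_comp] at q2
      · simpa only [Prod.fst_swap, Prod.snd_swap, pt_rot j i k, Measure.volume_eq_prod] using q2
      · exact w1_meas.mul (pt_meas j i k hg t c)
    calc _ ≤ ∫⁻ z : ℝ × ℝ, (ENNReal.ofReal |z.1| * ‖g (t, pt i j k z.1 z.2 c)‖ₑ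
          + ENNReal.ofReal |z.2| * ‖g (t, pt i j k z.1 z.2 c)‖ₑ) := by
          gcongr with z
          rw [← add_mul, ← ENNReal.ofReal_add (abs_nonneg _) (abs_nonneg _)]
          gcongr
          apply Real.sqrt_le_iff.2 ⟨by positivity, _⟩
          nlinarith [sq_abs z.1, sq_abs z.2, abs_nonneg z.1, abs_nonneg z.2, mul_nonneg (abs_nonneg z.1) (abs_nonneg z.2)]
      _ ≤ 4 * B + 4 * B := by
          rw [lintegral_add_left]
          · exact add_le_add q1 q3
          · exact w1_meas.mul (pt_meas i j k hg t c)
      _ = 8 * B := by rw [← add_mul]; norm_num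
  refine r0.trans (r1.trans ?_)
  simp only [mul_add]
  rw [lintegral_add_left]
  · have p1 := r2 g hg (fun w hw hs => by
      have := hB (w ++ [xl i]) (by simp; omega) (by simp [hs, s1])
      rwa [GW_snoc] at this)
    have p2 := r2 (Gam (ol i j) g) (Sm_Gam hg _) (fun w hw hs => by
      have := hB ((w ++ [ol i j]) ++ [xl i]) (by simp; omega) (by simp [hs, s1, s2])
      rwa [GW_snoc, GW_snoc] at this)
    calc _ ≤ 2 * (8 * B + 8 * B) := by gcongr
      _ = 32 * B := by rw [← add_mul, ← mul_assoc]; norm_num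
  · exact w2_meas.mul (pt_meas i j k hg t c)

lemma sob_u {M : ℝ} {G : Pt → ℝ} (hG : Good M G) {t : ℝ}
    (ht : 0 < t) (a b c : ℝ) (B : ℝ≥0∞)
    (hB : ∀ w : List (Fin 8), w.length ≤ 3 → w ⊆ spl → ∫⁻ x : E3, ‖GamWord w G (t, x)‖ₑ ≤ B) :
    ‖G (t, pt 0 1 2 a b c)‖ₑ ≤ B := by
  have e1 := fun a b c => line1 0 1 2 (by decide) (by decide) (by decide) hG ht a b c
  have e2 := fun a b c => line1 1 0 2 (by decide) (by decide) (by decide) (hG.gam (xl 0)) ht a b c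
  have e3 := fun a b c => line1 2 0 1 (by decide) (by decide) (by decide) ((hG.gam (xl 0)).gam (xl 1)) ht a b c
  have hS : Sm (Gam (xl 2) (Gam (xl 1) (Gam (xl 0) G))) := (((hG.gam (xl 0)).gam (xl 1)).gam (xl 2)).1
  have hb := hB [xl 2, xl 1, xl 0] (by simp) (by decide)
  rw [← pt_lint 0 1 2 (by decide) (by decide) (by decide) _ ((Sm_GamWord hG.1 _).slice t).enorm.measurable] at hb
  refine le_trans ?_ hb
  calc ‖G (t, pt 0 1 2 a b c)‖ₑ ≤ ∫⁻ a, ∫⁻ b, ∫⁻ c, ‖Gam (xl 2) (Gam (xl 1) (Gam (xl 0) G)) (t, pt 0 1 2 a b c)‖ₑ := by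
        refine (e1 a b c).trans ?_
        gcongr with a
        rw [pt_rot]
        refine (e2 b a c).trans ?_
        gcongr with b
        refine le_trans (le_of_eq ?_) ((e3 c a b).trans (le_of_eq ?_))
        · congr 3; unfold pt; abel
        · congr 1; ext c; congr 3; unfold pt; abel
    _ = ∫⁻ z : ℝ × ℝ, ∫⁻ c, ‖Gam (xl 2) (Gam (xl 1) (Gam (xl 0) G)) (t, pt 0 1 2 z.1 z.2 c)‖ₑ := by
        rw [Measure.volume_eq_prod, lintegral_prod]
        refine (Measurable.lintegral_prod_right' (f := fun z : (ℝ × ℝ) × ℝ => ‖Gam (xl 2) (Gam (xl 1) (Gam (xl 0) G)) (t, pt 0 1 2 z.1.1 z.1.2 z.2)‖ₑ) ?_).aemeasurable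
        exact (hS.continuous.comp (by unfold pt; fun_prop)).enorm.measurable
    _ = _ := by
        rw [lintegral_lintegral_swap]
        · rfl
        · exact (hS.continuous.comp (by unfold pt; fun_prop)).enorm.measurable.aemeasurable
    _ ≤ _ := le_rfl


/-- spatial words -/
def SW (m : ℕ) : Finset (List (Fin 8)) := (WD m).filter (fun c => c ⊆ spl)
lemma mem_SW {m : ℕ} {c : List (Fin 8)} : c ∈ SW m ↔ c.length ≤ m ∧ c ⊆ spl := by
  simp [SW, mem_WD]

lemma pt_self (x : E3) : pt 0 1 2 (x 0) (x 1) (x 2) = x := by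
  unfold pt
  conv_rhs => rw [e3_decomp x, Fin.sum_univ_three]

lemma sobolev : ∃ C : ℝ, 0 ≤ C ∧ ∀ (M t : ℝ) (F : Pt → ℝ) (B : ℝ), 0 < t → Good M F → 0 ≤ B →
    (∀ c : List (Fin 8), c.length ≤ 3 → c ⊆ spl → L2norm (fun x => GamWord c F (t, x)) ≤ B) →
    ∀ x : E3, (1 + ‖x‖) * |F (t, x)| ≤ C * B := by
  obtain ⟨T, memT⟩ : ∃ T : Finset (List (Fin 8)), ∀ c, c ∈ T ↔ c.length ≤ 3 ∧ c ⊆ spl := ⟨SW 3, fun _ => mem_SW⟩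
  set K : ℝ := 8 * (T).card with hK
  have hK0 : 0 ≤ K := by positivity
  refine ⟨Real.sqrt (2 * 97 * K), by positivity, fun M t F B ht hF hB0 hB x => ?_⟩
  have hG : Good M (fun p => F p * F p) := hF.mulr hF.1
  have key : ∀ w : List (Fin 8), w.length ≤ 3 → w ⊆ spl →
      ∫⁻ x : E3, ‖GamWord w (fun p => F p * F p) (t, x)‖ₑ ≤ ENNReal.ofReal (K * B ^ 2) := by
    intro w hw hs
    have h1 : ∀ x : E3, |GamWord w (fun p => F p * F p) (t, x)| ≤ 8 * ∑ c ∈ T, GamWord c F (t, x) ^ 2 := by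
      intro x
      have hS : 0 ≤ ∑ c ∈ T, GamWord c F (t, x) ^ 2 := Finset.sum_nonneg fun _ _ => sq_nonneg _
      have := leib w F F hF.1 hF.1 (t, x) (∑ c ∈ T, GamWord c F (t, x) ^ 2) (by
        intro a1 a2 hl s1 s2
        have e1 := Finset.single_le_sum (f := fun c => GamWord c F (t, x) ^ 2) (s := T)
          (fun _ _ => sq_nonneg _) ((memT _).2 ⟨by omega, fun z hz => hs (s1 hz)⟩ : a1 ∈ T)
        have e2 := Finset.single_le_sum (f := fun c => GamWord c F (t, x) ^ 2) (s := T)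
          (fun _ _ => sq_nonneg _) ((memT _).2 ⟨by omega, fun z hz => hs (s2 hz)⟩ : a2 ∈ T)
        rw [abs_le]
        constructor <;> nlinarith [sq_nonneg (GamWord a1 F (t, x) - GamWord a2 F (t, x)),
          sq_nonneg (GamWord a1 F (t, x) + GamWord a2 F (t, x))])
      refine this.trans ?_
      gcongr
      calc (2:ℝ) ^ w.length ≤ 2 ^ 3 := pow_le_pow_right₀ (by norm_num) hw
        _ = 8 := by norm_num
    have hint : Integrable (fun x : E3 => 8 * ∑ c ∈ T, GamWord c F (t, x) ^ 2) :=
      (integrable_finsetSum _ fun c _ => ((hF.gw c).cc ht).sqint).const_mul _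
    calc _ ≤ ∫⁻ x : E3, ENNReal.ofReal (8 * ∑ c ∈ T, GamWord c F (t, x) ^ 2) := by
          refine lintegral_mono fun x => ?_
          rw [Real.enorm_eq_ofReal_abs]
          exact ENNReal.ofReal_le_ofReal (h1 x)
      _ = ENNReal.ofReal (∫ x : E3, 8 * ∑ c ∈ T, GamWord c F (t, x) ^ 2) :=
          (ofReal_integral_eq_lintegral_ofReal hint (Filter.Eventually.of_forall fun x => by
            have : 0 ≤ ∑ c ∈ T, GamWord c F (t, x) ^ 2 := Finset.sum_nonneg fun _ _ => sq_nonneg _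
            positivity)).symm
      _ ≤ _ := by
          apply ENNReal.ofReal_le_ofReal
          rw [integral_const_mul, integral_finsetSum _ fun c _ => ((hF.gw c).cc ht).sqint, hK, mul_assoc]
          gcongr
          rw [← nsmul_eq_mul]
          apply Finset.sum_le_card_nsmul
          intro c hc
          rw [← L2_sq]
          have := hB c ((memT _).1 hc).1 ((memT _).1 hc).2
          have h0 := L2_nonneg (fun x => GamWord c F (t, x))
          gcongr
  have fin : ∀ (n : ℕ) (y : ℝ), 0 ≤ y → ENNReal.ofReal y * ‖F (t, x) * F (t, x)‖ₑ ≤ n * ENNReal.ofReal (K * B ^ 2) →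
      y * F (t, x) ^ 2 ≤ n * (K * B ^ 2) := by
    intro n y hy h
    rw [Real.enorm_eq_ofReal_abs, ← ENNReal.ofReal_mul hy, ← ENNReal.ofReal_natCast n,
      ← ENNReal.ofReal_mul (by positivity), ENNReal.ofReal_le_ofReal_iff (by positivity), abs_mul_self] at h
    rwa [pow_two]
  have e0 := sob_u hG ht (x 0) (x 1) (x 2) _ key
  have e1 := sob_w 0 1 2 (by decide) (by decide) (by decide) hG ht (x 0) (x 1) (x 2) _ key
  have e2 := sob_w 1 0 2 (by decide) (by decide) (by decide) hG ht (x 1) (x 0) (x 2) _ key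
  have e3 := sob_w 2 0 1 (by decide) (by decide) (by decide) hG ht (x 2) (x 0) (x 1) _ key
  have q2 : pt 1 0 2 (x 1) (x 0) (x 2) = x := by rw [pt_rot, pt_self]
  have q3 : pt 2 0 1 (x 2) (x 0) (x 1) = x := by rw [pt_rot, pt_swap, pt_self]
  rw [pt_self] at e0 e1
  rw [q2] at e2
  rw [q3] at e3
  have f0 := fin 1 1 zero_le_one (by simpa using e0)
  have f1 := fin 32 _ (sq_nonneg _) (by exact_mod_cast e1)
  have f2 := fin 32 _ (sq_nonneg _) (by exact_mod_cast e2)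
  have f3 := fin 32 _ (sq_nonneg _) (by exact_mod_cast e3)
  push_cast at f0 f1 f2 f3
  have hn : ‖x‖ ^ 2 = x 0 ^ 2 + x 1 ^ 2 + x 2 ^ 2 := by
    rw [EuclideanSpace.real_norm_sq_eq, Fin.sum_univ_three]
  have hfin : ((1 + ‖x‖) * |F (t, x)|) ^ 2 ≤ 2 * 97 * K * B ^ 2 := by
    rw [mul_pow, sq_abs]
    calc (1 + ‖x‖) ^ 2 * F (t, x) ^ 2 ≤ (2 * (1 + ‖x‖ ^ 2)) * F (t, x) ^ 2 := by
          gcongr; nlinarith [sq_nonneg (1 - ‖x‖)]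
      _ ≤ _ := by rw [hn]; nlinarith
  calc _ ≤ Real.sqrt (2 * 97 * K * B ^ 2) := Real.le_sqrt_of_sq_le hfin
    _ = _ := by rw [Real.sqrt_mul (by positivity), Real.sqrt_sq hB0]

end


def nm (t : ℝ) (f : Pt → ℝ) : ℝ := L2norm (fun x : E3 => f (t, x))

lemma nm_nonneg (t : ℝ) (f : Pt → ℝ) : 0 ≤ nm t f := L2_nonneg _
lemma nm_sq (t : ℝ) (f : Pt → ℝ) : nm t f ^ 2 = ∫ x : E3, f (t, x) ^ 2 := L2_sq _

lemma CC.abs {g : E3 → ℝ} (h : CC g) : CC (fun x => |g x|) :=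
  ⟨h.1.abs, h.2.comp_left (g := fun y : ℝ => |y|) abs_zero⟩

lemma L2_sum {ι : Type*} (s : Finset ι) (w : ι → ℝ) (hw : ∀ i ∈ s, 0 ≤ w i) (g : ι → E3 → ℝ)
    (hg : ∀ i ∈ s, CC (g i)) (f : E3 → ℝ) (h : ∀ x, |f x| ≤ ∑ i ∈ s, w i * |g i x|) :
    L2norm f ≤ ∑ i ∈ s, w i * L2norm (g i) := by
  apply L2_le_of_int (Finset.sum_nonneg fun i hi => mul_nonneg (hw i hi) (L2_nonneg _))
  have hint : ∀ i ∈ s, ∀ j ∈ s, Integrable (fun x => (w i * |g i x|) * (w j * |g j x|)) := by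
    intro i hi j hj
    have := (((hg j hj).abs.mul (f := fun _ => w j) continuous_const).mul (f := fun x => w i * |g i x|)
      (continuous_const.mul (hg i hi).abs.1)).int
    exact this
  have e1 : ∀ x, (∑ i ∈ s, w i * |g i x|) ^ 2 = ∑ i ∈ s, ∑ j ∈ s, (w i * |g i x|) * (w j * |g j x|) := by
    intro x; rw [pow_two, Finset.sum_mul_sum]
  calc ∫ x, f x ^ 2 ≤ ∫ x, ∑ i ∈ s, ∑ j ∈ s, (w i * |g i x|) * (w j * |g j x|) := by
        apply integral_mono_of_nonneg (Filter.Eventually.of_forall fun x => sq_nonneg _)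
        · exact integrable_finsetSum _ fun i hi => integrable_finsetSum _ fun j hj => hint i hi j hj
        · refine Filter.Eventually.of_forall fun x => ?_
          show f x ^ 2 ≤ ∑ i ∈ s, ∑ j ∈ s, (w i * |g i x|) * (w j * |g j x|)
          rw [← e1, ← sq_abs]
          exact pow_le_pow_left₀ (abs_nonneg _) (h x) 2
    _ = ∑ i ∈ s, ∑ j ∈ s, ∫ x, (w i * |g i x|) * (w j * |g j x|) := by
        rw [integral_finsetSum _ fun i hi => integrable_finsetSum _ fun j hj => hint i hi j hj]
        exact Finset.sum_congr rfl fun i hi => integral_finsetSum _ fun j hj => hint i hi j hj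
    _ ≤ ∑ i ∈ s, ∑ j ∈ s, (w i * L2norm (g i)) * (w j * L2norm (g j)) := by
        refine Finset.sum_le_sum fun i hi => Finset.sum_le_sum fun j hj => ?_
        have h1 := (le_abs_self _).trans (L2_cs (hg i hi).abs (hg j hj).abs)
        have h2 : ∀ k, L2norm (fun x => |g k x|) = L2norm (g k) := by intro k; simp [L2norm]
        rw [h2, h2] at h1
        calc ∫ x, (w i * |g i x|) * (w j * |g j x|) = (w i * w j) * ∫ x, |g i x| * |g j x| := by
              rw [← integral_const_mul]; congr 1; funext x; ring
          _ ≤ (w i * w j) * (L2norm (g i) * L2norm (g j)) :=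
              mul_le_mul_of_nonneg_left h1 (mul_nonneg (hw i hi) (hw j hj))
          _ = _ := by ring
    _ = _ := by rw [pow_two, Finset.sum_mul_sum]

lemma nm_sum {ι : Type*} {M t : ℝ} (ht : 0 < t) (s : Finset ι) (w : ι → ℝ) (hw : ∀ i ∈ s, 0 ≤ w i)
    (g : ι → Pt → ℝ) (hg : ∀ i ∈ s, Good M (g i)) {f : Pt → ℝ} (hf : Good M f)
    (h : ∀ x : E3, ‖x‖ ≤ t + M → |f (t, x)| ≤ ∑ i ∈ s, w i * |g i (t, x)|) :
    nm t f ≤ ∑ i ∈ s, w i * nm t (g i) := by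
  refine L2_sum s w hw (fun i x => g i (t, x)) (fun i hi => (hg i hi).cc ht) _ fun x => ?_
  rcases le_or_gt ‖x‖ (t + M) with hx | hx
  · exact h x hx
  · rw [hf.2 (t, x) ht hx, abs_zero]
    exact Finset.sum_nonneg fun i hi => mul_nonneg (hw i hi) (abs_nonneg _)

lemma nm_one {M t : ℝ} (ht : 0 < t) {w : ℝ} (hw : 0 ≤ w) {f g : Pt → ℝ} (hg : Good M g) (hf : Good M f)
    (h : ∀ x : E3, ‖x‖ ≤ t + M → |f (t, x)| ≤ w * |g (t, x)|) : nm t f ≤ w * nm t g := by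
  have := nm_sum ht (Finset.univ : Finset Unit) (fun _ => w) (fun _ _ => hw) (fun _ => g) (fun _ _ => hg) hf
    (by simpa using h)
  simpa using this

lemma nm_two {M t : ℝ} (ht : 0 < t) {v w : ℝ} (hv : 0 ≤ v) (hw : 0 ≤ w) {f g k : Pt → ℝ}
    (hg : Good M g) (hk : Good M k) (hf : Good M f)
    (h : ∀ x : E3, ‖x‖ ≤ t + M → |f (t, x)| ≤ v * |g (t, x)| + w * |k (t, x)|) :
    nm t f ≤ v * nm t g + w * nm t k := by
  have := nm_sum ht (Finset.univ : Finset (Fin 2)) ![v, w] (by intro i _; fin_cases i <;> simpa) ![g, k]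
    (by intro i _; fin_cases i <;> simpa) hf (by simpa using h)
  simpa using this

lemma nm_cs {M t : ℝ} (ht : 0 < t) {f g : Pt → ℝ} (hf : Good M f) (hg : Good M g) :
    |∫ x : E3, f (t, x) * g (t, x)| ≤ nm t f * nm t g := L2_cs (hf.cc ht) (hg.cc ht)

lemma nm_mulc {t : ℝ} (f : Pt → ℝ) (g : Pt → ℝ) (c : ℝ) (hg : ∀ x, g (t, x) = c * f (t, x)) :
    nm t g = |c| * nm t f := by
  unfold nm L2norm
  simp only [hg, mul_pow]
  rw [integral_const_mul, Real.sqrt_mul (sq_nonneg _), Real.sqrt_sq_eq_abs]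

/-- the weight with frozen time -/
def Wf (t0 : ℝ) (p : Pt) : ℝ := (t0 ^ 2 - ∑ k, p.2 k ^ 2) / (1 + t0)

lemma Sm_Wf (t0 : ℝ) : Sm (Wf t0) := by
  unfold Wf
  have : ∀ k : Fin 3, ContDiff ℝ (⊤ : ℕ∞) (fun p : Pt => p.2 k) := fun k => by fun_prop
  unfold Sm
  fun_prop

lemma Wf_eq (t0 : ℝ) (x : E3) : Wf t0 (t0, x) = (t0 ^ 2 - ‖x‖ ^ 2) / (1 + t0) := by
  rw [EuclideanSpace.real_norm_sq_eq]; rfl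

lemma dxi_Wf (t0 : ℝ) (i : Fin 3) (p : Pt) : dxi i (Wf t0) p = -2 * p.2 i / (1 + t0) := by
  unfold dxi
  have h0 : ∀ k : Fin 3, HasFDerivAt (fun p : Pt => p.2 k)
      ((EuclideanSpace.proj k : E3 →L[ℝ] ℝ).comp (ContinuousLinearMap.snd ℝ ℝ E3)) p := fun k =>
    ((EuclideanSpace.proj k : E3 →L[ℝ] ℝ).comp (ContinuousLinearMap.snd ℝ ℝ E3)).hasFDerivAt
  have h1 := ((HasFDerivAt.fun_sum (u := Finset.univ) (fun k _ => (h0 k).pow 2)).const_sub (t0 ^ 2)).mul_const ((1 + t0)⁻¹)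
  have h2 : HasFDerivAt (Wf t0) _ p := h1
  rw [h2.fderiv]
  simp
  ring

lemma dxi_comm {f : Pt → ℝ} (hf : Sm f) (i j : Fin 3) : dxi i (dxi j f) = dxi j (dxi i f) := by
  rw [dxi_eq_Gam j, dxi_Gam hf]
  have : ∀ k, ck (Fin.castLE (by decide) j.succ) i k = 0 := by
    intro k; fin_cases j <;> simp [ck, Lk, Fin.castLE] <;> rfl
  funext p
  rw [← dxi_eq_Gam]
  simp only [this, zero_mul, Finset.sum_const_zero, add_zero]

lemma quad_lem {a b R X Y : ℝ} (ha : 0 ≤ a) (hb : 0 ≤ b) (hR : 0 ≤ R) (hX : 0 ≤ X) (hY : 0 ≤ Y)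
    (h : X ^ 2 + Y ^ 2 ≤ a * R ^ 2 + b * R * Y) : X ≤ (1 + a + b) * R ∧ Y ≤ (1 + a + b) * R := by
  constructor
  · rw [← pow_le_pow_iff_left₀ hX (by positivity) two_ne_zero]
    nlinarith [sq_nonneg (Y - b * R / 2), mul_nonneg ha (sq_nonneg R), mul_nonneg hb (sq_nonneg R), sq_nonneg R,
      mul_nonneg (mul_nonneg ha hb) (sq_nonneg R), mul_nonneg (mul_nonneg hb hb) (sq_nonneg R), mul_nonneg (mul_nonneg ha ha) (sq_nonneg R)]
  · by_contra hc
    push Not at hc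
    have h1 : (1 + a) * R < Y - b * R := by linarith
    have h2 : (1 + a) * R ≤ Y := by nlinarith [mul_nonneg hb hR]
    have h0 : 0 < Y := lt_of_le_of_lt (by positivity) hc
    have h3 : Y * ((1 + a) * R) < Y * (Y - b * R) := mul_lt_mul_of_pos_left h1 h0
    have h4 : ((1 + a) * R) * ((1 + a) * R) ≤ Y * ((1 + a) * R) := by gcongr
    nlinarith [mul_nonneg ha (sq_nonneg R), mul_nonneg (mul_nonneg ha ha) (sq_nonneg R), sq_nonneg X, sq_nonneg R]


lemma ell_pair {M t : ℝ} (ht : 0 < t) {h φ : Pt → ℝ} (hh : Sm h) (hφ : Good M φ) (i j : Fin 3) :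
    ∫ x : E3, (h (t, x) * dxi i (dxi j φ) (t, x)) ^ 2 =
      (∫ x : E3, (h (t, x) * dxi i (dxi i φ) (t, x)) * (h (t, x) * dxi j (dxi j φ) (t, x)))
      + ((∫ x : E3, (2 * dxi j h (t, x) * (h (t, x) * dxi i (dxi i φ) (t, x))) * dxi j φ (t, x))
      - ∫ x : E3, (2 * dxi i h (t, x) * (h (t, x) * dxi i (dxi j φ) (t, x))) * dxi j φ (t, x)) := by
  have hij := (hφ.dxi j).dxi i
  have hii := (hφ.dxi i).dxi i
  have hhh := Sm_mul hh hh
  have e1 := ibp (hφ.dxi j) (Sm_mul hhh hij.1) ht i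
  have e2 := ibp (hφ.dxi j) (Sm_mul hhh hii.1) ht j
  rw [dxi_mul hhh hij.1, dxi_mul hh hh] at e1
  rw [dxi_mul hhh hii.1, dxi_mul hh hh] at e2
  have e3 : dxi i (dxi i (dxi j φ)) = dxi j (dxi i (dxi i φ)) := by
    rw [dxi_comm hφ.1 i j, dxi_comm (hφ.dxi i).1 i j]
  rw [e3] at e1
  have i1 : Integrable (fun x : E3 => (2 * dxi j h (t, x) * (h (t, x) * dxi i (dxi i φ) (t, x))) * dxi j φ (t, x)) :=
    (((hφ.dxi j).mul (Sm_mul (Sm_smul (Sm_dxi hh j) 2) (Sm_mul hh hii.1))).cc ht).int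
  have i2 : Integrable (fun x : E3 => (2 * dxi i h (t, x) * (h (t, x) * dxi i (dxi j φ) (t, x))) * dxi j φ (t, x)) :=
    (((hφ.dxi j).mul (Sm_mul (Sm_smul (Sm_dxi hh i) 2) (Sm_mul hh hij.1))).cc ht).int
  have i3 : Integrable (fun x : E3 => (h (t, x) * h (t, x) * dxi j (dxi i (dxi i φ)) (t, x)) * dxi j φ (t, x)) :=
    (((hφ.dxi j).mul (Sm_mul hhh (hii.dxi j).1)).cc ht).int
  have f1 : ∫ x : E3, (h (t, x) * dxi i (dxi j φ) (t, x)) ^ 2 =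
      -((∫ x : E3, (2 * dxi i h (t, x) * (h (t, x) * dxi i (dxi j φ) (t, x))) * dxi j φ (t, x))
      + ∫ x : E3, (h (t, x) * h (t, x) * dxi j (dxi i (dxi i φ)) (t, x)) * dxi j φ (t, x)) := by
    rw [← integral_add i2 i3]
    convert e1 using 3
    · ring
    · funext x; ring
  have f2 : ∫ x : E3, (h (t, x) * dxi i (dxi i φ) (t, x)) * (h (t, x) * dxi j (dxi j φ) (t, x)) =
      -((∫ x : E3, (2 * dxi j h (t, x) * (h (t, x) * dxi i (dxi i φ) (t, x))) * dxi j φ (t, x))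
      + ∫ x : E3, (h (t, x) * h (t, x) * dxi j (dxi i (dxi i φ)) (t, x)) * dxi j φ (t, x)) := by
    rw [← integral_add i1 i3]
    convert e2 using 3
    · ring
    · funext x; ring
  rw [f1, f2]; ring

lemma ell {M t : ℝ} (ht : 0 < t) {h φ : Pt → ℝ} (hh : Sm h) (hφ : Good M φ) {L R X : ℝ} (hL : 0 ≤ L)
    (hR : 0 ≤ R) (hX : 0 ≤ X)
    (hb : ∀ i, ∀ x : E3, ‖x‖ ≤ t + M → |dxi i h (t, x)| ≤ L) (hg : ∀ i, nm t (dxi i φ) ≤ R)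
    (hD : nm t (fun p => h p * ∑ i, dxi i (dxi i φ) p) ≤ X) (i j : Fin 3) :
    nm t (fun p => h p * dxi i (dxi j φ) p) ≤ (2 + 36 * L) * (X + R) := by
  set F : Fin 3 → Fin 3 → Pt → ℝ := fun i j p => h p * dxi i (dxi j φ) p with hF
  have gF : ∀ i j, Good M (F i j) := fun i j => ((hφ.dxi j).dxi i).mul hh
  set T := Real.sqrt (∑ i, ∑ j, nm t (F i j) ^ 2) with hT
  have hT2 : T ^ 2 = ∑ i, ∑ j, nm t (F i j) ^ 2 := Real.sq_sqrt (by positivity)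
  have hT0 : 0 ≤ T := Real.sqrt_nonneg _
  have hle : ∀ i j, nm t (F i j) ≤ T := by
    intro i j
    apply Real.le_sqrt_of_sq_le
    calc nm t (F i j) ^ 2 ≤ ∑ j, nm t (F i j) ^ 2 :=
          Finset.single_le_sum (f := fun j => nm t (F i j) ^ 2) (fun _ _ => sq_nonneg _) (Finset.mem_univ j)
      _ ≤ _ := Finset.single_le_sum (f := fun i => ∑ j, nm t (F i j) ^ 2) (fun _ _ => by positivity) (Finset.mem_univ i)
  have err : ∀ (k : Fin 3) (i j m : Fin 3),
      |∫ x : E3, (2 * dxi k h (t, x) * F i j (t, x)) * dxi m φ (t, x)| ≤ 2 * L * T * R := by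
    intro k i j m
    have g1 : Good M (fun p => (2 * dxi k h p) * F i j p) := (gF i j).mul (Sm_smul (Sm_dxi hh k) 2)
    have h1 := nm_cs ht g1 (hφ.dxi m)
    have h2 : nm t (fun p => (2 * dxi k h p) * F i j p) ≤ (2 * L) * nm t (F i j) := by
      apply nm_one ht (by positivity) (gF i j) g1
      intro x hx
      have := hb k x hx
      rw [abs_mul, abs_mul, abs_two]
      gcongr
    calc _ ≤ _ := h1
      _ ≤ (2 * L * T) * R := by
        apply mul_le_mul (h2.trans _) (hg m) (nm_nonneg _ _) (by positivity)
        gcongr; exact hle i j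
  have main : T ^ 2 ≤ X ^ 2 + 36 * L * R * T := by
    have hs : ∑ i, ∑ j, ∫ x : E3, F i i (t, x) * F j j (t, x) ≤ X ^ 2 := by
      have : ∑ i, ∑ j, ∫ x : E3, F i i (t, x) * F j j (t, x) = nm t (fun p => h p * ∑ i, dxi i (dxi i φ) p) ^ 2 := by
        rw [nm_sq]
        have hi : ∀ i j, Integrable (fun x : E3 => F i i (t, x) * F j j (t, x)) := fun i j =>
          (((gF i i).mulr (gF j j).1).cc ht).int
        rw [Finset.sum_congr rfl fun i _ => (integral_finsetSum Finset.univ fun j _ => hi i j).symm]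
        rw [← integral_finsetSum _ fun i _ => integrable_finsetSum _ fun j _ => hi i j]
        congr 1; funext x
        rw [Finset.mul_sum, pow_two, Finset.sum_mul_sum]
      rw [this]
      exact pow_le_pow_left₀ (nm_nonneg _ _) hD 2
    have hp : ∀ i j, nm t (F i j) ^ 2 ≤ (∫ x : E3, F i i (t, x) * F j j (t, x)) + 4 * L * T * R := by
      intro i j
      rw [nm_sq]
      have := ell_pair ht hh hφ i j
      simp only [hF] at this ⊢
      rw [this]
      have a1 := abs_le.1 (err j i i j)
      have a2 := abs_le.1 (err i i j j)
      simp only [hF] at a1 a2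
      linarith [a1.2, a2.1]
    rw [hT2]
    calc _ ≤ ∑ i : Fin 3, ∑ j : Fin 3, ((∫ x : E3, F i i (t, x) * F j j (t, x)) + 4 * L * T * R) :=
          Finset.sum_le_sum fun i _ => Finset.sum_le_sum fun j _ => hp i j
      _ = (∑ i, ∑ j, ∫ x : E3, F i i (t, x) * F j j (t, x)) + 36 * L * R * T := by
          simp only [Finset.sum_add_distrib, Finset.sum_const, Finset.card_univ, Fintype.card_fin, nsmul_eq_mul]
          push_cast; ring
      _ ≤ _ := by linarith
  have q := (quad_lem (a := 1) (b := 36 * L) (R := X + R) (X := 0) (Y := T) zero_le_one (by positivity)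
    (by positivity) le_rfl hT0 (by
      have : 36 * L * R * T ≤ 36 * L * (X + R) * T := by gcongr; linarith
      nlinarith [mul_nonneg hX hR, sq_nonneg R])).2
  calc _ ≤ T := hle i j
    _ ≤ _ := q.trans (by apply le_of_eq; ring)


lemma Wf_dxi_le {M t : ℝ} (hM : 0 < M) (ht : 1 ≤ t) (i : Fin 3) (x : E3) (hx : ‖x‖ ≤ t + M) :
    |dxi i (Wf t) (t, x)| ≤ 2 * (1 + M) := by
  rw [dxi_Wf, abs_div, abs_mul, abs_of_pos (show 0 < 1 + t by linarith), div_le_iff₀ (by linarith)]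
  have := (abs_le_norm x i).trans hx
  norm_num
  nlinarith

lemma box_Gop (μ lam : ℝ) (φ : Pt → ℝ) (p : Pt) : box φ p = Gop μ lam φ p - (μ * tw (-lam) p) * dt φ p := by
  simp [Gop]

lemma lin1 (μ lam M : ℝ) (hμ : 0 < μ) (hM : 0 < M) : ∃ C : ℝ, 0 ≤ C ∧ ∀ φ, Good M φ → ∀ t R : ℝ, 1 ≤ t → 0 ≤ R →
    (∀ (c : List (Fin 8)) α, c.length ≤ 1 → nm t (Dop α (GamWord c φ)) ≤ R) →
    t * nm t (Gop μ lam φ) ≤ R →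
    nm t (fun p => Wf t p * (∑ i, dxi i (dxi i φ) p)
      + (-(t ^ 2 / (1 + t) * (μ * (1 + t) ^ (-lam)))) * dt φ p) ≤ C * R ∧
    ∀ i, nm t (fun p => Wf t p * dxi i (dt φ) p) ≤ C * (R + (t ^ 2 / (1 + t) * (μ * (1 + t) ^ (-lam))) * nm t (dt φ)) := by
  obtain ⟨C, hC, hKS⟩ := KS M hM
  set n : ℝ := ((WD 1 ×ˢ (Finset.univ : Finset (Fin 4))).card : ℝ) with hn
  have hn0 : 0 ≤ n := Nat.cast_nonneg _
  refine ⟨C * n + 1 + M, by positivity, fun φ hφ t R ht hR h1 h2 => ?_⟩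
  have ht0 : 0 < t := by linarith
  have hu : 0 < 1 + t := by linarith
  set β := t ^ 2 / (1 + t) * (μ * (1 + t) ^ (-lam)) with hβ
  have hβ0 : 0 ≤ β := by positivity
  have hT0 : t ^ 2 / (1 + t) ≤ t := by rw [div_le_iff₀ hu]; nlinarith
  have hT00 : 0 ≤ t ^ 2 / (1 + t) := by positivity
  have hG : Good M (Gop μ lam φ) := by
    refine ⟨Sm_Gop μ lam hφ.1, fun p hp hx => ?_⟩
    have e1 := (hφ.dt).2 p hp hx
    have e2 := (hφ.dt.dt).2 p hp hx
    have e3 : ∀ i, dxi i (dxi i φ) p = 0 := fun i => ((hφ.dxi i).dxi i).2 p hp hx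
    have e3' : ∀ i, dxi i (fun q => dxi i φ q) p = 0 := e3
    have e2' : dt (fun q => dt φ q) p = 0 := e2
    simp [Gop, box, e1, e2', e3']
  have hR2 : (t ^ 2 / (1 + t)) * nm t (Gop μ lam φ) ≤ R := le_trans (by gcongr; exact nm_nonneg _ _) h2
  let s := WD 1 ×ˢ (Finset.univ : Finset (Fin 4))
  have hbox : ∀ x : E3, box φ (t, x) = Gop μ lam φ (t, x) - (μ * (1 + t) ^ (-lam)) * dt φ (t, x) := by
    intro x; rw [box_Gop μ lam, tw_eq _ (by simpa using ht0.le)]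
  have hZ : ∀ x : E3, ‖x‖ ≤ t + M → ∀ Z, Z = ∑ q ∈ s, |Dop q.2 (GamWord q.1 φ) (t, x)| →
      |Wf t (t, x) * (∑ i, dxi i (dxi i φ) (t, x)) + t ^ 2 / (1 + t) * box φ (t, x)| ≤ C * Z ∧
      ∀ i, |Wf t (t, x) * dxi i (dt φ) (t, x) - t * x i / (1 + t) * box φ (t, x)| ≤ C * Z := by
    intro x hx Z hZ
    have := hKS φ hφ.1 (t, x) ht hx Z (fun c α hc => by
      rw [hZ]
      exact Finset.single_le_sum (f := fun q : List (Fin 8) × Fin 4 => |Dop q.2 (GamWord q.1 φ) (t, x)|)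
        (fun _ _ => abs_nonneg _) (show (c, α) ∈ s by simp [s, mem_WD, hc]))
    simpa only [Wf_eq] using this
  have hsum : ∑ q ∈ s, C * nm t (Dop q.2 (GamWord q.1 φ)) ≤ C * n * R := by
    calc _ ≤ ∑ q ∈ s, C * R := Finset.sum_le_sum fun q hq => by
          have : q.1.length ≤ 1 := by simpa [s, mem_WD] using hq
          have := h1 q.1 q.2 this
          gcongr
      _ = C * n * R := by rw [Finset.sum_const, nsmul_eq_mul]; ring
  have hΔ : Good M (fun p => ∑ i, dxi i (dxi i φ) p) := Good.sum _ fun i => (hφ.dxi i).dxi i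
  -- combine
  have gen : ∀ (F : Pt → ℝ) (k v : ℝ), Good M F → 0 ≤ k → 0 ≤ v →
      (∀ x : E3, ‖x‖ ≤ t + M → |F (t, x)| ≤ C * (∑ q ∈ s, |Dop q.2 (GamWord q.1 φ) (t, x)|) +
        k * |Gop μ lam φ (t, x)| + v * |dt φ (t, x)|) →
      nm t F ≤ C * n * R + k * nm t (Gop μ lam φ) + v * nm t (dt φ) := by
    intro F k v hF hk hv H
    have := nm_sum ht0 (s.disjSum (Finset.univ : Finset (Fin 2)))
      (Sum.elim (fun _ => C) ![k, v]) (by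
        intro i _; rcases i with i | i
        · exact hC
        · fin_cases i <;> simpa)
      (Sum.elim (fun q => Dop q.2 (GamWord q.1 φ)) ![Gop μ lam φ, dt φ]) (by
        intro i _; rcases i with i | i
        · exact (hφ.gw _).dop _
        · fin_cases i
          · exact hG
          · exact hφ.dt) hF (by
        intro x hx
        rw [Finset.sum_disjSum]
        simpa [Finset.mul_sum, add_assoc] using H x hx)
    rw [Finset.sum_disjSum] at this
    simp at this
    linarith
  constructor
  · have := gen (fun p => Wf t p * (∑ i, dxi i (dxi i φ) p) + (-β) * dt φ p) (t ^ 2 / (1 + t)) 0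
      ((hΔ.mul (Sm_Wf t)).add (hφ.dt.smul _)) hT00 le_rfl (by
      intro x hx
      have h := (hZ x hx _ rfl).1
      rw [hbox] at h
      have e : Wf t (t, x) * (∑ i, dxi i (dxi i φ) (t, x)) + (-β) * dt φ (t, x) =
        (Wf t (t, x) * (∑ i, dxi i (dxi i φ) (t, x)) + t ^ 2 / (1 + t) * (Gop μ lam φ (t, x) - μ * (1 + t) ^ (-lam) * dt φ (t, x)))
          - t ^ 2 / (1 + t) * Gop μ lam φ (t, x) := by rw [hβ]; ring
      rw [e]
      refine (abs_sub _ _).trans ?_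
      rw [abs_mul (t ^ 2 / (1 + t)), abs_of_nonneg hT00]
      linarith)
    nlinarith
  · intro i
    have := gen (fun p => Wf t p * dxi i (dt φ) p) ((1 + M) * (t ^ 2 / (1 + t))) ((1 + M) * β)
      ((hφ.dt.dxi i).mul (Sm_Wf t)) (by positivity) (by positivity) (by
      intro x hx
      have h := (hZ x hx _ rfl).2 i
      have hb := hbox x
      have hx' : |t * x i / (1 + t)| ≤ (1 + M) * (t ^ 2 / (1 + t)) := by
        rw [abs_div, abs_mul, abs_of_pos ht0, abs_of_pos hu, mul_div_assoc', div_le_div_iff_of_pos_right hu]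
        have := (abs_le_norm x i).trans hx
        have h3 : |x i| ≤ (1 + M) * t := by nlinarith
        nlinarith [mul_le_mul_of_nonneg_left h3 ht0.le]
      have hbb : |box φ (t, x)| ≤ |Gop μ lam φ (t, x)| + μ * (1 + t) ^ (-lam) * |dt φ (t, x)| := by
        rw [hb]; refine (abs_sub _ _).trans ?_
        rw [abs_mul (μ * (1 + t) ^ (-lam)), abs_of_nonneg (by positivity : 0 ≤ μ * (1 + t) ^ (-lam))]
      have e : Wf t (t, x) * dxi i (dt φ) (t, x) = (Wf t (t, x) * dxi i (dt φ) (t, x) - t * x i / (1 + t) * box φ (t, x))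
        + t * x i / (1 + t) * box φ (t, x) := by ring
      rw [e]
      refine (abs_add_le _ _).trans ?_
      rw [abs_mul (t * x i / (1 + t))]
      have := mul_le_mul hx' hbb (abs_nonneg _) (by positivity)
      have e2 : (1 + M) * (t ^ 2 / (1 + t)) * (|Gop μ lam φ (t, x)| + μ * (1 + t) ^ (-lam) * |dt φ (t, x)|)
        = (1 + M) * (t ^ 2 / (1 + t)) * |Gop μ lam φ (t, x)| + (1 + M) * β * |dt φ (t, x)| := by rw [hβ]; ring
      linarith)
    have hY : 0 ≤ β * nm t (dt φ) := mul_nonneg hβ0 (nm_nonneg _ _)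
    have h5 : (1 + M) * ((t ^ 2 / (1 + t)) * nm t (Gop μ lam φ)) ≤ (1 + M) * R := by gcongr
    have h6 : 0 ≤ C * n * (β * nm t (dt φ)) := by positivity
    nlinarith


lemma lin (μ lam M : ℝ) (hμ : 0 < μ) (hM : 0 < M) : ∃ C : ℝ, 0 ≤ C ∧ ∀ φ, Good M φ → ∀ t R : ℝ, 1 ≤ t → 0 ≤ R →
    (∀ (c : List (Fin 8)) α, c.length ≤ 1 → nm t (Dop α (GamWord c φ)) ≤ R) →
    (∀ i, (1 + t) ^ (1 - lam) * nm t (dxi i φ) ≤ R) →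
    t * nm t (Gop μ lam φ) ≤ R →
    (∀ q, nm t (fun p => Wf t p * D2 q φ p) ≤ C * R) ∧ (t * (1 + t) ^ (-lam)) * nm t (dt φ) ≤ C * R := by
  obtain ⟨K, hK, hl⟩ := lin1 μ lam M hμ hM
  obtain ⟨a, ha⟩ : ∃ a, a = K ^ 2 + 6 * μ * (2 * (1 + M) + K) := ⟨_, rfl⟩
  obtain ⟨b, hb⟩ : ∃ b, b = 6 * μ * K := ⟨_, rfl⟩
  have ha0 : 0 ≤ a := by rw [ha]; positivity
  have hb0 : 0 ≤ b := by rw [hb]; positivity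
  obtain ⟨K3, hK3⟩ : ∃ K3, K3 = 1 + a + b := ⟨_, rfl⟩
  have hK30 : 0 ≤ K3 := by rw [hK3]; positivity
  refine ⟨(2 + 36 * (2 * (1 + M))) * (K3 + 1) + K * (1 + K3) + 2 * K3 / μ, by positivity, fun φ hφ t R ht hR h1 h2 h3 => ?_⟩
  obtain ⟨l1, l2⟩ := hl φ hφ t R ht hR h1 h3
  have ht0 : 0 < t := by linarith
  have hu : 0 < 1 + t := by linarith
  set β := t ^ 2 / (1 + t) * (μ * (1 + t) ^ (-lam)) with hβ
  have hβ0 : 0 ≤ β := by positivity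
  set Y := β * nm t (dt φ) with hY
  have hY0 : 0 ≤ Y := mul_nonneg hβ0 (nm_nonneg _ _)
  have hΔ : Good M (fun p => ∑ i, dxi i (dxi i φ) p) := Good.sum _ fun i => (hφ.dxi i).dxi i
  have hWΔ : Good M (fun p => Wf t p * ∑ i, dxi i (dxi i φ) p) := hΔ.mul (Sm_Wf t)
  set X := nm t (fun p => Wf t p * ∑ i, dxi i (dxi i φ) p) with hX
  have hX0 : 0 ≤ X := nm_nonneg _ _
  have hβi : ∀ i, β * nm t (dxi i φ) ≤ μ * R := by
    intro i
    have : β ≤ μ * (1 + t) ^ (1 - lam) := by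
      have e : (1 + t) ^ (1 - lam) = (1 + t) * (1 + t) ^ (-lam) := by
        rw [sub_eq_add_neg, Real.rpow_add hu, Real.rpow_one]
      have : t ^ 2 / (1 + t) ≤ 1 + t := by rw [div_le_iff₀ hu]; nlinarith
      have hp : 0 ≤ μ * (1 + t) ^ (-lam) := by positivity
      rw [e, hβ]; nlinarith
    calc _ ≤ (μ * (1 + t) ^ (1 - lam)) * nm t (dxi i φ) := by gcongr; exact nm_nonneg _ _
      _ = μ * ((1 + t) ^ (1 - lam) * nm t (dxi i φ)) := by ring
      _ ≤ _ := by gcongr; exact h2 i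
  have hdt : nm t (dt φ) ≤ R := h1 [] 0 (by simp)
  have hdx : ∀ i, nm t (dxi i φ) ≤ R := fun i => by
    have := h1 [] i.succ (by simp)
    rwa [Dop_succ] at this
  have cross : |β * ∫ x : E3, (Wf t (t, x) * dt φ (t, x)) * ∑ i, dxi i (dxi i φ) (t, x)|
      ≤ 3 * μ * R * (2 * (1 + M) * R + K * (R + Y)) := by
    have gW : Good M (fun p => Wf t p * dt φ p) := hφ.dt.mul (Sm_Wf t)
    have e1 : ∫ x : E3, (Wf t (t, x) * dt φ (t, x)) * ∑ i, dxi i (dxi i φ) (t, x)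
        = ∑ i, - ∫ x : E3, dxi i (fun p => Wf t p * dt φ p) (t, x) * dxi i φ (t, x) := by
      simp only [Finset.mul_sum]
      rw [integral_finsetSum _ fun i _ => (((((hφ.dxi i).dxi i).mul gW.1).cc ht0).int)]
      exact Finset.sum_congr rfl fun i _ => ibp (hφ.dxi i) gW.1 ht0 i
    rw [e1, Finset.mul_sum]
    refine (Finset.abs_sum_le_sum_abs _ _).trans ?_
    have each : ∀ i, |β * - ∫ x : E3, dxi i (fun p => Wf t p * dt φ p) (t, x) * dxi i φ (t, x)|
        ≤ μ * R * (2 * (1 + M) * R + K * (R + Y)) := by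
      intro i
      rw [abs_mul, abs_neg, abs_of_nonneg hβ0]
      have g1 : Good M (dxi i (fun p => Wf t p * dt φ p)) := gW.dxi i
      have c1 := nm_cs ht0 g1 (hφ.dxi i)
      have n1 : nm t (dxi i (fun p => Wf t p * dt φ p)) ≤ (2 * (1 + M)) * nm t (dt φ) +
          1 * nm t (fun p => Wf t p * dxi i (dt φ) p) := by
        apply nm_two ht0 (by positivity) zero_le_one hφ.dt ((hφ.dt.dxi i).mul (Sm_Wf t)) g1
        intro x hx
        rw [dxi_mul (Sm_Wf t) hφ.dt.1]
        refine (abs_add_le _ _).trans ?_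
        rw [abs_mul (dxi i (Wf t) (t, x)), one_mul]
        have := Wf_dxi_le hM ht i x hx
        gcongr
      have n2 := l2 i
      have n3 : nm t (dxi i (fun p => Wf t p * dt φ p)) ≤ 2 * (1 + M) * R + K * (R + Y) := by
        refine n1.trans ?_
        rw [one_mul]; gcongr
      calc _ ≤ β * (nm t (dxi i (fun p => Wf t p * dt φ p)) * nm t (dxi i φ)) := by gcongr
        _ = (β * nm t (dxi i φ)) * nm t (dxi i (fun p => Wf t p * dt φ p)) := by ring
        _ ≤ _ := mul_le_mul (hβi i) n3 (nm_nonneg _ _) (by positivity)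
    calc _ ≤ ∑ i : Fin 3, μ * R * (2 * (1 + M) * R + K * (R + Y)) := Finset.sum_le_sum fun i _ => each i
      _ = _ := by simp; ring
  have expand : X ^ 2 + Y ^ 2 = nm t (fun p => Wf t p * (∑ i, dxi i (dxi i φ) p) + (-β) * dt φ p) ^ 2
      + 2 * (β * ∫ x : E3, (Wf t (t, x) * dt φ (t, x)) * ∑ i, dxi i (dxi i φ) (t, x)) := by
    rw [hX, hY, mul_pow, nm_sq, nm_sq, nm_sq, ← integral_const_mul, ← mul_assoc, ← integral_const_mul]
    have i1 : Integrable (fun x : E3 => (Wf t (t, x) * ∑ i, dxi i (dxi i φ) (t, x)) ^ 2) := (hWΔ.cc ht0).sqint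
    have i2 : Integrable (fun x : E3 => β ^ 2 * dt φ (t, x) ^ 2) := ((hφ.dt.cc ht0).sqint).const_mul _
    have i3 : Integrable (fun x : E3 => (Wf t (t, x) * (∑ i, dxi i (dxi i φ) (t, x)) + (-β) * dt φ (t, x)) ^ 2) :=
      ((hWΔ.add (hφ.dt.smul (-β))).cc ht0).sqint
    have i4 : Integrable (fun x : E3 => 2 * β * ((Wf t (t, x) * dt φ (t, x)) * ∑ i, dxi i (dxi i φ) (t, x))) :=
      (((hΔ.mul (hφ.dt.mul (Sm_Wf t)).1).cc ht0).int).const_mul _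
    rw [← integral_add i1 i2, ← integral_add i3 i4]
    congr 1; funext x; ring
  have main : X ^ 2 + Y ^ 2 ≤ a * R ^ 2 + b * R * Y := by
    rw [expand]
    have := pow_le_pow_left₀ (nm_nonneg _ _) l1 2
    have c2 := (abs_le.1 cross).2
    rw [ha, hb]
    nlinarith
  obtain ⟨qX, qY⟩ := quad_lem ha0 hb0 hR hX0 hY0 main
  rw [← hK3] at qX qY
  have hL : 0 ≤ 2 * (1 + M) := by positivity
  have hpos1 : 0 ≤ K * (1 + K3) * R := by positivity
  have hpos2 : 0 ≤ 2 * K3 / μ * R := by positivity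
  have hpos3 : 0 ≤ (2 + 36 * (2 * (1 + M))) * (K3 + 1) * R := by positivity
  constructor
  · rintro ⟨i, α⟩
    refine Fin.cases ?_ (fun j => ?_) α
    · have := l2 i
      have e : (fun p => Wf t p * D2 (i, 0) φ p) = (fun p => Wf t p * dxi i (dt φ) p) := by
        funext p; rfl
      rw [e]
      have h7 : K * (R + Y) ≤ K * (R + K3 * R) := by gcongr
      linarith
    · have e : (fun p => Wf t p * D2 (i, j.succ) φ p) = (fun p => Wf t p * dxi i (dxi j φ) p) := by
        funext p; simp only [D2, Dop_succ]
      rw [e]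
      have := ell ht0 (Sm_Wf t) hφ hL hR (by positivity : 0 ≤ K3 * R) (fun i x hx => Wf_dxi_le hM ht i x hx) hdx qX i j
      linarith
  · have e : (t * (1 + t) ^ (-lam)) * nm t (dt φ) ≤ 2 / μ * Y := by
      rw [hY, hβ]
      have : t ≤ 2 * (t ^ 2 / (1 + t)) := by
        rw [mul_div_assoc', le_div_iff₀ hu]; nlinarith
      have hp : 0 ≤ (1 + t) ^ (-lam) * nm t (dt φ) := mul_nonneg (by positivity) (nm_nonneg _ _)
      have := mul_le_mul_of_nonneg_right this hp
      calc _ = t * ((1 + t) ^ (-lam) * nm t (dt φ)) := by ring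
        _ ≤ _ := this
        _ = _ := by field_simp
    have : 2 / μ * Y ≤ 2 / μ * (K3 * R) := by gcongr
    have e3 : 2 / μ * (K3 * R) = 2 * K3 / μ * R := by ring
    linarith


lemma nm_tr {ι : Type*} {M t : ℝ} (ht : 0 < t) (s : Finset ι) (g : ι → Pt → ℝ) (hg : ∀ i ∈ s, Good M (g i))
    {f : Pt → ℝ} (hf : Good M f) {C : ℝ} (hC : 0 ≤ C)
    (h : ∀ x : E3, ‖x‖ ≤ t + M → ∀ B, (∀ i ∈ s, |g i (t, x)| ≤ B) → |f (t, x)| ≤ C * B)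
    {B' : ℝ} (hB : ∀ i ∈ s, nm t (g i) ≤ B') : nm t f ≤ C * s.card * B' := by
  have h1 := nm_sum ht s (fun _ => C) (fun _ _ => hC) g hg hf (fun x hx => by
    rw [← Finset.mul_sum]
    exact h x hx _ fun i hi => Finset.single_le_sum (f := fun i => |g i (t, x)|) (fun _ _ => abs_nonneg _) hi)
  refine h1.trans ?_
  calc _ ≤ ∑ i ∈ s, C * B' := Finset.sum_le_sum fun i hi => by
        have := hB i hi
        gcongr
    _ = _ := by rw [Finset.sum_const, nsmul_eq_mul]; ring

lemma nm_leib (n : ℕ) : ∃ C : ℝ, 0 ≤ C ∧ ∀ (M t : ℝ) (f g : Pt → ℝ), 0 < t → Sm f → Good M g →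
    ∀ a : List (Fin 8), a.length ≤ n → ∀ B,
    (∀ a1 a2 : List (Fin 8), a1.length + a2.length ≤ a.length → a1 ⊆ a → a2 ⊆ a →
      nm t (fun p => GamWord a1 f p * GamWord a2 g p) ≤ B) →
    nm t (GamWord a (fun p => f p * g p)) ≤ C * B := by
  classical
  obtain ⟨T, hT⟩ : ∃ T : Finset (List (Fin 8)), ∀ c, c ∈ T ↔ c.length ≤ n := ⟨WD n, fun _ => mem_WD⟩
  refine ⟨2 ^ n * (T ×ˢ T).card, by positivity, fun M t f g ht hf hg a ha B hB => ?_⟩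
  have hB0 : 0 ≤ B := (nm_nonneg _ _).trans (hB [] [] (by simp) (by simp) (by simp))
  set s := (T ×ˢ T).filter (fun q => q.1.length + q.2.length ≤ a.length ∧ q.1 ⊆ a ∧ q.2 ⊆ a) with hs
  have := nm_tr (M := M) ht s (fun q p => GamWord q.1 f p * GamWord q.2 g p)
    (fun q _ => (hg.gw _).mul (Sm_GamWord hf _)) ((hg.mul hf).gw a) (C := 2 ^ n) (by positivity)
    (fun x hx B h => by
      have hB0 : 0 ≤ B := (abs_nonneg _).trans (h ([], []) (by simp [hs, hT]))
      refine (leib a f g hf hg.1 (t, x) B fun a1 a2 h1 h2 h3 => ?_).trans ?_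
      · exact h (a1, a2) (by simp [hs, hT, h1, h2, h3]; omega)
      · gcongr; norm_num)
    (B' := B) (fun q hq => by
      simp only [hs, Finset.mem_filter] at hq
      exact hB q.1 q.2 hq.2.1 hq.2.2.1 hq.2.2.2)
  refine this.trans ?_
  have : (s.card : ℝ) ≤ (T ×ˢ T).card := by exact_mod_cast Finset.card_filter_le _ _
  gcongr

lemma nm_comm {ι : Type*} [Fintype ι] {D : ι → (Pt → ℝ) → Pt → ℝ} (hD : CommP D)
    (hgood : ∀ M f i, Good M f → Good M (D i f)) (n : ℕ) :
    ∃ C : ℝ, 0 ≤ C ∧ ∀ (M t : ℝ) (m f : Pt → ℝ), 0 < t → Sm m → Good M f → ∀ B,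
    (∀ (c : List (Fin 8)) j, c.length ≤ n → nm t (fun p => m p * D j (GamWord c f) p) ≤ B) →
    ∀ (a : List (Fin 8)) i, a.length ≤ n → nm t (fun p => m p * GamWord a (D i f) p) ≤ C * B := by
  obtain ⟨C, hC, h⟩ := hD n
  obtain ⟨T, hT⟩ : ∃ T : Finset (List (Fin 8)), ∀ c, c ∈ T ↔ c.length ≤ n := ⟨WD n, fun _ => mem_WD⟩
  refine ⟨C * (T ×ˢ (Finset.univ : Finset ι)).card, by positivity, fun M t m f ht hm hf B hB a i ha => ?_⟩
  refine nm_tr (M := M) ht (T ×ˢ (Finset.univ : Finset ι)) (fun q p => m p * D q.2 (GamWord q.1 f) p)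
    (fun q _ => (hgood _ _ _ (hf.gw _)).mul hm) (((hgood _ _ _ hf).gw a).mul hm) hC ?_ ?_
  · intro x hx B h1
    have := h a ha (fun p => f p) hf.1 (t, x)
    rcases eq_or_ne (m (t, x)) 0 with h0 | h0
    · rw [h0, zero_mul, abs_zero]
      have := (abs_nonneg _).trans (h1 ([], i) (by simp [hT]))
      positivity
    · have h2 := h a ha f hf.1 (t, x) (B / |m (t, x)|) (fun c j hc => by
        rw [le_div_iff₀ (abs_pos.2 h0), mul_comm, ← abs_mul]
        exact h1 (c, j) (by simp [hT, hc])) i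
      rw [abs_mul]
      calc _ ≤ |m (t, x)| * (C * (B / |m (t, x)|)) := by gcongr
        _ = C * B := by field_simp
  · intro q hq
    simp only [Finset.mem_product, hT] at hq
    exact hB _ _ hq.1

/-- affine functions are preserved by spatial fields -/
def Aff (B : ℝ) (f : Pt → ℝ) : Prop := ∃ (a : Fin 3 → ℝ) (b : ℝ), (∀ k, |a k| ≤ B) ∧ |b| ≤ B ∧
  f = fun p : Pt => (∑ k, a k * p.2 k) + b

lemma dxi_aff (a : Fin 3 → ℝ) (b : ℝ) (i : Fin 3) (p : Pt) :
    dxi i (fun p : Pt => (∑ k, a k * p.2 k) + b) p = a i := by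
  unfold dxi
  have h0 : ∀ k : Fin 3, HasFDerivAt (fun p : Pt => p.2 k)
      ((EuclideanSpace.proj k : E3 →L[ℝ] ℝ).comp (ContinuousLinearMap.snd ℝ ℝ E3)) p := fun k =>
    ((EuclideanSpace.proj k : E3 →L[ℝ] ℝ).comp (ContinuousLinearMap.snd ℝ ℝ E3)).hasFDerivAt
  have h1 := ((HasFDerivAt.fun_sum (u := Finset.univ) (fun k _ => (h0 k).const_mul (a k))).add_const b)
  rw [h1.fderiv]
  simp

lemma Aff.gam {B : ℝ} {f : Pt → ℝ} (h : Aff B f) (k : Fin 8) (hk : k ∈ spl) : Aff B (Gam k f) := by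
  obtain ⟨a, b, ha, hb, rfl⟩ := h
  have hB : 0 ≤ B := (abs_nonneg _).trans hb
  simp only [spl, List.mem_cons, List.not_mem_nil, or_false] at hk
  have key : ∀ (c : Fin 3 → ℝ) (d : ℝ), (∀ k, |c k| ≤ B) → |d| ≤ B →
      (∀ p, Gam k (fun p : Pt => (∑ k, a k * p.2 k) + b) p = (∑ k, c k * p.2 k) + d) →
      Aff B (Gam k (fun p : Pt => (∑ k, a k * p.2 k) + b)) :=
    fun c d h1 h2 h3 => ⟨c, d, h1, h2, funext h3⟩
  rcases hk with rfl | rfl | rfl | rfl | rfl | rfl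
  · exact key 0 (a 0) (by simp [hB]) (ha 0) (fun p => by simp [Gam, dxi_aff])
  · exact key 0 (a 1) (by simp [hB]) (ha 1) (fun p => by simp [Gam, dxi_aff])
  · exact key 0 (a 2) (by simp [hB]) (ha 2) (fun p => by simp [Gam, dxi_aff])
  · exact key ![0, a 2, - a 1] 0 (by intro k; fin_cases k <;> simp [hB, ha]) (by simpa) (fun p => by
      simp only [Gam]; simp [dxi_aff]; simp [Fin.sum_univ_three]; ring)
  · exact key ![-a 2, 0, a 0] 0 (by intro k; fin_cases k <;> simp [hB, ha]) (by simpa) (fun p => by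
      simp only [Gam]; simp [dxi_aff]; simp [Fin.sum_univ_three]; ring)
  · exact key ![a 1, - a 0, 0] 0 (by intro k; fin_cases k <;> simp [hB, ha]) (by simpa) (fun p => by
      simp only [Gam]; simp [dxi_aff]; simp [Fin.sum_univ_three]; ring)

lemma Aff_Wf {t : ℝ} (ht : 0 < t) (k : Fin 8) (hk : k ∈ spl) : Aff (2 / (1 + t)) (Gam k (Wf t)) := by
  have hB : 0 ≤ 2 / (1 + t) := by positivity
  have hu : 0 < 1 + t := by linarith
  simp only [spl, List.mem_cons, List.not_mem_nil, or_false] at hk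
  have key : ∀ (c : Fin 3 → ℝ), (∀ k, |c k| ≤ 2 / (1 + t)) →
      (∀ p, Gam k (Wf t) p = (∑ k, c k * p.2 k) + 0) → Aff (2 / (1 + t)) (Gam k (Wf t)) :=
    fun c h1 h3 => ⟨c, 0, h1, by simpa, funext h3⟩
  have e : |(-2 / (1 + t))| ≤ 2 / (1 + t) := by rw [abs_div, abs_of_pos hu]; simp
  rcases hk with rfl | rfl | rfl | rfl | rfl | rfl
  · exact key ![-2 / (1 + t), 0, 0] (by intro k; fin_cases k <;> simp [hB, e]) (fun p => by
      simp [Gam, dxi_Wf, Fin.sum_univ_three]; ring)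
  · exact key ![0, -2 / (1 + t), 0] (by intro k; fin_cases k <;> simp [hB, e]) (fun p => by
      simp [Gam, dxi_Wf, Fin.sum_univ_three]; ring)
  · exact key ![0, 0, -2 / (1 + t)] (by intro k; fin_cases k <;> simp [hB, e]) (fun p => by
      simp [Gam, dxi_Wf, Fin.sum_univ_three]; ring)
  · exact key 0 (by simp [hB]) (fun p => by simp [Gam, dxi_Wf]; ring)
  · exact key 0 (by simp [hB]) (fun p => by simp [Gam, dxi_Wf]; ring)
  · exact key 0 (by simp [hB]) (fun p => by simp [Gam, dxi_Wf]; ring)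

lemma Wf_words {M t : ℝ} (hM : 0 < M) (ht : 0 < t) (c : List (Fin 8)) (hc : c ⊆ spl) (hn : c ≠ [])
    (x : E3) (hx : ‖x‖ ≤ t + M) : |GamWord c (Wf t) (t, x)| ≤ 6 * (1 + M) := by
  have hA : Aff (2 / (1 + t)) (GamWord c (Wf t)) := by
    induction c with
    | nil => exact absurd rfl hn
    | cons k l ih =>
      have hk : k ∈ spl := hc (by simp)
      by_cases hl : l = []
      · subst hl; exact Aff_Wf ht k hk
      · exact (ih (fun y hy => hc (by simp [hy])) hl).gam k hk
  obtain ⟨a, b, ha, hb, h⟩ := hA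
  rw [h]
  have hu : 0 < 1 + t := by linarith
  have h1 : ∀ k, |a k * x k| ≤ 2 / (1 + t) * (t + M) := fun k => by
    rw [abs_mul]
    exact mul_le_mul (ha k) ((abs_le_norm x k).trans hx) (abs_nonneg _) (by positivity)
  calc |(∑ k, a k * x k) + b| ≤ (∑ k : Fin 3, 2 / (1 + t) * (t + M)) + 2 / (1 + t) :=
        (abs_add_le _ _).trans (add_le_add ((Finset.abs_sum_le_sum_abs _ _).trans (Finset.sum_le_sum fun k _ => h1 k)) hb)
    _ = 2 * (3 * (t + M) + 1) / (1 + t) := by simp; ring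
    _ ≤ _ := by rw [div_le_iff₀ hu]; nlinarith [mul_pos hM ht]

lemma t_le_Wf {t : ℝ} (ht : 1 ≤ t) (x : E3) : t ≤ 4 * |Wf t (t, x)| + 2 * (1 + ‖x‖) := by
  rw [Wf_eq]
  have hn := norm_nonneg x
  rcases le_or_gt (t / 2) ‖x‖ with h | h
  · have := abs_nonneg ((t ^ 2 - ‖x‖ ^ 2) / (1 + t)); linarith
  · have : t / 4 ≤ (t ^ 2 - ‖x‖ ^ 2) / (1 + t) := by
      rw [le_div_iff₀ (by linarith)]
      nlinarith
    have := this.trans (le_abs_self _)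
    linarith


lemma sup_word : ∃ S : ℝ, 0 ≤ S ∧ ∀ (M t : ℝ) (u : Pt → ℝ) (B : ℝ) (n : ℕ), 0 < t → Good M u →
    (∀ a : List (Fin 8), a.length ≤ n → nm t (GamWord a u) ≤ B) →
    ∀ a : List (Fin 8), a.length + 3 ≤ n → ∀ x : E3, (1 + ‖x‖) * |GamWord a u (t, x)| ≤ S * B := by
  obtain ⟨S, hS, h⟩ := sobolev
  refine ⟨S, hS, fun M t u B n ht hu hB a ha x => h M t _ B ht (hu.gw a) ((nm_nonneg _ _).trans (hB [] (by simp))) ?_ x⟩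
  intro c hc _
  have := hB (c ++ a) (by simp; omega)
  rwa [GamWord_append] at this

lemma prod_mix (N l : ℕ) (hN : 8 ≤ N) (hl : l ≤ N) : ∃ C : ℝ, 0 ≤ C ∧ ∀ (M t : ℝ) (u v : Pt → ℝ) (B B' : ℝ),
    0 < t → Good M u → Good M v → (∀ a : List (Fin 8), a.length ≤ N → nm t (GamWord a u) ≤ B) →
    (∀ a : List (Fin 8), a.length ≤ l → nm t (GamWord a v) ≤ B') →
    ∀ c : List (Fin 8), c.length ≤ l → nm t (GamWord c (fun p => u p * v p)) ≤ C * (B * B') := by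
  obtain ⟨S, hS, hsup⟩ := sup_word
  obtain ⟨L, hL, hleib⟩ := nm_leib l
  refine ⟨L * S, by positivity, fun M t u v B B' ht hu hv hB hB' c hc => ?_⟩
  have hB0 : 0 ≤ B := (nm_nonneg _ _).trans (hB [] (by simp))
  have hB0' : 0 ≤ B' := (nm_nonneg _ _).trans (hB' [] (by simp))
  have := hleib M t u v ht hu.1 hv c hc (S * (B * B')) (fun a1 a2 h12 _ _ => by
    rcases le_or_gt (a1.length + 3) N with h | h
    · have h1 : nm t (fun p => GamWord a1 u p * GamWord a2 v p) ≤ (S * B) * nm t (GamWord a2 v) := by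
        apply nm_one ht (by positivity) (hv.gw a2) ((hv.gw a2).mul (hu.gw a1).1)
        intro x _
        rw [abs_mul]
        have := hsup M t u B N ht hu hB a1 h x
        gcongr
        refine le_trans ?_ this
        nlinarith [norm_nonneg x, abs_nonneg (GamWord a1 u (t, x))]
      have h2 := hB' a2 (by omega)
      calc _ ≤ _ := h1
        _ ≤ (S * B) * B' := by gcongr
        _ = _ := by ring
    · have h1 : nm t (fun p => GamWord a1 u p * GamWord a2 v p) ≤ (S * B') * nm t (GamWord a1 u) := by
        apply nm_one ht (by positivity) (hu.gw a1) ((hv.gw a2).mul (hu.gw a1).1)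
        intro x _
        rw [abs_mul, mul_comm]
        have := hsup M t v B' l ht hv hB' a2 (by omega) x
        gcongr
        refine le_trans ?_ this
        nlinarith [norm_nonneg x, abs_nonneg (GamWord a2 v (t, x))]
      have h2 := hB a1 (by omega)
      calc _ ≤ _ := h1
        _ ≤ (S * B') * B := by gcongr
        _ = _ := by ring)
  calc _ ≤ _ := this
    _ = _ := by ring

lemma sup_W (M : ℝ) (hM : 0 < M) : ∃ S : ℝ, 0 ≤ S ∧ ∀ (t : ℝ) (v : Pt → ℝ) (B : ℝ) (n : ℕ), 0 < t → Good M v →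
    (∀ a : List (Fin 8), a.length ≤ n → nm t (GamWord a v) ≤ B) →
    (∀ a : List (Fin 8), a.length ≤ n → nm t (fun p => Wf t p * GamWord a v p) ≤ B) →
    ∀ a : List (Fin 8), a.length + 3 ≤ n → ∀ x : E3, |Wf t (t, x) * GamWord a v (t, x)| ≤ S * B := by
  obtain ⟨S, hS, h⟩ := sobolev
  obtain ⟨L, hL, hleib⟩ := nm_leib 3
  refine ⟨S * (L * (6 * (1 + M))), by positivity, fun t v B n ht hv hB hBW a ha x => ?_⟩
  have hB0 : 0 ≤ B := (nm_nonneg _ _).trans (hB [] (by simp))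
  have := h M t (fun p => Wf t p * GamWord a v p) (L * (6 * (1 + M) * B)) ht ((hv.gw a).mul (Sm_Wf t)) (by positivity) (by
    intro c hc hcs
    refine hleib M t (Wf t) (GamWord a v) ht (Sm_Wf t) (hv.gw a) c hc _ fun a1 a2 h12 h1 h2 => ?_
    rw [← GamWord_append]
    by_cases h0 : a1 = []
    · subst h0
      have := hBW (a2 ++ a) (by simp at h12 ⊢; omega)
      simp only [GamWord]
      nlinarith [mul_nonneg hM.le hB0]
    · have h3 : nm t (fun p => GamWord a1 (Wf t) p * GamWord (a2 ++ a) v p) ≤ (6 * (1 + M)) * nm t (GamWord (a2 ++ a) v) := by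
        apply nm_one ht (by positivity) (hv.gw _) ((hv.gw _).mul (Sm_GamWord (Sm_Wf t) a1))
        intro x hx
        rw [abs_mul]
        have := Wf_words hM ht a1 (fun y hy => hcs (h1 hy)) h0 x hx
        gcongr
      have := hB (a2 ++ a) (by simp; omega)
      exact h3.trans (by gcongr)) x
  have h5 := abs_nonneg (Wf t (t, x) * GamWord a v (t, x))
  have h6 := norm_nonneg x
  calc _ ≤ (1 + ‖x‖) * |Wf t (t, x) * GamWord a v (t, x)| := by nlinarith
    _ ≤ _ := this
    _ = _ := by ring

lemma typeI (N l : ℕ) (M : ℝ) (hM : 0 < M) (hN : 8 ≤ N) (hl : l ≤ N) : ∃ C : ℝ, 0 ≤ C ∧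
    ∀ (t : ℝ) (u v : Pt → ℝ) (B B' : ℝ),
    1 ≤ t → Good M u → Good M v → (∀ a : List (Fin 8), a.length ≤ N → nm t (GamWord a u) ≤ B) →
    (∀ a : List (Fin 8), a.length ≤ l → nm t (GamWord a v) ≤ B') →
    (∀ a : List (Fin 8), a.length ≤ l → nm t (fun p => Wf t p * GamWord a v p) ≤ B') →
    ∀ c : List (Fin 8), c.length ≤ l → t * nm t (GamWord c (fun p => u p * v p)) ≤ C * (B * B') := by
  obtain ⟨S, hS, hsup⟩ := sup_word
  obtain ⟨S', hS', hsupW⟩ := sup_W M hM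
  obtain ⟨L, hL, hleib⟩ := nm_leib l
  refine ⟨L * (6 * (S + S')), by positivity, fun t u v B B' ht1 hu hv hB hB' hBW c hc => ?_⟩
  have ht : 0 < t := by linarith
  have hB0 : 0 ≤ B := (nm_nonneg _ _).trans (hB [] (by simp))
  have hB0' : 0 ≤ B' := (nm_nonneg _ _).trans (hB' [] (by simp))
  have := hleib M t u v ht hu.1 hv c hc ((6 * (S + S')) * (B * B') / t) (fun a1 a2 h12 _ _ => by
    rw [le_div_iff₀ ht, mul_comm]
    have hg : Good M (fun p => GamWord a1 u p * GamWord a2 v p) := (hv.gw a2).mul (hu.gw a1).1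
    have e : t * nm t (fun p => GamWord a1 u p * GamWord a2 v p) = nm t (fun p => t * (GamWord a1 u p * GamWord a2 v p)) := by
      rw [nm_mulc (fun p => GamWord a1 u p * GamWord a2 v p) (fun p => t * (GamWord a1 u p * GamWord a2 v p)) t (fun x => rfl),
        abs_of_pos ht]
    rw [e]
    have pt : ∀ x : E3, |t * (GamWord a1 u (t, x) * GamWord a2 v (t, x))| ≤
        4 * (|GamWord a1 u (t, x)| * |Wf t (t, x) * GamWord a2 v (t, x)|)
        + 2 * ((1 + ‖x‖) * (|GamWord a1 u (t, x)| * |GamWord a2 v (t, x)|)) := by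
      intro x
      rw [abs_mul, abs_of_pos ht, abs_mul, abs_mul (Wf t (t, x))]
      have h1 := mul_le_mul_of_nonneg_right (t_le_Wf ht1 x)
        (mul_nonneg (abs_nonneg (GamWord a1 u (t, x))) (abs_nonneg (GamWord a2 v (t, x))))
      linarith
    rcases le_or_gt (a1.length + 3) N with h | h
    · have h1 : nm t (fun p => t * (GamWord a1 u p * GamWord a2 v p)) ≤
          (4 * (S * B)) * nm t (fun p => Wf t p * GamWord a2 v p) + (2 * (S * B)) * nm t (GamWord a2 v) := by
        apply nm_two ht (by positivity) (by positivity) ((hv.gw a2).mul (Sm_Wf t)) (hv.gw a2) (hg.smul t)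
        intro x _
        have h2 := hsup M t u B N ht hu hB a1 h x
        have h2' : |GamWord a1 u (t, x)| ≤ S * B := by
          refine le_trans ?_ h2
          nlinarith [norm_nonneg x, abs_nonneg (GamWord a1 u (t, x))]
        refine (pt x).trans ?_
        have h3 := mul_le_mul_of_nonneg_right h2' (abs_nonneg (Wf t (t, x) * GamWord a2 v (t, x)))
        have h4 := mul_le_mul_of_nonneg_right h2 (abs_nonneg (GamWord a2 v (t, x)))
        linarith
      have h2 := hB' a2 (by omega)
      have h3 := hBW a2 (by omega)
      calc _ ≤ _ := h1
        _ ≤ (4 * (S * B)) * B' + (2 * (S * B)) * B' := by gcongr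
        _ ≤ _ := by nlinarith [mul_nonneg hS' (mul_nonneg hB0 hB0')]
    · have h1 : nm t (fun p => t * (GamWord a1 u p * GamWord a2 v p)) ≤
          (4 * (S' * B') + 2 * (S * B')) * nm t (GamWord a1 u) := by
        apply nm_one ht (by positivity) (hu.gw a1) (hg.smul t)
        intro x _
        have h2 := hsup M t v B' l ht hv hB' a2 (by omega) x
        have h2' := hsupW t v B' l ht hv hB' hBW a2 (by omega) x
        refine (pt x).trans ?_
        have h3 := mul_le_mul_of_nonneg_right h2' (abs_nonneg (GamWord a1 u (t, x)))
        have h4 := mul_le_mul_of_nonneg_right h2 (abs_nonneg (GamWord a1 u (t, x)))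
        linarith
      have h2 := hB a1 (by omega)
      calc _ ≤ _ := h1
        _ ≤ (4 * (S' * B') + 2 * (S * B')) * B := by gcongr
        _ ≤ _ := by nlinarith [mul_nonneg hS' (mul_nonneg hB0 hB0'), mul_nonneg hS (mul_nonneg hB0 hB0')])
  calc _ ≤ t * (L * ((6 * (S + S')) * (B * B') / t)) := by gcongr
    _ = _ := by field_simp

lemma tw_mix (l : ℕ) (s : ℝ) : ∃ C : ℝ, 0 ≤ C ∧ ∀ (M t : ℝ) (v : Pt → ℝ) (B : ℝ), 0 < t → Good M v →
    (∀ a : List (Fin 8), a.length ≤ l → (1 + t) ^ s * nm t (GamWord a v) ≤ B) →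
    ∀ c : List (Fin 8), c.length ≤ l → nm t (GamWord c (fun p => tw s p * v p)) ≤ C * B := by
  obtain ⟨T, hT, htw⟩ := tw_bound l s
  obtain ⟨L, hL, hleib⟩ := nm_leib l
  refine ⟨L * T, by positivity, fun M t v B ht hv hB c hc => ?_⟩
  have := hleib M t (tw s) v ht (Sm_tw s) hv c hc (T * B) (fun a1 a2 h12 _ _ => by
    have h1 : nm t (fun p => GamWord a1 (tw s) p * GamWord a2 v p) ≤ (T * (1 + t) ^ s) * nm t (GamWord a2 v) := by
      apply nm_one ht (by positivity) (hv.gw a2) ((hv.gw a2).mul (Sm_GamWord (Sm_tw s) a1))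
      intro x _
      have := htw a1 (by omega) (t, x) ht
      rw [tw_eq _ (by simpa using ht.le)] at this
      rw [abs_mul]; gcongr
    have h2 := hB a2 (by omega)
    calc _ ≤ _ := h1
      _ = T * ((1 + t) ^ s * nm t (GamWord a2 v)) := by ring
      _ ≤ _ := by gcongr)
  linarith


def Bd (M : ℝ) (n : ℕ) (t B : ℝ) (u : Pt → ℝ) : Prop :=
  Good M u ∧ ∀ a : List (Fin 8), a.length ≤ n → nm t (GamWord a u) ≤ B

lemma Bd.mono {M t B B' : ℝ} {n : ℕ} {u : Pt → ℝ} (h : Bd M n t B u) (hB : B ≤ B') : Bd M n t B' u :=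
  ⟨h.1, fun a ha => (h.2 a ha).trans hB⟩

lemma Bd.nonneg {M t B : ℝ} {n : ℕ} {u : Pt → ℝ} (h : Bd M n t B u) : 0 ≤ B :=
  (nm_nonneg _ _).trans (h.2 [] (by simp))

lemma Bd.add {M t B B' : ℝ} {n : ℕ} {u v : Pt → ℝ} (ht : 0 < t) (h : Bd M n t B u) (h' : Bd M n t B' v) :
    Bd M n t (B + B') (fun p => u p + v p) := by
  refine ⟨h.1.add h'.1, fun a ha => ?_⟩
  have := nm_two ht zero_le_one zero_le_one (h.1.gw a) (h'.1.gw a) ((h.1.add h'.1).gw a) (fun x _ => by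
    rw [GW_add h.1.1 h'.1.1, one_mul, one_mul]; exact abs_add_le _ _)
  have h1 := h.2 a ha
  have h2 := h'.2 a ha
  linarith

lemma Bd.smul {M t B : ℝ} {n : ℕ} {u : Pt → ℝ} (h : Bd M n t B u) (c : ℝ) :
    Bd M n t (|c| * B) (fun p => c * u p) := by
  refine ⟨h.1.smul c, fun a ha => ?_⟩
  rw [GW_smul h.1.1, nm_mulc (GamWord a u) _ c (fun x => rfl)]
  have h1 := h.2 a ha
  gcongr

lemma Bd.sum {ι : Type*} (s : Finset ι) {M t B : ℝ} {n : ℕ} {u : ι → Pt → ℝ} (ht : 0 < t)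
    (h : ∀ i, Bd M n t B (u i)) : Bd M n t (s.card * B) (fun p => ∑ i ∈ s, u i p) := by
  have hg : Good M (fun p => ∑ i ∈ s, u i p) := Good.sum s fun i => (h i).1
  refine ⟨hg, fun a ha => ?_⟩
  have := nm_sum ht s (fun _ => 1) (fun _ _ => zero_le_one) (fun i => GamWord a (u i)) (fun i _ => (h i).1.gw a) (hg.gw a)
    (fun x _ => by
      rw [GW_sum s fun i => (h i).1.1]
      simp only [one_mul]
      exact Finset.abs_sum_le_sum_abs _ _)
  refine this.trans ?_
  calc _ ≤ ∑ i ∈ s, B := Finset.sum_le_sum fun i _ => by rw [one_mul]; exact (h i).2 a ha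
    _ = _ := by rw [Finset.sum_const, nsmul_eq_mul]

lemma nm_comm1 {ι : Type*} [Fintype ι] {D : ι → (Pt → ℝ) → Pt → ℝ} (hD : CommP D)
    (hgood : ∀ M f i, Good M f → Good M (D i f)) (n : ℕ) :
    ∃ C : ℝ, 0 ≤ C ∧ ∀ (M t : ℝ) (f : Pt → ℝ), 0 < t → Good M f → ∀ B,
    (∀ (c : List (Fin 8)) j, c.length ≤ n → nm t (D j (GamWord c f)) ≤ B) →
    ∀ i, Bd M n t (C * B) (D i f) := by
  obtain ⟨C, hC, h⟩ := nm_comm hD hgood n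
  refine ⟨C, hC, fun M t f ht hf B hB i => ⟨hgood _ _ _ hf, fun a ha => ?_⟩⟩
  have := h M t (fun _ => 1) f ht (Sm_const 1) hf B (by simpa only [one_mul] using hB) a i ha
  simpa only [one_mul] using this

def uf (lam : ℝ) (ψ : Pt → ℝ) (α : Fin 4) (p : Pt) : ℝ := tw lam p * Dop α ψ p

def U1 (μ lam : ℝ) (ψ : Pt → ℝ) (p : Pt) : ℝ :=
  uf lam ψ 0 p + (lam * (tw (lam - 1) p * ψ p) + (μ * ψ p +
    (1 / 2) * ∑ j : Fin 3, uf lam ψ j.succ p * uf lam ψ j.succ p))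

def Hop (μ lam γ : ℝ) (ψ : Pt → ℝ) (p : Pt) : ℝ :=
  (-2 * lam) * (tw (-1) p * Dop 0 ψ p) + ((lam * (1 - lam)) * (tw (-2) p * ψ p) +
  ((-(γ - 1)) * (∑ i : Fin 3, U1 μ lam ψ p * D2 (i, i.succ) ψ p) +
  ((-2) * (∑ i : Fin 3, uf lam ψ i.succ p * D2 (i, 0) ψ p) +
  ((-2 * lam) * (∑ i : Fin 3, tw (-1) p * (uf lam ψ i.succ p * dxi i ψ p)) +
  ((-μ) * (∑ i : Fin 3, tw (-lam) p * (uf lam ψ i.succ p * dxi i ψ p)) +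
  (-1) * ∑ q : Fin 3 × Fin 3, (uf lam ψ q.1.succ p * uf lam ψ q.2.succ p) * D2 (q.1, q.2.succ) ψ p)))))

set_option maxHeartbeats 4000000 in
lemma nonlin (μ lam γ M : ℝ) (N l : ℕ) (hlam0 : 0 ≤ lam) (hlam1 : lam ≤ 1) (hM : 0 < M) (hN : 8 ≤ N) (hl : l ≤ N) :
    ∃ C : ℝ, 0 ≤ C ∧ ∀ ψ, Good M ψ → ∀ t δ R X : ℝ, 1 ≤ t → 0 ≤ δ → δ ≤ 1 → 0 ≤ R → 0 ≤ X →
    (∀ (c : List (Fin 8)) α, c.length ≤ N → (1 + t) ^ lam * nm t (Dop α (GamWord c ψ)) ≤ δ) →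
    (∀ (c : List (Fin 8)), c.length ≤ N → nm t (GamWord c ψ) ≤ δ) →
    (∀ (c : List (Fin 8)) α, c.length ≤ l + 1 → nm t (Dop α (GamWord c ψ)) ≤ R) →
    (∀ (c : List (Fin 8)) i, c.length ≤ l → (1 + t) ^ (1 - lam) * nm t (dxi i (GamWord c ψ)) ≤ R) →
    (∀ (c : List (Fin 8)), c.length ≤ l → (1 + t)⁻¹ * nm t (GamWord c ψ) ≤ R) →
    (∀ (c : List (Fin 8)) q, c.length ≤ l → nm t (fun p => Wf t p * D2 q (GamWord c ψ) p) ≤ X) →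
    Bd M l t (C * (R + δ * X) / t) (Hop μ lam γ ψ) := by
  have gDop : ∀ M f (i : Fin 4), Good M f → Good M (Dop i f) := fun M f i h => h.dop i
  have gdxi : ∀ M f (i : Fin 3), Good M f → Good M (dxi i f) := fun M f i h => h.dxi i
  have gD2 : ∀ M f (i : Fin 3 × Fin 4), Good M f → Good M (D2 i f) := fun M f i h => h.D2 i
  obtain ⟨cD, hcD, hDop⟩ := nm_comm1 comm_Dop gDop N
  obtain ⟨cDl, hcDl, hDopl⟩ := nm_comm1 comm_Dop gDop l
  obtain ⟨cx, hcx, hdx⟩ := nm_comm1 comm_dxi gdxi l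
  obtain ⟨c2, hc2, hD2⟩ := nm_comm1 comm_D2 gD2 l
  obtain ⟨cW, hcW, hD2W⟩ := nm_comm comm_D2 gD2 l
  obtain ⟨T1, hT1, tw1⟩ := tw_mix N lam
  obtain ⟨T2, hT2, tw2⟩ := tw_mix N (lam - 1)
  obtain ⟨T3, hT3, tw3⟩ := tw_mix l (-1)
  obtain ⟨T4, hT4, tw4⟩ := tw_mix l (-2)
  obtain ⟨T5, hT5, tw5⟩ := tw_mix l (-lam)
  obtain ⟨P1, hP1, pm1⟩ := prod_mix N N hN le_rfl
  obtain ⟨P2, hP2, pm2⟩ := prod_mix N l hN hl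
  obtain ⟨I, hI, tI⟩ := typeI N l M hM hN hl
  obtain ⟨Ku, hKu⟩ : ∃ K, K = T1 * cD := ⟨_, rfl⟩
  have hKu0 : 0 ≤ Ku := by rw [hKu]; positivity
  obtain ⟨Kq, hKq⟩ : ∃ K, K = P1 * Ku ^ 2 := ⟨_, rfl⟩
  have hKq0 : 0 ≤ Kq := by rw [hKq]; positivity
  obtain ⟨K1, hK1⟩ : ∃ K, K = Ku + (|lam| * T2 + (|μ| + |1 / 2| * (3 * Kq))) := ⟨_, rfl⟩
  have hK10 : 0 ≤ K1 := by rw [hK1]; positivity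
  obtain ⟨J, hJ⟩ : ∃ J, J = I * (c2 + cW) := ⟨_, rfl⟩
  have hJ0 : 0 ≤ J := by rw [hJ]; positivity
  obtain ⟨Kx, hKx⟩ : ∃ K, K = P2 * (Ku * cx) := ⟨_, rfl⟩
  have hKx0 : 0 ≤ Kx := by rw [hKx]; positivity
  refine ⟨|-2 * lam| * (T3 * cDl) + (|lam * (1 - lam)| * T4 + (|-(γ - 1)| * (3 * (J * K1)) +
    (|-2| * (3 * (J * Ku)) + (|-2 * lam| * (3 * (T3 * Kx)) + (|-μ| * (3 * (T5 * Kx)) + |-1| * (9 * (J * Kq))))))),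
    by positivity, fun ψ hψ t δ R X ht1 hδ0 hδ1 hR hX hE1 hE2 h1 h2 h3 hXX => ?_⟩
  have ht : 0 < t := by linarith
  have hu : 0 < 1 + t := by linarith
  have hu1 : 1 ≤ 1 + t := by linarith
  -- small functions
  have su : ∀ α, Bd M N t (Ku * δ) (uf lam ψ α) := by
    intro α
    have hb := hDop M t ψ ht hψ (δ / (1 + t) ^ lam) (fun c j hc => by
      rw [le_div_iff₀ (by positivity), mul_comm]; exact hE1 c j hc) α
    refine ⟨(hψ.dop α).mul (Sm_tw lam), fun a ha => ?_⟩
    have := tw1 M t (Dop α ψ) (cD * δ) ht (hψ.dop α) (fun a ha => by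
      have := hb.2 a ha
      calc _ ≤ (1 + t) ^ lam * (cD * (δ / (1 + t) ^ lam)) := by gcongr
        _ = _ := by field_simp) a ha
    rw [hKu]
    calc _ ≤ _ := this
      _ = _ := by ring
  have sψ : Bd M N t δ ψ := ⟨hψ, hE2⟩
  have sψ2 : Bd M N t (T2 * δ) (fun p => tw (lam - 1) p * ψ p) := by
    refine ⟨hψ.mul (Sm_tw _), tw2 M t ψ δ ht hψ fun a ha => ?_⟩
    have e : (1 + t) ^ (lam - 1) ≤ 1 := Real.rpow_le_one_of_one_le_of_nonpos hu1 (by linarith)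
    have := hE2 a ha
    have h0 := nm_nonneg t (GamWord a ψ)
    nlinarith
  have suu : ∀ α β, Bd M N t (Kq * δ) (fun p => uf lam ψ α p * uf lam ψ β p) := by
    intro α β
    refine ⟨(su β).1.mul (su α).1.1, fun a ha => ?_⟩
    have := pm1 M t _ _ _ _ ht (su α).1 (su β).1 (su α).2 (su β).2 a ha
    refine this.trans ?_
    rw [hKq]
    have : δ * δ ≤ δ := by nlinarith
    calc P1 * (Ku * δ * (Ku * δ)) = P1 * Ku ^ 2 * (δ * δ) := by ring
      _ ≤ _ := by gcongr
  have sU : Bd M N t (K1 * δ) (U1 μ lam ψ) := by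
    have := (su 0).add ht ((sψ2.smul lam).add ht ((sψ.smul μ).add ht
      ((Bd.sum (Finset.univ : Finset (Fin 3)) ht (fun j => suu j.succ j.succ)).smul (1 / 2))))
    refine Bd.mono this (le_of_eq ?_)
    rw [hK1]; simp only [Finset.card_univ, Fintype.card_fin]; push_cast; ring
  -- second derivatives
  have bD2 : ∀ q, Bd M l t (c2 * R) (D2 q ψ) := hD2 M t ψ ht hψ R (fun c q hc => by
    have := h1 (Fin.castLE (by norm_num) q.2 :: c) q.1.succ (by simpa using hc)
    rw [Dop_succ] at this
    rw [D2, Dop_eq_Gam]; exact this)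
  have bD2W : ∀ (a : List (Fin 8)) q, a.length ≤ l → nm t (fun p => Wf t p * GamWord a (D2 q ψ) p) ≤ cW * X :=
    hD2W M t (Wf t) ψ ht (Sm_Wf t) hψ X hXX
  have tyI : ∀ (u : Pt → ℝ) (K : ℝ) q, 0 ≤ K → Bd M N t (K * δ) u →
      Bd M l t (J * K * (R + δ * X) / t) (fun p => u p * D2 q ψ p) := by
    intro u K q hK hb
    refine ⟨(hψ.D2 q).mul hb.1.1, fun a ha => ?_⟩
    rw [le_div_iff₀ ht, mul_comm]
    have := tI t u (D2 q ψ) (K * δ) ((c2 + cW) * (R + X)) ht1 hb.1 (hψ.D2 q) hb.2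
      (fun a ha => ((bD2 q).2 a ha).trans (by nlinarith [mul_nonneg hc2 hX, mul_nonneg hcW hX, mul_nonneg hcW hR]))
      (fun a ha => (bD2W a q ha).trans (by nlinarith [mul_nonneg hc2 hX, mul_nonneg hc2 hR, mul_nonneg hcW hR])) a ha
    refine this.trans ?_
    have e : δ * (R + X) ≤ R + δ * X := by nlinarith
    calc I * (K * δ * ((c2 + cW) * (R + X))) = (I * (c2 + cW)) * K * (δ * (R + X)) := by ring
      _ ≤ (I * (c2 + cW)) * K * (R + δ * X) := by gcongr
      _ = _ := by rw [hJ]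
  -- linear terms
  have l1 : Bd M l t (T3 * cDl * R / t) (fun p => tw (-1) p * Dop 0 ψ p) := by
    have hb := hDopl M t ψ ht hψ R (fun c j hc => h1 c j (by omega)) 0
    refine ⟨(hψ.dop 0).mul (Sm_tw _), fun a ha => (tw3 M t (Dop 0 ψ) (cDl * R / t) ht (hψ.dop 0) (fun a ha => ?_) a ha).trans
      (le_of_eq (by ring))⟩
    have := hb.2 a ha
    rw [Real.rpow_neg_one, le_div_iff₀ ht]
    have h0 := nm_nonneg t (GamWord a (Dop 0 ψ))
    calc (1 + t)⁻¹ * nm t (GamWord a (Dop 0 ψ)) * t = nm t (GamWord a (Dop 0 ψ)) * (t / (1 + t)) := by ring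
      _ ≤ nm t (GamWord a (Dop 0 ψ)) * 1 := by gcongr; rw [div_le_one hu]; linarith
      _ ≤ _ := by linarith
  have l2 : Bd M l t (T4 * R / t) (fun p => tw (-2) p * ψ p) := by
    refine ⟨hψ.mul (Sm_tw _), fun a ha => (tw4 M t ψ (R / t) ht hψ (fun a ha => ?_) a ha).trans
      (le_of_eq (by ring))⟩
    have := h3 a ha
    have h0 := nm_nonneg t (GamWord a ψ)
    have e : (1 + t) ^ (-2 : ℝ) = (1 + t)⁻¹ * (1 + t)⁻¹ := by
      rw [show (-2 : ℝ) = -1 + -1 by norm_num, Real.rpow_add hu, Real.rpow_neg_one]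
    rw [e, le_div_iff₀ ht]
    calc (1 + t)⁻¹ * (1 + t)⁻¹ * nm t (GamWord a ψ) * t = ((1 + t)⁻¹ * nm t (GamWord a ψ)) * (t / (1 + t)) := by ring
      _ ≤ ((1 + t)⁻¹ * nm t (GamWord a ψ)) * 1 := by gcongr; rw [div_le_one hu]; linarith
      _ ≤ _ := by linarith
  -- type III
  have pre : ∀ i : Fin 3, ∀ s ≤ -lam, ∀ a : List (Fin 8), a.length ≤ l →
      (1 + t) ^ s * nm t (GamWord a (fun p => uf lam ψ i.succ p * dxi i ψ p)) ≤ Kx * R / t := by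
    intro i s hs a ha
    have hb := hdx M t ψ ht hψ (R / (1 + t) ^ (1 - lam)) (fun c j hc => by
      rw [le_div_iff₀ (by positivity), mul_comm]; exact h2 c j hc) i
    have h5 := pm2 M t _ _ _ _ ht (su i.succ).1 hb.1 (su i.succ).2 hb.2 a ha
    have e1 : (1 + t) ^ s ≤ (1 + t) ^ (-lam) := Real.rpow_le_rpow_of_exponent_le hu1 hs
    have e2 : (1 + t) ^ (1 - lam) = (1 + t) * (1 + t) ^ (-lam) := by
      rw [sub_eq_add_neg, Real.rpow_add hu, Real.rpow_one]
    have hp : 0 < (1 + t) ^ (-lam) := by positivity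
    calc _ ≤ (1 + t) ^ (-lam) * (P2 * (Ku * δ * (cx * (R / (1 + t) ^ (1 - lam))))) := by
          apply mul_le_mul e1 h5 (nm_nonneg _ _) hp.le
      _ = Kx * R * δ / (1 + t) := by rw [e2, hKx]; field_simp
      _ ≤ Kx * R * 1 / t := by gcongr; linarith
      _ = _ := by ring
  have t3 : ∀ i : Fin 3, Bd M l t (T3 * (Kx * R / t)) (fun p => tw (-1) p * (uf lam ψ i.succ p * dxi i ψ p)) := fun i =>
    ⟨((hψ.dxi i).mul (su i.succ).1.1).mul (Sm_tw _), tw3 M t _ _ ht ((hψ.dxi i).mul (su i.succ).1.1)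
      (pre i (-1) (by linarith))⟩
  have t5 : ∀ i : Fin 3, Bd M l t (T5 * (Kx * R / t)) (fun p => tw (-lam) p * (uf lam ψ i.succ p * dxi i ψ p)) := fun i =>
    ⟨((hψ.dxi i).mul (su i.succ).1.1).mul (Sm_tw _), tw5 M t _ _ ht ((hψ.dxi i).mul (su i.succ).1.1)
      (pre i (-lam) le_rfl)⟩
  have total := (l1.smul (-2 * lam)).add ht ((l2.smul (lam * (1 - lam))).add ht
    (((Bd.sum (Finset.univ : Finset (Fin 3)) ht (fun i => tyI _ K1 (i, i.succ) hK10 sU)).smul (-(γ - 1))).add ht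
    (((Bd.sum (Finset.univ : Finset (Fin 3)) ht (fun i => tyI _ Ku (i, 0) hKu0 (su i.succ))).smul (-2)).add ht
    (((Bd.sum (Finset.univ : Finset (Fin 3)) ht t3).smul (-2 * lam)).add ht
    (((Bd.sum (Finset.univ : Finset (Fin 3)) ht t5).smul (-μ)).add ht
    ((Bd.sum (Finset.univ : Finset (Fin 3 × Fin 3)) ht
      (fun q => tyI _ Kq (q.1, q.2.succ) hKq0 (suu q.1.succ q.2.succ))).smul (-1)))))))
  refine Bd.mono total ?_
  simp only [Finset.card_univ, Fintype.card_fin, Fintype.card_prod]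
  push_cast
  have hS : R / t ≤ (R + δ * X) / t := by
    have : 0 ≤ δ * X := by positivity
    gcongr; linarith
  have hS0 : 0 ≤ R / t := by positivity
  set Q := (R + δ * X) / t with hQ
  have key : ∀ k : ℝ, 0 ≤ k → k * (R / t) ≤ k * Q := fun k hk => by gcongr
  have k1 := key (|-2 * lam| * (T3 * cDl)) (by positivity)
  have k2 := key (|lam * (1 - lam)| * T4) (by positivity)
  have k3 := key (|-2 * lam| * (3 * (T3 * Kx))) (by positivity)
  have k4 := key (|-μ| * (3 * (T5 * Kx))) (by positivity)
  have r1 : ∀ k, k * R / t = k * (R / t) := fun k => by ring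
  have r2 : ∀ k, k * (R + δ * X) / t = k * Q := fun k => by rw [hQ]; ring
  simp only [r1, r2]
  linarith


lemma Gop_good {M : ℝ} (μ lam : ℝ) {φ : Pt → ℝ} (hφ : Good M φ) : Good M (Gop μ lam φ) := by
  refine ⟨Sm_Gop μ lam hφ.1, fun p hp hx => ?_⟩
  have e1 : dt φ p = 0 := hφ.dt.2 p hp hx
  have e2' : dt (fun q => dt φ q) p = 0 := hφ.dt.dt.2 p hp hx
  have e3' : ∀ i, dxi i (fun q => dxi i φ q) p = 0 := fun i => ((hφ.dxi i).dxi i).2 p hp hx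
  simp [Gop, box, e1, e2', e3']

lemma Gop_eq_Hop {μ lam γ : ℝ} {ψ : Pt → ℝ} (h : psiEq μ lam γ ψ) (p : Pt) (hp : 0 < p.1) :
    Gop μ lam ψ p = Hop μ lam γ ψ p := by
  have h := h p hp.le
  have hu : 0 < 1 + p.1 := by linarith
  have e1 : (1 + p.1) ^ (2 * lam) = ((1 + p.1) ^ lam) ^ 2 := by
    rw [two_mul, Real.rpow_add hu, sq]
  have e2 : (1 + p.1) ^ (-1 : ℝ) = (1 + p.1)⁻¹ := by rw [Real.rpow_neg_one]
  have e3 : (1 + p.1) ^ (-2 : ℝ) = ((1 + p.1) ^ 2)⁻¹ := by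
    rw [Real.rpow_neg hu.le]; norm_cast
  have e4 : (1 + p.1) ^ (lam - 1) = (1 + p.1)⁻¹ * (1 + p.1) ^ lam := by
    rw [Real.rpow_sub hu, Real.rpow_one]; ring
  have e5 : (1 + p.1) ^ (-lam) = ((1 + p.1) ^ lam)⁻¹ := Real.rpow_neg hu.le _
  have hL : (1 + p.1) ^ lam ≠ 0 := (Real.rpow_pos_of_pos hu _).ne'
  unfold Gop Hop U1 uf
  simp only [tw_eq _ hp.le, e2, e3, e4, e5, Dop_succ, Dop_zero, D2, Fintype.sum_prod_type]
  unfold Qpsi csq at h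
  simp only [e1, e4] at h
  change box ψ p + _ + _ - _ = _ at h
  generalize (1 + p.1) ^ lam = L at *
  generalize 1 + p.1 = u at *
  have hb : box ψ p = box ψ p := rfl
  simp only [Fin.sum_univ_three] at h ⊢
  have hk : ∀ i, dxi i (fun q => dt ψ q) p = dxi i (dt ψ) p := fun _ => rfl
  have hk' : ∀ i j, dxi i (fun q => dxi j ψ q) p = dxi i (dxi j ψ) p := fun _ _ => rfl
  simp only [hk, hk'] at h
  have ec : L⁻¹ * L = 1 := inv_mul_cancel₀ hL
  have c : ∀ a b : ℝ, L⁻¹ * (L * a * b) = a * b := fun a b => by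
    rw [mul_assoc, ← mul_assoc L⁻¹, ec, one_mul]
  simp only [c]
  simp only [div_eq_mul_inv] at h
  linear_combination h

lemma linN (μ lam M : ℝ) (hμ : 0 < μ) (hM : 0 < M) (n : ℕ) :
    ∃ C : ℝ, 0 ≤ C ∧ ∀ ψ, Good M ψ → ∀ t R : ℝ, 1 ≤ t → 0 ≤ R →
    (∀ (c : List (Fin 8)) α, c.length ≤ n + 1 → nm t (Dop α (GamWord c ψ)) ≤ R) →
    (∀ (c : List (Fin 8)) i, c.length ≤ n → (1 + t) ^ (1 - lam) * nm t (dxi i (GamWord c ψ)) ≤ R) →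
    (∀ (c : List (Fin 8)), c.length ≤ n → t * nm t (GamWord c (Gop μ lam ψ)) ≤ R) →
    ∀ b : List (Fin 8), b.length ≤ n → (∀ q, nm t (fun p => Wf t p * D2 q (GamWord b ψ) p) ≤ C * R) ∧
      (t * (1 + t) ^ (-lam)) * nm t (dt (GamWord b ψ)) ≤ C * R := by
  obtain ⟨CL, hCL, hlin⟩ := lin μ lam M hμ hM
  induction n with
  | zero =>
    refine ⟨CL, hCL, fun ψ hψ t R ht hR h1 h2 h3 b hb => ?_⟩
    obtain rfl : b = [] := by simpa using hb
    exact hlin ψ hψ t R ht hR (fun c α hc => h1 c α (by simpa using hc)) (fun i => h2 [] i (by simp))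
      (h3 [] (by simp))
  | succ n ih =>
    obtain ⟨C0, hC0, ih⟩ := ih
    obtain ⟨Cg, hCg, hg⟩ := Gb_bound μ lam (n + 1)
    set s : Finset (List (Fin 8) ⊕ List (Fin 8)) := (WD (n+1)).disjSum (WD n) with hs
    refine ⟨CL * (1 + Cg * s.card * (1 + C0)), by positivity, fun ψ hψ t R ht hR h1 h2 h3 b hb => ?_⟩
    have ht0 : 0 < t := by linarith
    have hu : 0 < 1 + t := by linarith
    have ihh := ih ψ hψ t R ht hR (fun c α hc => h1 c α (by omega)) (fun c i hc => h2 c i (by omega))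
      (fun c hc => h3 c (by omega))
    have gtw : ∀ d, Good M (fun p => tw (-lam) p * dt (GamWord d ψ) p) := fun d =>
      (hψ.gw d).dt.mul (Sm_tw _)
    have key : nm t (Gop μ lam (GamWord b ψ)) ≤ Cg * s.card * ((1 + C0) * R / t) := by
      refine nm_tr (M := M) ht0 s (Sum.elim (fun c => GamWord c (Gop μ lam ψ))
        (fun d p => tw (-lam) p * dt (GamWord d ψ) p)) ?_ (Gop_good _ _ (hψ.gw b)) hCg ?_ ?_
      · rintro (c | d) _
        · exact (Gop_good _ _ hψ).gw c
        · exact gtw d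
      · intro x hx B hB
        refine hg b hb ψ hψ.1 (t, x) ht0 B (fun c hc => ?_) (fun d hd => ?_)
        · exact hB (Sum.inl c) (Finset.inl_mem_disjSum.2 (mem_WD.2 hc))
        · have := hB (Sum.inr d) (Finset.inr_mem_disjSum.2 (mem_WD.2 (by omega)))
          simp only [Sum.elim_inr, abs_mul, abs_of_pos (tw_pos _ _)] at this
          exact this
      · rintro (c | d) hcd
        · have := h3 c (mem_WD.1 (Finset.inl_mem_disjSum.1 hcd))
          rw [Sum.elim_inl, le_div_iff₀ ht0, mul_comm]
          nlinarith [mul_nonneg hC0 hR]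
        · have := (ihh d (mem_WD.1 (Finset.inr_mem_disjSum.1 hcd))).2
          rw [Sum.elim_inr, le_div_iff₀ ht0, mul_comm, nm_mulc (dt (GamWord d ψ)) _ ((1 + t) ^ (-lam)) (fun x => by
            rw [tw_eq _ (by simpa using ht0.le)]), abs_of_pos (Real.rpow_pos_of_pos hu _)]
          nlinarith [mul_nonneg hC0 hR]
    have key2 : t * nm t (Gop μ lam (GamWord b ψ)) ≤ Cg * s.card * (1 + C0) * R := by
      calc _ ≤ t * (Cg * s.card * ((1 + C0) * R / t)) := by gcongr
        _ = _ := by field_simp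
    have hk0 : 0 ≤ Cg * s.card * (1 + C0) := by positivity
    have hRR : R ≤ (1 + Cg * s.card * (1 + C0)) * R := by nlinarith [mul_nonneg hk0 hR]
    have := hlin (GamWord b ψ) (hψ.gw b) t ((1 + Cg * s.card * (1 + C0)) * R) ht (by positivity)
      (fun c α hc => by
        rw [← GamWord_append]
        exact (h1 _ α (by rw [List.length_append]; omega)).trans hRR)
      (fun i => (h2 b i hb).trans hRR) (key2.trans (by nlinarith))
    simpa only [mul_assoc] using this


lemma mainBig (μ lam γ M : ℝ) (N l : ℕ) (hμ : 0 < μ) (hlam0 : 0 ≤ lam) (hlam1 : lam ≤ 1) (hM : 0 < M)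
    (hN : 8 ≤ N) (hl : l ≤ N) :
    ∃ C : ℝ, 0 ≤ C ∧ ∃ δ : ℝ, 0 < δ ∧ ∀ ψ, Good M ψ → psiEq μ lam γ ψ → ∀ t R δ' : ℝ, 1 ≤ t → 0 ≤ R →
    0 ≤ δ' → δ' ≤ δ →
    (∀ (c : List (Fin 8)) α, c.length ≤ N → (1 + t) ^ lam * nm t (Dop α (GamWord c ψ)) ≤ δ') →
    (∀ (c : List (Fin 8)), c.length ≤ N → nm t (GamWord c ψ) ≤ δ') →
    (∀ (c : List (Fin 8)) α, c.length ≤ l + 1 → nm t (Dop α (GamWord c ψ)) ≤ R) →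
    (∀ (c : List (Fin 8)) i, c.length ≤ l → (1 + t) ^ (1 - lam) * nm t (dxi i (GamWord c ψ)) ≤ R) →
    (∀ (c : List (Fin 8)), c.length ≤ l → (1 + t)⁻¹ * nm t (GamWord c ψ) ≤ R) →
    ∀ (b : List (Fin 8)) q, b.length ≤ l → nm t (fun p => Wf t p * D2 q (GamWord b ψ) p) ≤ C * R := by
  obtain ⟨Cn, hCn, hnl⟩ := nonlin μ lam γ M N l hlam0 hlam1 hM hN hl
  obtain ⟨CN, hCN, hlN⟩ := linN μ lam M hμ hM l
  obtain ⟨A, hA⟩ : ∃ A : ℝ, A = (WD l).card * 12 * (CN * (1 + Cn)) := ⟨_, rfl⟩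
  have hA0 : 0 ≤ A := by rw [hA]; positivity
  refine ⟨2 * A, by positivity, 1 / (2 * (A + 1)), by positivity,
    fun ψ hψ heq t R δ' ht hR hδ0 hδ hE1 hE2 h1 h2 h3 b q hb => ?_⟩
  have ht0 : 0 < t := by linarith
  have hδA : A * δ' ≤ 1 / 2 := by
    rw [le_div_iff₀ (by positivity)] at hδ
    nlinarith
  have hδ1 : δ' ≤ 1 := by
    rw [le_div_iff₀ (by positivity)] at hδ
    nlinarith
  obtain ⟨X, hX⟩ : ∃ X, X = ∑ c ∈ WD l, ∑ q, nm t (fun p => Wf t p * D2 q (GamWord c ψ) p) := ⟨_, rfl⟩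
  have hXc : ∀ (c : List (Fin 8)) q, c.length ≤ l → nm t (fun p => Wf t p * D2 q (GamWord c ψ) p) ≤ X := by
    intro c q hc
    rw [hX]
    refine le_trans ?_ (Finset.single_le_sum (f := fun c => ∑ q, nm t (fun p => Wf t p * D2 q (GamWord c ψ) p))
      (fun c _ => Finset.sum_nonneg fun q _ => nm_nonneg _ _) (mem_WD.2 hc))
    exact Finset.single_le_sum (f := fun q => nm t (fun p => Wf t p * D2 q (GamWord c ψ) p))
      (fun q _ => nm_nonneg _ _) (Finset.mem_univ q)
  have hX0 : 0 ≤ X := (nm_nonneg _ _).trans (hXc b q hb)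
  have hB := hnl ψ hψ t δ' R X ht hδ0 hδ1 hR hX0 hE1 hE2 h1 h2 h3 hXc
  have hRX : 0 ≤ R + δ' * X := by positivity
  have hRX2 : 0 ≤ Cn * (R + δ' * X) := by positivity
  have hdX : 0 ≤ δ' * X := by positivity
  have hRR : R ≤ (1 + Cn) * (R + δ' * X) := by nlinarith
  have := hlN ψ hψ t ((1 + Cn) * (R + δ' * X)) ht (by positivity) (fun c α hc => (h1 c α hc).trans hRR)
    (fun c i hc => (h2 c i hc).trans hRR) (fun c hc => by
      have e : nm t (GamWord c (Gop μ lam ψ)) = nm t (GamWord c (Hop μ lam γ ψ)) := by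
        unfold nm
        congr 1
        funext x
        exact GW_congr Up_open (fun p hp => Gop_eq_Hop heq p hp) c (t, x) ht0
      rw [e]
      have := hB.2 c hc
      rw [le_div_iff₀ ht0] at this
      nlinarith)
  have hXle : X ≤ A * (R + δ' * X) := by
    rw [hX]
    calc _ ≤ ∑ c ∈ WD l, ∑ q : Fin 3 × Fin 4, CN * ((1 + Cn) * (R + δ' * X)) :=
          Finset.sum_le_sum fun c hc => Finset.sum_le_sum fun q _ => (this c (mem_WD.1 hc)).1 q
      _ = A * (R + δ' * X) := by
          rw [hA]; simp; ring
      _ = _ := by rw [hX]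
  have h4 := hXc b q hb
  nlinarith


lemma Good.zero {M : ℝ} {f : Pt → ℝ} (h : Good M f) {t : ℝ} (ht : 0 ≤ t) {x : E3} (hx : t + M < ‖x‖) :
    f (t, x) = 0 := by
  have hc : Filter.Tendsto (fun s : ℝ => f (s, x)) (nhdsWithin t (Set.Ioi t)) (nhds (f (t, x))) := by
    have : Continuous (fun s : ℝ => f (s, x)) := h.1.continuous.comp (by fun_prop)
    exact (this.tendsto t).mono_left nhdsWithin_le_nhds
  have h0 : Filter.Tendsto (fun s : ℝ => f (s, x)) (nhdsWithin t (Set.Ioi t)) (nhds 0) := by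
    refine Filter.Tendsto.congr' ?_ tendsto_const_nhds
    have hlt : ∀ᶠ s in nhdsWithin t (Set.Ioi t), s < ‖x‖ - M :=
      nhdsWithin_le_nhds (eventually_lt_nhds (by linarith))
    filter_upwards [hlt, self_mem_nhdsWithin] with s hs hs2
    exact (h.2 (s, x) (lt_of_le_of_lt ht hs2) (by simp only; linarith)).symm
  exact tendsto_nhds_unique hc h0

lemma Good.cc0 {M : ℝ} {f : Pt → ℝ} (h : Good M f) {t : ℝ} (ht : 0 ≤ t) :
    CC (fun x : E3 => f (t, x)) := by
  refine ⟨h.1.slice t, HasCompactSupport.intro (isCompact_closedBall (0 : E3) (t + M)) fun x hx => ?_⟩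
  exact h.zero ht (by simpa using hx)

lemma energy_bd {lam M : ℝ} {N : ℕ} {ψ : Pt → ℝ} (hψ : Good M ψ) {t d : ℝ} (ht : 0 < t) (hd : 0 ≤ d)
    (hE : energy lam N ψ t ≤ d ^ 2) {c : List (Fin 8)} (hc : c.length ≤ N) :
    (∀ α, (1 + t) ^ lam * nm t (Dop α (GamWord c ψ)) ≤ d) ∧ nm t (GamWord c ψ) ≤ d := by
  have hu : 0 < 1 + t := by linarith
  have hp := Real.rpow_pos_of_pos hu (2 * lam)
  have e1 : (1 + t) ^ (2 * lam) = ((1 + t) ^ lam) ^ 2 := by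
    rw [two_mul, Real.rpow_add hu, sq]
  have h0 := le_wsum (m := N) (fun c => ∫ x : E3, ((1 + t) ^ (2 * lam) *
        ∑ α : Fin 4, (Dop α (GamWord c ψ) (t, x)) ^ 2 + (GamWord c ψ (t, x)) ^ 2))
    (fun c => integral_nonneg fun x => by positivity) hc
  have h1 := h0.trans hE
  have i1 : ∀ α, Integrable (fun x : E3 => (Dop α (GamWord c ψ) (t, x)) ^ 2) := fun α =>
    (((hψ.gw c).dop α).cc ht).sqint
  have i2 : Integrable (fun x : E3 => (GamWord c ψ (t, x)) ^ 2) := ((hψ.gw c).cc ht).sqint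
  rw [integral_add ((integrable_finsetSum _ fun α _ => i1 α).const_mul _) i2, integral_const_mul,
    integral_finsetSum _ fun α _ => i1 α] at h1
  simp only [← nm_sq] at h1
  have hs : ∀ α, nm t (Dop α (GamWord c ψ)) ^ 2 ≤ ∑ α : Fin 4, nm t (Dop α (GamWord c ψ)) ^ 2 := fun α =>
    Finset.single_le_sum (f := fun α => nm t (Dop α (GamWord c ψ)) ^ 2) (fun _ _ => sq_nonneg _) (Finset.mem_univ α)
  refine ⟨fun α => ?_, ?_⟩
  · refine (pow_le_pow_iff_left₀ (mul_nonneg (by positivity) (nm_nonneg _ _)) hd two_ne_zero).1 ?_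
    rw [mul_pow, ← e1]
    nlinarith [hs α, sq_nonneg (nm t (GamWord c ψ)), mul_le_mul_of_nonneg_left (hs α) hp.le]
  · refine (pow_le_pow_iff_left₀ (nm_nonneg _ _) hd two_ne_zero).1 ?_
    have : 0 ≤ (1 + t) ^ (2 * lam) * ∑ α : Fin 4, nm t (Dop α (GamWord c ψ)) ^ 2 := by positivity
    linarith

def Rsum (lam : ℝ) (ψ : Pt → ℝ) (l : ℕ) (t : ℝ) : ℝ :=
  (∑ n ∈ Finset.range (l + 2), ∑ c : Fin n → Fin 8, ∑ α : Fin 4,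
            L2norm (fun y : E3 => Dop α (GamWord (List.ofFn c) ψ) (t, y)))
          + (1 + t) ^ (1 - lam) *
            (∑ n ∈ Finset.range (l + 1), ∑ c : Fin n → Fin 8, ∑ i : Fin 3,
              L2norm (fun y : E3 => dxi i (GamWord (List.ofFn c) ψ) (t, y)))
          + (1 + t)⁻¹ *
            (∑ n ∈ Finset.range (l + 1), ∑ c : Fin n → Fin 8,
              L2norm (fun y : E3 => GamWord (List.ofFn c) ψ (t, y)))

lemma Rsum_bd {lam : ℝ} {ψ : Pt → ℝ} {l : ℕ} {t : ℝ} (ht : 0 ≤ t) :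
    0 ≤ Rsum lam ψ l t ∧
    (∀ (c : List (Fin 8)) α, c.length ≤ l + 1 → nm t (Dop α (GamWord c ψ)) ≤ Rsum lam ψ l t) ∧
    (∀ (c : List (Fin 8)) i, c.length ≤ l → (1 + t) ^ (1 - lam) * nm t (dxi i (GamWord c ψ)) ≤ Rsum lam ψ l t) ∧
    (∀ (c : List (Fin 8)), c.length ≤ l → (1 + t)⁻¹ * nm t (GamWord c ψ) ≤ Rsum lam ψ l t) := by
  have hu : 0 < 1 + t := by linarith
  have hp : 0 < (1 + t) ^ (1 - lam) := Real.rpow_pos_of_pos hu _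
  obtain ⟨S1, hS1⟩ : ∃ S, S = ∑ n ∈ Finset.range (l + 2), ∑ c : Fin n → Fin 8, ∑ α : Fin 4,
            L2norm (fun y : E3 => Dop α (GamWord (List.ofFn c) ψ) (t, y)) := ⟨_, rfl⟩
  obtain ⟨S2, hS2⟩ : ∃ S, S = ∑ n ∈ Finset.range (l + 1), ∑ c : Fin n → Fin 8, ∑ i : Fin 3,
              L2norm (fun y : E3 => dxi i (GamWord (List.ofFn c) ψ) (t, y)) := ⟨_, rfl⟩
  obtain ⟨S3, hS3⟩ : ∃ S, S = ∑ n ∈ Finset.range (l + 1), ∑ c : Fin n → Fin 8,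
              L2norm (fun y : E3 => GamWord (List.ofFn c) ψ (t, y)) := ⟨_, rfl⟩
  have hR : Rsum lam ψ l t = S1 + (1 + t) ^ (1 - lam) * S2 + (1 + t)⁻¹ * S3 := by
    rw [hS1, hS2, hS3]; rfl
  have b1 : ∀ (c : List (Fin 8)) α, c.length ≤ l + 1 → nm t (Dop α (GamWord c ψ)) ≤ S1 := by
    intro c α hc
    rw [hS1]
    refine le_trans ?_ (le_wsum (m := l + 1) (fun c => ∑ α : Fin 4, L2norm (fun y : E3 => Dop α (GamWord c ψ) (t, y)))
      (fun c => Finset.sum_nonneg fun _ _ => L2_nonneg _) hc)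
    exact Finset.single_le_sum (f := fun α => L2norm (fun y : E3 => Dop α (GamWord c ψ) (t, y)))
      (fun _ _ => L2_nonneg _) (Finset.mem_univ α)
  have b2 : ∀ (c : List (Fin 8)) i, c.length ≤ l → nm t (dxi i (GamWord c ψ)) ≤ S2 := by
    intro c i hc
    rw [hS2]
    refine le_trans ?_ (le_wsum (m := l) (fun c => ∑ i : Fin 3, L2norm (fun y : E3 => dxi i (GamWord c ψ) (t, y)))
      (fun c => Finset.sum_nonneg fun _ _ => L2_nonneg _) hc)
    exact Finset.single_le_sum (f := fun i => L2norm (fun y : E3 => dxi i (GamWord c ψ) (t, y)))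
      (fun _ _ => L2_nonneg _) (Finset.mem_univ i)
  have b3 : ∀ (c : List (Fin 8)), c.length ≤ l → nm t (GamWord c ψ) ≤ S3 := by
    intro c hc
    rw [hS3]
    exact le_wsum (m := l) (fun c => L2norm (fun y : E3 => GamWord c ψ (t, y))) (fun c => L2_nonneg _) hc
  have n1 : 0 ≤ S1 := (nm_nonneg _ _).trans (b1 [] 0 (by simp))
  have n2 : 0 ≤ (1 + t) ^ (1 - lam) * S2 := mul_nonneg hp.le ((nm_nonneg _ _).trans (b2 [] 0 (by simp)))
  have n3 : 0 ≤ (1 + t)⁻¹ * S3 := mul_nonneg (by positivity) ((nm_nonneg _ _).trans (b3 [] (by simp)))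
  rw [hR]
  refine ⟨by linarith, fun c α hc => by linarith [b1 c α hc], fun c i hc => ?_, fun c hc => ?_⟩
  · have := mul_le_mul_of_nonneg_left (b2 c i hc) hp.le
    linarith
  · have := mul_le_mul_of_nonneg_left (b3 c hc) (inv_nonneg.2 hu.le)
    linarith

lemma sqrt_le_one_add (a : ℝ) : √(1 + a ^ 2) ≤ 1 + |a| := by
  rw [Real.sqrt_le_left (by positivity)]
  nlinarith [abs_nonneg a, sq_abs a]

lemma perl (μ lam γ M : ℝ) (N l : ℕ) (hμ : 0 < μ) (hlam0 : 0 ≤ lam) (hlam1 : lam ≤ 1) (hM : 0 < M)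
    (hN : 8 ≤ N) (hl : l ≤ N) :
    ∃ C > 0, ∃ δ > 0, ∀ (ψ : Pt → ℝ) (d : ℝ), Good M ψ → psiEq μ lam γ ψ → 0 ≤ d → d ≤ δ →
      (∀ t : ℝ, 0 ≤ t → energy lam N ψ t ≤ d ^ 2) → ∀ t : ℝ, 0 ≤ t →
      (∑ n ∈ Finset.range (l + 1), ∑ b : Fin n → Fin 8, ∑ i : Fin 3, ∑ α : Fin 4,
          L2norm (fun y : E3 => Real.sqrt (1 + (‖y‖ - t) ^ 2) *
            dxi i (Dop α (GamWord (List.ofFn b) ψ)) (t, y))) ≤ C * Rsum lam ψ l t := by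
  obtain ⟨C, hC, δ, hδ, hmain⟩ := mainBig μ lam γ M N l hμ hlam0 hlam1 hM hN hl
  obtain ⟨K, hK, hw⟩ := wsum_le l
  refine ⟨K * (12 * (1 + 2 * C + (3 + M))) + 1, by positivity, δ, hδ, fun ψ d hψ heq hd hdδ hE t ht => ?_⟩
  obtain ⟨hR0, r1, r2, r3⟩ := Rsum_bd (lam := lam) (ψ := ψ) (l := l) ht
  set R := Rsum lam ψ l t
  have each : ∀ (b : List (Fin 8)) i α, b.length ≤ l → L2norm (fun y : E3 => Real.sqrt (1 + (‖y‖ - t) ^ 2) *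
      dxi i (Dop α (GamWord b ψ)) (t, y)) ≤ (1 + 2 * C + (3 + M)) * R := by
    intro b i α hb
    have hg : Good M (dxi i (Dop α (GamWord b ψ))) := ((hψ.gw b).dop α).dxi i
    have hn : nm t (dxi i (Dop α (GamWord b ψ))) ≤ R := by
      rw [Dop_eq_Gam, ← Dop_succ]
      exact r1 (Fin.castLE (by norm_num) α :: b) i.succ (by simpa using hb)
    have hCR : 0 ≤ C * R := by positivity
    have hMR : 0 ≤ M * R := by positivity
    rcases le_total 1 t with h1 | h1
    · have ht0 : 0 < t := by linarith
      have hD := hmain ψ hψ heq t R d h1 hR0 hd hdδ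
        (fun c α hc => (energy_bd hψ ht0 hd (hE t ht) hc).1 α) (fun c hc => (energy_bd hψ ht0 hd (hE t ht) hc).2)
        r1 r2 r3 b (i, α) hb
      have hgW : Good M (fun p => Wf t p * D2 (i, α) (GamWord b ψ) p) := hg.mul (Sm_Wf t)
      have := L2_sum (Finset.univ : Finset (Fin 2)) ![1, 2] (by
          intro j _; fin_cases j <;> simp)
        ![fun y => dxi i (Dop α (GamWord b ψ)) (t, y), fun y => Wf t (t, y) * D2 (i, α) (GamWord b ψ) (t, y)] (by
          intro j _; fin_cases j
          · exact hg.cc ht0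
          · exact hgW.cc ht0) (fun y : E3 => Real.sqrt (1 + (‖y‖ - t) ^ 2) *
            dxi i (Dop α (GamWord b ψ)) (t, y)) (by
          intro x
          simp only [Fin.sum_univ_two, Matrix.cons_val_zero, Matrix.cons_val_one, D2, abs_mul,
            abs_of_nonneg (Real.sqrt_nonneg _)]
          have a1 : |‖x‖ - t| ≤ 2 * |Wf t (t, x)| := by
            have e : (‖x‖ - t) * (t + ‖x‖) = - (Wf t (t, x) * (1 + t)) := by
              rw [Wf_eq]; field_simp; ring
            have e2 : |‖x‖ - t| * (t + ‖x‖) = |Wf t (t, x)| * (1 + t) := by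
              have := congrArg abs e
              rwa [abs_neg, abs_mul, abs_mul, abs_of_nonneg (by positivity : 0 ≤ t + ‖x‖),
                abs_of_nonneg (by positivity : 0 ≤ 1 + t)] at this
            have hx := norm_nonneg x
            have := abs_nonneg (‖x‖ - t)
            have h5 := abs_nonneg (Wf t (t, x))
            by_contra hcon
            push Not at hcon
            have : (2 * |Wf t (t, x)|) * t < |‖x‖ - t| * t := by gcongr
            nlinarith [mul_nonneg (abs_nonneg (‖x‖ - t)) hx, mul_nonneg h5 (by linarith : 0 ≤ t - 1)]
          have a2 := sqrt_le_one_add (‖x‖ - t)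
          have a3 := abs_nonneg (dxi i (Dop α (GamWord b ψ)) (t, x))
          nlinarith [mul_le_mul_of_nonneg_right (a2.trans (add_le_add_right a1 1)) a3])
      simp only [Fin.sum_univ_two, Matrix.cons_val_zero, Matrix.cons_val_one] at this
      refine this.trans ?_
      have hD' : L2norm (fun y => Wf t (t, y) * D2 (i, α) (GamWord b ψ) (t, y)) ≤ C * R := hD
      have hn' : L2norm (fun y => dxi i (Dop α (GamWord b ψ)) (t, y)) ≤ R := hn
      nlinarith
    · have := L2_mono (hg.cc0 ht) (C := 3 + M) (by positivity) (f := fun y : E3 => Real.sqrt (1 + (‖y‖ - t) ^ 2) *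
            dxi i (Dop α (GamWord b ψ)) (t, y)) (by
        intro x
        rcases le_or_gt ‖x‖ (t + M) with hx | hx
        · rw [abs_mul, abs_of_nonneg (Real.sqrt_nonneg _)]
          gcongr
          refine (sqrt_le_one_add _).trans ?_
          have := norm_nonneg x
          have : |‖x‖ - t| ≤ 2 + M := abs_le.2 ⟨by linarith, by linarith⟩
          linarith
        · simp [hg.zero ht hx])
      have hn' : L2norm (fun y => dxi i (Dop α (GamWord b ψ)) (t, y)) ≤ R := hn
      refine this.trans ?_
      have : (3 + M) * L2norm (fun y => dxi i (Dop α (GamWord b ψ)) (t, y)) ≤ (3 + M) * R := by gcongr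
      nlinarith
  have := hw (fun b => ∑ i : Fin 3, ∑ α : Fin 4,
          L2norm (fun y : E3 => Real.sqrt (1 + (‖y‖ - t) ^ 2) *
            dxi i (Dop α (GamWord b ψ)) (t, y))) (12 * ((1 + 2 * C + (3 + M)) * R)) (fun b hb => by
    calc _ ≤ ∑ i : Fin 3, ∑ α : Fin 4, (1 + 2 * C + (3 + M)) * R :=
          Finset.sum_le_sum fun i _ => Finset.sum_le_sum fun α _ => each b i α hb
      _ = _ := by simp; ring)
  refine this.trans ?_
  nlinarith

lemma allL (μ lam γ M : ℝ) (N : ℕ) (hμ : 0 < μ) (hlam0 : 0 ≤ lam) (hlam1 : lam ≤ 1) (hM : 0 < M)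
    (hN : 8 ≤ N) (m : ℕ) (hm : m ≤ N) :
    ∃ C > 0, ∃ δ > 0, ∀ (ψ : Pt → ℝ) (d : ℝ), Good M ψ → psiEq μ lam γ ψ → 0 ≤ d → d ≤ δ →
      (∀ t : ℝ, 0 ≤ t → energy lam N ψ t ≤ d ^ 2) → ∀ l, l ≤ m → ∀ t : ℝ, 0 ≤ t →
      (∑ n ∈ Finset.range (l + 1), ∑ b : Fin n → Fin 8, ∑ i : Fin 3, ∑ α : Fin 4,
          L2norm (fun y : E3 => Real.sqrt (1 + (‖y‖ - t) ^ 2) *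
            dxi i (Dop α (GamWord (List.ofFn b) ψ)) (t, y))) ≤ C * Rsum lam ψ l t := by
  induction m with
  | zero =>
    obtain ⟨C, hC, δ, hδ, h⟩ := perl μ lam γ M N 0 hμ hlam0 hlam1 hM hN hm
    refine ⟨C, hC, δ, hδ, fun ψ d a1 a2 a3 a4 a5 l hl t ht => ?_⟩
    obtain rfl : l = 0 := by omega
    exact h ψ d a1 a2 a3 a4 a5 t ht
  | succ m ih =>
    obtain ⟨C, hC, δ, hδ, h⟩ := perl μ lam γ M N (m + 1) hμ hlam0 hlam1 hM hN hm
    obtain ⟨C', hC', δ', hδ', h'⟩ := ih (by omega)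
    refine ⟨C + C', by positivity, min δ δ', lt_min hδ hδ', fun ψ d a1 a2 a3 a4 a5 l hl t ht => ?_⟩
    have hR := (Rsum_bd (lam := lam) (ψ := ψ) (l := l) ht).1
    rcases hl.lt_or_eq with hl | rfl
    · refine (h' ψ d a1 a2 a3 (a4.trans (min_le_right _ _)) a5 l (by omega) t ht).trans ?_
      nlinarith [mul_nonneg hC.le hR]
    · refine (h ψ d a1 a2 a3 (a4.trans (min_le_left _ _)) a5 t ht).trans ?_
      nlinarith [mul_nonneg hC'.le hR]

theorem weighted_L2_bootstrap
    (μ lam γ M : ℝ) (N : ℕ) (hμ : 0 < μ) (hlam0 : 0 ≤ lam) (hlam1 : lam ≤ 1)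
    (hγ : 1 < γ) (hM : 0 < M) (hN : 8 ≤ N) :
    ∃ C > 0, ∃ δ > 0, ∀ (ψ : Pt → ℝ) (K ε : ℝ),
      ContDiff ℝ (⊤ : ℕ∞) ψ →
      (∀ t : ℝ, 0 ≤ t → ∀ x : E3, t + M < ‖x‖ → ψ (t, x) = 0) →
      psiEq μ lam γ ψ →
      0 < K → 0 < ε →
      (∀ t : ℝ, 0 ≤ t → energy lam N ψ t ≤ K ^ 2 * ε ^ 2) →
      K * ε ≤ δ →
      ∀ l : ℕ, l ≤ N - 1 → ∀ t : ℝ, 0 ≤ t →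
        (∑ n ∈ Finset.range (l + 1), ∑ b : Fin n → Fin 8, ∑ i : Fin 3, ∑ α : Fin 4,
          L2norm (fun y : E3 => Real.sqrt (1 + (‖y‖ - t) ^ 2) *
            dxi i (Dop α (GamWord (List.ofFn b) ψ)) (t, y)))
        ≤ C * (∑ n ∈ Finset.range (l + 2), ∑ c : Fin n → Fin 8, ∑ α : Fin 4,
            L2norm (fun y : E3 => Dop α (GamWord (List.ofFn c) ψ) (t, y)))
          + C * (1 + t) ^ (1 - lam) *
            (∑ n ∈ Finset.range (l + 1), ∑ c : Fin n → Fin 8, ∑ i : Fin 3,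
              L2norm (fun y : E3 => dxi i (GamWord (List.ofFn c) ψ) (t, y)))
          + C * (1 + t)⁻¹ *
            (∑ n ∈ Finset.range (l + 1), ∑ c : Fin n → Fin 8,
              L2norm (fun y : E3 => GamWord (List.ofFn c) ψ (t, y))) := by
  obtain ⟨C, hC, δ, hδ, h⟩ := allL μ lam γ M N hμ hlam0 hlam1 hM hN (N - 1) (by omega)
  refine ⟨C, hC, δ, hδ, fun ψ K ε hψ hsupp heq hK hε hE hKε l hl t ht => ?_⟩
  have hG : Good M ψ := ⟨hψ, fun p hp hx => hsupp p.1 hp.le p.2 hx⟩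
  refine (h ψ (K * ε) hG heq (by positivity) hKε (fun t ht => by rw [mul_pow]; exact hE t ht) l hl t ht).trans
    (le_of_eq ?_)
  unfold Rsum
  ring
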